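/- Let q : ℝ^m → ℝ^l be twice continuously differentiable, Γ := {y : q_i(y) ≤ 0, i=1,…,l}, ȳ ∈ Γ, ȳ* ∈ N̂_Γ(ȳ). Assume that M_q is metrically subregular at (ȳ,0) and metrically regular in the vicinity of ȳ, that for every direction 0 ≠ u ∈ K̄ and every maximal index set J ∈ J̄(u) the mapping (q_i)_{i∈J} is 2-regular at ȳ in direction u, and that N(ȳ) ≠ {0}. Then N_{gph N̂_Γ}(ȳ,ȳ*) = N̂_{gph N̂_Γ}(ȳ,ȳ*) ∪ ⋃_{(v,v*)∈T_{gph N̂_Γ}(ȳ,ȳ*), v≠0} ⋃_{(λ,μ)∈M̄(v,v*), J∈J̄(v)} ⋃_{I⁺(λ,μ)⊂I⁺⊂I⊂J} Q(v,λ,I⁺,I). -/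

import Mathlib

open Set Filter Topology Metric RealInnerProductSpace

noncomputable section

/-- Euclidean space `ℝ^d`. -/
abbrev Em (d : ℕ) : Type := EuclideanSpace ℝ (Fin d)

section General

variable {H : Type*} [NormedAddCommGroup H] [NormedSpace ℝ H]

/-- Bouligand tangent (contingent) cone to `Ω` at `z`. -/
def tanCone (Ω : Set H) (z : H) : Set H :=
  {u | ∃ (t : ℕ → ℝ) (uk : ℕ → H), (∀ k, 0 < t k) ∧ Tendsto t atTop (𝓝 0) ∧
    Tendsto uk atTop (𝓝 u) ∧ ∀ k, z + t k • uk k ∈ Ω}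

open Classical in
/-- The set `V_{ε,δ}(v)`. -/
def Vset (eps delta : ℝ) (v : H) : Set H :=
  if v = 0 then Metric.closedBall 0 eps
  else {0} ∪ {u | u ∈ Metric.closedBall (0:H) eps ∧ u ≠ 0 ∧
    ‖‖u‖⁻¹ • u - ‖v‖⁻¹ • v‖ ≤ delta}

end General

section InnerSp

variable {H : Type*} [NormedAddCommGroup H] [InnerProductSpace ℝ H]

/-- Negative polar cone. -/
def polarCone (K : Set H) : Set H := {x | ∀ y ∈ K, ⟪x, y⟫ ≤ 0}

/-- Regular (Fréchet) normal cone. -/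
def regNormalCone (Ω : Set H) (z : H) : Set H := polarCone (tanCone Ω z)

/-- Limiting (Mordukhovich) normal cone. -/
def limNormalCone (Ω : Set H) (z : H) : Set H :=
  {x | ∃ (zk xk : ℕ → H), (∀ k, zk k ∈ Ω) ∧ (∀ k, xk k ∈ regNormalCone Ω (zk k)) ∧
    Tendsto zk atTop (𝓝 z) ∧ Tendsto xk atTop (𝓝 x)}

end InnerSp

section ProdSp

variable {E F : Type*} [NormedAddCommGroup E] [InnerProductSpace ℝ E]
  [NormedAddCommGroup F] [InnerProductSpace ℝ F]

/-- Negative polar w.r.t. the natural pairing on a product of inner product spaces. -/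
def polarConeP (K : Set (E × F)) : Set (E × F) :=
  {p | ∀ q ∈ K, ⟪p.1, q.1⟫ + ⟪p.2, q.2⟫ ≤ 0}

/-- Regular normal cone in a product space. -/
def regNormalConeP (Ω : Set (E × F)) (z : E × F) : Set (E × F) :=
  polarConeP (tanCone Ω z)

/-- Limiting normal cone in a product space. -/
def limNormalConeP (Ω : Set (E × F)) (z : E × F) : Set (E × F) :=
  {x | ∃ (zk xk : ℕ → E × F), (∀ k, zk k ∈ Ω) ∧
    (∀ k, xk k ∈ regNormalConeP Ω (zk k)) ∧
    Tendsto zk atTop (𝓝 z) ∧ Tendsto xk atTop (𝓝 x)}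

/-- Directional limiting normal cone in a product space. -/
def dirLimNormalConeP (Ω : Set (E × F)) (z u : E × F) : Set (E × F) :=
  {x | ∃ (t : ℕ → ℝ) (uk xk : ℕ → E × F), (∀ k, 0 < t k) ∧ Tendsto t atTop (𝓝 0) ∧
    Tendsto uk atTop (𝓝 u) ∧ Tendsto xk atTop (𝓝 x) ∧
    ∀ k, xk k ∈ regNormalConeP Ω (z + t k • uk k)}

end ProdSp

section Metr

variable {X Y : Type*} [PseudoMetricSpace X] [PseudoMetricSpace Y]

/-- `Ψ` is metrically regular near `(ub, vb)` with modulus `κ`. -/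
def MetricallyRegularNear (Ψ : X → Set Y) (ub : X) (vb : Y) (κ : ℝ) : Prop :=
  ∃ U ∈ 𝓝 ub, ∃ V ∈ 𝓝 vb, ∀ u ∈ U, ∀ v ∈ V,
    EMetric.infEdist u {x | v ∈ Ψ x} ≤ ENNReal.ofReal κ * EMetric.infEdist v (Ψ u)

/-- `Ψ` is metrically subregular at `(ub, vb)`. -/
def MetricallySubregularAt (Ψ : X → Set Y) (ub : X) (vb : Y) : Prop :=
  ∃ κ > (0:ℝ), ∃ U ∈ 𝓝 ub, ∀ u ∈ U,
    EMetric.infEdist u {x | vb ∈ Ψ x} ≤ ENNReal.ofReal κ * EMetric.infEdist vb (Ψ u)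

end Metr

section TwoDiff

variable {m p : ℕ}

/-- `g` is twice Fréchet differentiable at `ȳ`. -/
def TwiceDiffAt (g : Em m → Em p) (yb : Em m) : Prop :=
  (∀ᶠ y in 𝓝 yb, DifferentiableAt ℝ g y) ∧ DifferentiableAt ℝ (fderiv ℝ g) yb

/-- Adjoint (transpose) of a continuous linear map between Euclidean spaces. -/
def adjA (A : Em m →L[ℝ] Em p) : Em p →L[ℝ] Em m := ContinuousLinearMap.adjoint A

end TwoDiff

section Q

variable {m l : ℕ}

/-- The feasible set `Γ = {y : q i y ≤ 0 ∀ i}`. -/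
def Gam (q : Em m → Em l) : Set (Em m) := {y | ∀ i, q y i ≤ 0}

/-- `∇q_i(y)v`. -/
def gradQ (q : Em m → Em l) (y : Em m) (i : Fin l) (v : Em m) : ℝ := fderiv ℝ q y v i

/-- `vᵀ∇²q_i(y)w`. -/
def hessQ (q : Em m → Em l) (y : Em m) (i : Fin l) (v w : Em m) : ℝ :=
  fderiv ℝ (fderiv ℝ q) y v w i

/-- `∇q(y)ᵀλ`. -/
def gradT (q : Em m → Em l) (y : Em m) (lam : Em l) : Em m :=
  ContinuousLinearMap.adjoint (fderiv ℝ q y) lam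

/-- `∇²(λᵀq)(y)v = (vᵀ∇²q(y))ᵀλ`. -/
def hessT (q : Em m → Em l) (y : Em m) (lam : Em l) (v : Em m) : Em m :=
  ContinuousLinearMap.adjoint (fderiv ℝ (fderiv ℝ q) y v) lam

/-- The perturbation mapping `M_q(y) = q(y) - ℝ^l_-`. -/
def Mq (q : Em m → Em l) (y : Em m) : Set (Em l) := {z | ∀ i, q y i ≤ z i}

/-- `M_q` is metrically regular in the vicinity of `ȳ`. -/
def MetricallyRegularInVicinity (q : Em m → Em l) (yb : Em m) : Prop :=
  ∃ V ∈ 𝓝 yb, ∃ κ > (0:ℝ), ∀ y ∈ V, y ≠ yb → (0:Em l) ∈ Mq q y →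
    MetricallyRegularNear (Mq q) y (0:Em l) κ

/-- Active index set `I(y)`. -/
def actI (q : Em m → Em l) (y : Em m) : Set (Fin l) := {i | q y i = 0}

/-- `Ī(v) = {i ∈ I(ȳ) : ∇q_i(ȳ)v = 0}`. -/
def IbarDir (q : Em m → Em l) (yb v : Em m) : Set (Fin l) :=
  {i | q yb i = 0 ∧ gradQ q yb i v = 0}

/-- Linearized cone `T^lin(ȳ)`. -/
def Tlin (q : Em m → Em l) (yb : Em m) : Set (Em m) :=
  {v | ∀ i ∈ actI q yb, gradQ q yb i v ≤ 0}

/-- The normal cone `N_{ℝ^l_-}(q(y))`. -/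
def NRl (q : Em m → Em l) (y : Em m) : Set (Em l) :=
  {mu | (∀ i, 0 ≤ mu i) ∧ ∀ i, q y i ≠ 0 → mu i = 0}

/-- Lagrange multiplier set `Λ(y, y*)`. -/
def Lam (q : Em m → Em l) (y ystar : Em m) : Set (Em l) :=
  {lam | lam ∈ NRl q y ∧ gradT q y lam = ystar}

/-- Directional multiplier set `Λ(y, y*; v)`. -/
def LamDir (q : Em m → Em l) (yb ystar v : Em m) : Set (Em l) :=
  {lam | lam ∈ Lam q yb ystar ∧ ∀ lam' ∈ Lam q yb ystar,
    ∑ i, lam' i * hessQ q yb i v v ≤ ∑ i, lam i * hessQ q yb i v v}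

/-- The set `M̄(v, v*)`. -/
def Mbar (q : Em m → Em l) (yb ystar v vstar : Em m) : Set (Em l × Em l) :=
  {p | p.1 ∈ LamDir q yb ystar v ∧ p.2 ∈ tanCone (NRl q yb) p.1 ∧
    vstar = hessT q yb p.1 v + gradT q yb p.2}

/-- `I⁺(λ)`. -/
def Iplus (lam : Em l) : Set (Fin l) := {i | 0 < lam i}

/-- `I⁺(λ, μ)`. -/
def IplusLM (lam mu : Em l) : Set (Fin l) := {i | 0 < lam i} ∪ {i | lam i = 0 ∧ 0 < mu i}

/-- `P_{I⁺,I}`. -/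
def Pset (Ip I : Set (Fin l)) : Set (Em l) :=
  {mu | (∀ i ∉ I, mu i = 0) ∧ ∀ i ∈ I \ Ip, 0 ≤ mu i}

/-- `K̄_{I⁺,I}`. -/
def Kcone (q : Em m → Em l) (yb : Em m) (Ip I : Set (Fin l)) : Set (Em m) :=
  {w | (∀ i ∈ Ip, gradQ q yb i w = 0) ∧ ∀ i ∈ I \ Ip, gradQ q yb i w ≤ 0}

/-- `K̄_{I⁺,I}(v)`. -/
def KconeDir (q : Em m → Em l) (yb : Em m) (Ip I : Set (Fin l)) (v : Em m) : Set (Em m) :=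
  {w | w ∈ Kcone q yb Ip I ∧ ∃ z : Em m,
    (∀ i ∈ Ip, gradQ q yb i z + hessQ q yb i v w = 0) ∧
    ∀ i ∈ I \ Ip, gradQ q yb i z + hessQ q yb i v w ≤ 0}

/-- `Q(v, λ, I⁺, I)`. -/
def Qset (q : Em m → Em l) (yb v : Em m) (lam : Em l) (Ip I : Set (Fin l)) :
    Set (Em m × Em m) :=
  {p | p.2 ∈ KconeDir q yb Ip I v ∧
    p.1 + hessT q yb lam p.2 ∈ polarCone (KconeDir q yb Ip I v)}

/-- `Q₀(v, λ, I⁺, I)`. -/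
def Qzero (q : Em m → Em l) (yb v : Em m) (lam : Em l) (Ip I : Set (Fin l)) :
    Set (Em m × Em m) :=
  {p | p.2 ∈ KconeDir q yb Ip I v ∧
    ∃ mu ∈ Pset Ip I, p.1 + hessT q yb lam p.2 = gradT q yb mu}

/-- `Ξ̄(v)`, the feasible set of the dual program. -/
def Xibar (q : Em m → Em l) (yb v : Em m) : Set (Em m) :=
  {z | ∀ i ∈ actI q yb, gradQ q yb i z + hessQ q yb i v v ≤ 0}

/-- `J(z)`. -/
def Jset (q : Em m → Em l) (yb v z : Em m) : Set (Fin l) :=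
  {i | i ∈ IbarDir q yb v ∧ gradQ q yb i z + hessQ q yb i v v = 0}

/-- `J̄(v)`. -/
def Jbar (q : Em m → Em l) (yb v : Em m) : Set (Set (Fin l)) :=
  {J | ∃ z ∈ Xibar q yb v, J = Jset q yb v z}

/-- `J` is a maximal element of `J̄(v)`. -/
def MaximalJ (q : Em m → Em l) (yb v : Em m) (J : Set (Fin l)) : Prop :=
  J ∈ Jbar q yb v ∧ ∀ J' ∈ Jbar q yb v, J ⊆ J' → J = J'

/-- `(q_i)_{i ∈ J}` is 2-regular at `ȳ` in direction `v`. -/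
def TwoRegular (q : Em m → Em l) (yb v : Em m) (J : Set (Fin l)) : Prop :=
  ∀ α : Fin l → ℝ, ∃ u w : Em m,
    (∀ i ∈ J, gradQ q yb i u + hessQ q yb i v w = α i) ∧ ∀ i ∈ J, gradQ q yb i w = 0

/-- 2-LICQ holds at `ȳ` in direction `v`. -/
def TwoLICQ (q : Em m → Em l) (yb v : Em m) : Prop :=
  ∃ eps > (0:ℝ), ∃ delta > (0:ℝ), ∀ y : Em m, y - yb ∈ Vset eps delta v →
    y ∈ Gam q → y ≠ yb → TwoRegular q yb v (actI q y)

/-- Gradient vector of `q_i` at `y`. -/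
def gradF (q : Em m → Em l) (y : Em m) (i : Fin l) : Em m := gradient (fun x => q x i) y

/-- LICQ holds at `y`. -/
def LICQat (q : Em m → Em l) (y : Em m) : Prop :=
  LinearIndependent ℝ (fun i : actI q y => gradF q y (i : Fin l))

/-- Graph of the regular normal cone mapping `N̂_Γ`. -/
def GphNhat (q : Em m → Em l) : Set (Em m × Em m) :=
  {p | p.1 ∈ Gam q ∧ p.2 ∈ regNormalCone (Gam q) p.1}

/-- Critical cone `K̄ = T_Γ(ȳ) ∩ (ȳ*)^⊥`. -/
def Kbar (q : Em m → Em l) (yb ystar : Em m) : Set (Em m) :=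
  {v | v ∈ tanCone (Gam q) yb ∧ ⟪ystar, v⟫ = 0}

/-- The null space `N(ȳ)` of the active gradients. -/
def Nspace (q : Em m → Em l) (yb : Em m) : Set (Em m) :=
  {v | ∀ i ∈ actI q yb, gradQ q yb i v = 0}

/-- The union `⋃_{(λ,μ),J} ⋃_{I⁺,I} Q(v,λ,I⁺,I)`. -/
def unionQ (q : Em m → Em l) (yb ystar v vstar : Em m) : Set (Em m × Em m) :=
  {p | ∃ lam mu : Em l, (lam, mu) ∈ Mbar q yb ystar v vstar ∧
    ∃ J ∈ Jbar q yb v, ∃ Ip I : Set (Fin l),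
      IplusLM lam mu ⊆ Ip ∧ Ip ⊆ I ∧ I ⊆ J ∧ p ∈ Qset q yb v lam Ip I}

/-- The cone `N¹_{gph N̂_Γ}((ȳ,ȳ*);(0,v*))`. -/
def N1cone (q : Em m → Em l) (yb ystar vstar : Em m) : Set (Em m × Em m) :=
  {p | ∃ (t : ℕ → ℝ) (vk vks wks wk : ℕ → Em m),
    (∀ k, 0 < t k) ∧ Tendsto t atTop (𝓝 0) ∧ (∀ k, vk k ≠ 0) ∧
    Tendsto vk atTop (𝓝 0) ∧ Tendsto vks atTop (𝓝 vstar) ∧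
    Tendsto (fun k => (wks k, wk k)) atTop (𝓝 p) ∧
    ∀ k, (wks k, wk k) ∈ regNormalConeP (GphNhat q) (yb + t k • vk k, ystar + t k • vks k)}

/-- The cone `N²_{gph N̂_Γ}((ȳ,ȳ*);(0,v*))`. -/
def N2cone (q : Em m → Em l) (yb ystar vstar : Em m) : Set (Em m × Em m) :=
  {p | ∃ (t : ℕ → ℝ) (vks wks wk : ℕ → Em m),
    (∀ k, 0 < t k) ∧ Tendsto t atTop (𝓝 0) ∧
    Tendsto vks atTop (𝓝 vstar) ∧
    Tendsto (fun k => (wks k, wk k)) atTop (𝓝 p) ∧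
    ∀ k, (wks k, wk k) ∈ regNormalConeP (GphNhat q) (yb, ystar + t k • vks k)}

/-- The union over unit directions in `K̄` appearing in Theorem 7(2). -/
def unionQdir (q : Em m → Em l) (yb ystar vstar : Em m) : Set (Em m × Em m) :=
  {p | ∃ vt : Em m, vt ∈ Kbar q yb ystar ∧ ‖vt‖ = 1 ∧
    ∃ lam mu : Em l, (lam, mu) ∈ Mbar q yb ystar 0 vstar ∧ lam ∈ LamDir q yb ystar vt ∧
    ∃ J ∈ Jbar q yb vt, ∃ Ip I : Set (Fin l),
      IplusLM lam mu ⊆ Ip ∧ Ip ⊆ I ∧ I ⊆ J ∧ p ∈ Qset q yb vt lam Ip I}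

/-- `Λ̄^E(v)`. -/
def LamE (q : Em m → Em l) (yb ystar v : Em m) : Set (Em l) :=
  LamDir q yb ystar v ∩ convexHull ℝ (Set.extremePoints ℝ (Lam q yb ystar))

open Classical in
/-- `Λ̃̄^E(v)`. -/
def LamEt (q : Em m → Em l) (yb ystar v : Em m) : Set (Em l) :=
  if v = 0 then convexHull ℝ (⋃ u ∈ Kbar q yb ystar \ {0}, LamE q yb ystar u)
  else LamE q yb ystar v

/-- The union appearing in Proposition 5 (with `Q₀` and `Λ̃̄^E(ṽ)`). -/
def unionQ0 (q : Em m → Em l) (yb ystar vstar vt : Em m) : Set (Em m × Em m) :=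
  {p | ∃ lam mu : Em l, (lam, mu) ∈ Mbar q yb ystar 0 vstar ∧ lam ∈ LamEt q yb ystar vt ∧
    ∃ J ∈ Jbar q yb vt, ∃ Ip I : Set (Fin l),
      IplusLM lam mu ⊆ Ip ∧ Ip ⊆ I ∧ I ⊆ J ∧ p ∈ Qzero q yb vt lam Ip I}

end Q

section Aubin

/-- The Aubin property of `S` around `(xb, yb)`. -/
def AubinProperty {n m : ℕ} (S : Em n → Set (Em m)) (xb : Em n) (yb : Em m) : Prop :=
  ∃ U ∈ 𝓝 xb, ∃ V ∈ 𝓝 yb, ∃ κ : ℝ, 0 ≤ κ ∧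
    ∀ x1 ∈ U, ∀ x2 ∈ U, ∀ y ∈ S x1 ∩ V, ∃ y' ∈ S x2, ‖y - y'‖ ≤ κ * ‖x1 - x2‖

end Aubin

end

theorem exists_coeff_bound_of_indep {ι E : Type*} [Fintype ι] [NormedAddCommGroup E]
    [NormedSpace ℝ E] (a : ι → E) (s : Set ι)
    (h : ∀ g : ι → ℝ, (∀ i ∉ s, g i = 0) → ∑ i, g i • a i = 0 → g = 0) :
    ∃ C : ℝ, 0 ≤ C ∧ ∀ g : ι → ℝ, (∀ i ∉ s, g i = 0) →
      ∀ i, |g i| ≤ C * ‖∑ i, g i • a i‖ := by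
  let S : Submodule ℝ (ι → ℝ) :=
    { carrier := {g | ∀ i ∉ s, g i = 0}
      add_mem' := fun {x y} hx hy i hi => by simp [hx i hi, hy i hi]
      zero_mem' := fun i _ => rfl
      smul_mem' := fun c x hx i hi => by simp [hx i hi] }
  let T : S →ₗ[ℝ] E := (Fintype.linearCombination ℝ a).domRestrict S
  have hT : ∀ g : S, T g = ∑ i, (g : ι → ℝ) i • a i := fun g => by
    simp [T, Fintype.linearCombination_apply]
  have hker : LinearMap.ker T = ⊥ := by
    rw [LinearMap.ker_eq_bot']
    intro g hg
    rw [hT] at hg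
    exact Subtype.ext (h g g.2 hg)
  obtain ⟨K, -, hK⟩ := T.exists_antilipschitzWith hker
  refine ⟨K, K.2, fun g hg i => ?_⟩
  have h1 := hK.le_mul_dist (⟨g, hg⟩ : S) 0
  rw [map_zero, dist_zero_right, dist_zero_right, hT] at h1
  exact (norm_le_pi_norm g i).trans h1

theorem exists_indep_nonneg_comb {ι E : Type*} [Fintype ι] [NormedAddCommGroup E]
    [NormedSpace ℝ E] (a : ι → E) (c : ι → ℝ) (hc : ∀ i, 0 ≤ c i) :
    ∃ c' : ι → ℝ, (∀ i, 0 ≤ c' i) ∧ (∀ i, c i = 0 → c' i = 0) ∧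
      ∑ i, c' i • a i = ∑ i, c i • a i ∧
      ∀ g : ι → ℝ, (∀ i ∉ {i | c' i ≠ 0}, g i = 0) → ∑ i, g i • a i = 0 → g = 0 := by
  classical
  induction hn : (Finset.univ.filter fun i => c i ≠ 0).card using Nat.strong_induction_on
    generalizing c with
  | _ n ih =>
  by_cases hli : ∀ g : ι → ℝ, (∀ i ∉ {i | c i ≠ 0}, g i = 0) → ∑ i, g i • a i = 0 → g = 0
  · exact ⟨c, hc, fun _ h => h, rfl, hli⟩
  push Not at hli
  obtain ⟨g, hgs, hg0, hgne⟩ := hli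
  obtain ⟨g, hgs, hg0, i1, hi1⟩ : ∃ g : ι → ℝ, (∀ i, c i = 0 → g i = 0) ∧
      ∑ i, g i • a i = 0 ∧ ∃ i, 0 < g i := by
    obtain ⟨i, hi⟩ := Function.ne_iff.1 hgne
    rcases lt_or_gt_of_ne hi with h | h
    · refine ⟨-g, fun j hj => ?_, ?_, i, by simpa using h⟩
      · simpa using hgs j (by simpa using hj)
      · simpa using hg0
    · exact ⟨g, fun j hj => hgs j (by simpa using hj), hg0, i, h⟩
  obtain ⟨i0, hi0, hmin⟩ := Finset.exists_min_image (Finset.univ.filter fun i => 0 < g i)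
    (fun i => c i / g i) ⟨i1, by simpa using hi1⟩
  simp only [Finset.mem_filter, Finset.mem_univ, true_and] at hi0 hmin
  set t := c i0 / g i0 with ht
  have ht0 : 0 ≤ t := div_nonneg (hc _) hi0.le
  have hd : ∀ i, 0 ≤ c i - t * g i := by
    intro i
    rcases lt_or_ge 0 (g i) with h | h
    · have := hmin i h
      rw [le_div_iff₀ h] at this
      linarith
    · nlinarith [hc i]
  have hsub : ∀ i, c i = 0 → c i - t * g i = 0 := fun i hi => by simp [hi, hgs i hi]
  have hci0 : c i0 ≠ 0 := fun h => by simp [hgs i0 h] at hi0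
  obtain ⟨c', h1, h2, h3, h4⟩ := ih _ (by
    rw [← hn]
    apply Finset.card_lt_card
    rw [Finset.ssubset_iff_of_subset]
    · refine ⟨i0, by simpa using hci0, ?_⟩
      simp only [Finset.mem_filter, Finset.mem_univ, true_and, not_not]
      show c i0 - t * g i0 = 0
      rw [ht, div_mul_cancel₀ _ hi0.ne', sub_self]
    · intro i
      simp only [Finset.mem_filter, Finset.mem_univ, true_and]
      exact fun h hh => h (hsub i hh)) (fun i => c i - t * g i) hd rfl
  refine ⟨c', h1, fun i hi => h2 i (hsub i hi), ?_, h4⟩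
  rw [h3]
  simp only [sub_smul, Finset.sum_sub_distrib, mul_smul, ← Finset.smul_sum, hg0, smul_zero,
    sub_zero]

/-- A conic combination can be rewritten, on the same support, with coefficients controlled by the
norm of its value. -/
theorem exists_bounded_nonneg_comb {ι E : Type*} [Fintype ι] [NormedAddCommGroup E]
    [NormedSpace ℝ E] (a : ι → E) :
    ∃ C : ℝ, 0 ≤ C ∧ ∀ c : ι → ℝ, (∀ i, 0 ≤ c i) → ∃ c' : ι → ℝ, (∀ i, 0 ≤ c' i) ∧
      (∀ i, c i = 0 → c' i = 0) ∧ ∑ i, c' i • a i = ∑ i, c i • a i ∧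
      ∀ i, c' i ≤ C * ‖∑ i, c i • a i‖ := by
  classical
  have key : ∀ s : Set ι, ∃ C : ℝ, 0 ≤ C ∧
      ((∀ g : ι → ℝ, (∀ i ∉ s, g i = 0) → ∑ i, g i • a i = 0 → g = 0) →
      ∀ g : ι → ℝ, (∀ i ∉ s, g i = 0) → ∀ i, |g i| ≤ C * ‖∑ i, g i • a i‖) := by
    intro s
    by_cases h : ∀ g : ι → ℝ, (∀ i ∉ s, g i = 0) → ∑ i, g i • a i = 0 → g = 0
    · obtain ⟨C, h0, h1⟩ := exists_coeff_bound_of_indep a s h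
      exact ⟨C, h0, fun _ => h1⟩
    · exact ⟨0, le_rfl, fun h' => absurd h' h⟩
  choose C hC0 hC using key
  refine ⟨∑ s, C s, Finset.sum_nonneg fun s _ => hC0 s, fun c hc => ?_⟩
  obtain ⟨c', h1, h2, h3, h4⟩ := exists_indep_nonneg_comb a c hc
  refine ⟨c', h1, h2, h3, fun i => ?_⟩
  have h5 := hC _ h4 c' (fun i hi => by simpa using hi) i
  rw [h3] at h5
  refine (le_abs_self _).trans (h5.trans ?_)
  gcongr
  exact Finset.single_le_sum (fun s _ => hC0 s) (Finset.mem_univ _)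

/-- **Farkas' lemma** for finitely many generators. -/
theorem farkas_nonneg {ι E : Type*} [Fintype ι] [NormedAddCommGroup E] [InnerProductSpace ℝ E]
    [FiniteDimensional ℝ E] (a : ι → E) (x : E)
    (h : ∀ d : E, (∀ i, ⟪a i, d⟫ ≤ 0) → ⟪x, d⟫ ≤ 0) :
    ∃ c : ι → ℝ, (∀ i, 0 ≤ c i) ∧ ∑ i, c i • a i = x := by
  classical
  set K : Set E := {y | ∃ c : ι → ℝ, (∀ i, 0 ≤ c i) ∧ ∑ i, c i • a i = y} with hK
  by_contra hx
  have hxK : x ∉ K := hx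
  have hconv : Convex ℝ K := by
    rintro _ ⟨c, hc, rfl⟩ _ ⟨c', hc', rfl⟩ s t hs ht -
    refine ⟨fun i => s * c i + t * c' i, fun i =>
      add_nonneg (mul_nonneg hs (hc i)) (mul_nonneg ht (hc' i)), ?_⟩
    simp only [add_smul, mul_smul, Finset.sum_add_distrib, Finset.smul_sum]
  have hclosed : IsClosed K := by
    obtain ⟨C, hC0, hC⟩ := exists_bounded_nonneg_comb a
    rw [← isSeqClosed_iff_isClosed]
    intro y y0 hy hlim
    obtain ⟨B, hB⟩ := hlim.norm.bddAbove_range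
    have hB' : ∀ n, ‖y n‖ ≤ B := fun n => hB ⟨n, rfl⟩
    have : ∀ n, ∃ c : ι → ℝ, (∀ i, 0 ≤ c i) ∧ ∑ i, c i • a i = y n ∧ ∀ i, c i ≤ C * B := by
      intro n
      obtain ⟨c, hc, hcy⟩ := hy n
      obtain ⟨c', h1, -, h3, h4⟩ := hC c hc
      refine ⟨c', h1, h3.trans hcy, fun i => (h4 i).trans ?_⟩
      rw [hcy]
      exact mul_le_mul_of_nonneg_left (hB' n) hC0
    choose c hc0 hcy hcB using this
    have hmem : ∀ n, c n ∈ Set.Icc (0 : ι → ℝ) (fun _ => C * B) :=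
      fun n => ⟨fun i => hc0 n i, fun i => hcB n i⟩
    obtain ⟨c0, hc0m, φ, hφ, hcφ⟩ := isCompact_Icc.tendsto_subseq hmem
    refine ⟨c0, fun i => hc0m.1 i, ?_⟩
    have h1 : Tendsto (fun n => ∑ i, c (φ n) i • a i) atTop (𝓝 (∑ i, c0 i • a i)) :=
      tendsto_finsetSum _ fun i _ => ((tendsto_pi_nhds.1 hcφ) i).smul_const _
    have h2 : Tendsto (fun n => ∑ i, c (φ n) i • a i) atTop (𝓝 y0) := by
      simp only [hcy]
      exact hlim.comp hφ.tendsto_atTop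
    exact tendsto_nhds_unique h1 h2
  obtain ⟨f, u, hfu, hux⟩ := geometric_hahn_banach_closed_point hconv hclosed hxK
  have h0K : (0 : E) ∈ K := ⟨0, fun _ => le_rfl, by simp⟩
  have hu0 : 0 < u := by simpa using hfu 0 h0K
  have hrep : ∀ y, ⟪y, (InnerProductSpace.toDual ℝ E).symm f⟫ = f y := fun y => by
    rw [real_inner_comm, InnerProductSpace.toDual_symm_apply]
  have hle := h ((InnerProductSpace.toDual ℝ E).symm f) (fun i => by
    rw [hrep]
    by_contra! hpos
    have hm : ((u / f (a i)) • a i) ∈ K := by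
      refine ⟨fun j => if j = i then u / f (a i) else 0, fun j => ?_, by simp⟩
      dsimp only
      split_ifs
      · positivity
      · exact le_rfl
    have := hfu _ hm
    rw [map_smul, smul_eq_mul, div_mul_cancel₀ _ hpos.ne'] at this
    exact lt_irrefl _ this)
  rw [hrep] at hle
  linarith

/-- Farkas' lemma with sign-free multipliers on `F`. -/
theorem farkas_Pset {l : ℕ} {E : Type*} [NormedAddCommGroup E] [InnerProductSpace ℝ E]
    [FiniteDimensional ℝ E] (a : Fin l → E) (x : E) (F I : Set (Fin l)) (hFI : F ⊆ I)
    (h : ∀ d : E, (∀ i ∈ F, ⟪a i, d⟫ = 0) → (∀ i ∈ I \ F, ⟪a i, d⟫ ≤ 0) → ⟪x, d⟫ ≤ 0) :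
    ∃ c ∈ Pset F I, ∑ i, c i • a i = x := by
  classical
  let b : Fin l ⊕ Fin l → E := Sum.elim (fun i => if i ∈ I then a i else 0)
    (fun i => if i ∈ F then - a i else 0)
  obtain ⟨c, hc, hcx⟩ := farkas_nonneg b x (fun d hd => h d (fun i hi => by
      have h1 := hd (Sum.inl i)
      have h2 := hd (Sum.inr i)
      simp only [b, Sum.elim_inl, Sum.elim_inr, if_pos (hFI hi), if_pos hi, inner_neg_left] at h1 h2
      linarith) (fun i hi => by
      have h1 := hd (Sum.inl i)
      simpa [b, hi.1] using h1))
  refine ⟨WithLp.toLp 2 fun i => (if i ∈ I then c (Sum.inl i) else 0) -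
      (if i ∈ F then c (Sum.inr i) else 0), ⟨fun i hi => ?_, fun i hi => ?_⟩, ?_⟩
  · have : i ∉ F := fun h => hi (hFI h)
    simp [hi, this]
  · simpa [hi.1, hi.2] using hc _
  · rw [← hcx, Fintype.sum_sum_type, ← Finset.sum_add_distrib]
    refine Finset.sum_congr rfl fun i _ => ?_
    by_cases h1 : i ∈ I <;> by_cases h2 : i ∈ F <;> simp [b, h1, h2, add_smul, sub_eq_add_neg]

section Affine

variable {l : ℕ} {E : Type*} [NormedAddCommGroup E] [InnerProductSpace ℝ E]
  (a : Fin l → E) (c : Fin l → ℝ) (F I : Set (Fin l))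

theorem sum_smul_pair (μ : Em l) :
    ∑ i, μ i • (WithLp.toLp 2 (a i, c i) : WithLp 2 (E × ℝ)) =
      WithLp.toLp 2 (∑ i, μ i • a i, ∑ i, μ i * c i) := by
  apply (WithLp.linearEquiv 2 ℝ (E × ℝ)).injective
  rw [map_sum]
  ext <;> simp [Prod.fst_sum, Prod.snd_sum]

variable [FiniteDimensional ℝ E]

/-- Solvability of a mixed affine system, in terms of multipliers. -/
theorem exists_affine_solution (hFI : F ⊆ I)
    (h : ∀ μ ∈ Pset F I, ∑ i, μ i • a i = 0 → ∑ i, μ i * c i ≤ 0) :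
    ∃ z : E, (∀ i ∈ F, ⟪a i, z⟫ + c i = 0) ∧ ∀ i ∈ I \ F, ⟪a i, z⟫ + c i ≤ 0 := by
  by_contra hno
  obtain ⟨μ, hμ, hsum⟩ := farkas_Pset (E := WithLp 2 (E × ℝ))
    (fun i => WithLp.toLp 2 (a i, c i)) (WithLp.toLp 2 (0, 1)) F I hFI (fun d h1 h2 => by
      by_contra! hd
      simp only [WithLp.prod_inner_apply, inner_zero_left, zero_add] at hd h1 h2
      have hs : 0 < d.ofLp.2 := by simpa using hd
      refine hno ⟨d.ofLp.2⁻¹ • d.ofLp.1, fun i hi => ?_, fun i hi => ?_⟩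
      · have := h1 i hi
        rw [inner_smul_right]
        simp only [RCLike.inner_apply, conj_trivial] at this
        field_simp
        linarith
      · have := h2 i hi
        rw [inner_smul_right]
        simp only [RCLike.inner_apply, conj_trivial] at this
        have h3 : d.ofLp.2⁻¹ * ⟪a i, d.ofLp.1⟫ + c i = d.ofLp.2⁻¹ * (⟪a i, d.ofLp.1⟫ + d.ofLp.2 * c i) := by
          field_simp
        rw [h3]
        exact mul_nonpos_of_nonneg_of_nonpos (inv_nonneg.2 hs.le) this)
  rw [sum_smul_pair] at hsum
  have h1 : ∑ i, μ i • a i = 0 := congrArg WithLp.fst hsum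
  have h2 : ∑ i, μ i * c i = 1 := congrArg WithLp.snd hsum
  have := h μ hμ h1
  linarith

/-- Strong duality with complementary slackness, for linear programs whose primal and dual are both
feasible. -/
theorem exists_complementary_pair (hFI : F ⊆ I) (x : E)
    (hP : ∃ μ ∈ Pset F I, ∑ i, μ i • a i = x)
    (hD : ∃ z : E, (∀ i ∈ F, ⟪a i, z⟫ + c i = 0) ∧ ∀ i ∈ I \ F, ⟪a i, z⟫ + c i ≤ 0) :
    ∃ μ ∈ Pset F I, ∑ i, μ i • a i = x ∧ ∃ z : E, (∀ i ∈ F, ⟪a i, z⟫ + c i = 0) ∧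
      (∀ i ∈ I \ F, ⟪a i, z⟫ + c i ≤ 0) ∧ ∀ i, μ i = 0 ∨ ⟪a i, z⟫ + c i = 0 := by
  classical
  have hweak : ∀ (z : E) (s : ℝ), (∀ i ∈ F, ⟪a i, z⟫ + s * c i = 0) →
      (∀ i ∈ I \ F, ⟪a i, z⟫ + s * c i ≤ 0) → ∀ μ ∈ Pset F I, ∑ i, μ i • a i = x →
      ⟪x, z⟫ + s * ∑ i, μ i * c i ≤ 0 := by
    intro z s h1 h2 μ hμ hx
    have : ⟪x, z⟫ + s * ∑ i, μ i * c i = ∑ i, μ i * (⟪a i, z⟫ + s * c i) := by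
      rw [← hx, sum_inner, Finset.mul_sum, ← Finset.sum_add_distrib]
      refine Finset.sum_congr rfl fun i _ => ?_
      rw [real_inner_smul_left]
      ring
    rw [this]
    refine Finset.sum_nonpos fun i _ => ?_
    by_cases hF : i ∈ F
    · simp [h1 i hF]
    by_cases hI : i ∈ I
    · exact mul_nonpos_of_nonneg_of_nonpos (hμ.2 i ⟨hI, hF⟩) (h2 i ⟨hI, hF⟩)
    · simp [hμ.1 i hI]
  obtain ⟨z0, hz1, hz2⟩ := hD
  obtain ⟨μ0, hμ0, hμ0x⟩ := hP
  set S : Set ℝ := {r | ∃ μ ∈ Pset F I, ∑ i, μ i • a i = x ∧ ∑ i, μ i * c i = r} with hS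
  have hSne : S.Nonempty := ⟨_, μ0, hμ0, hμ0x, rfl⟩
  have hSb : BddAbove S := by
    refine ⟨-⟪x, z0⟫, ?_⟩
    rintro _ ⟨μ, hμ, hx, rfl⟩
    have := hweak z0 1 (by simpa using hz1) (by simpa using hz2) μ hμ hx
    linarith
  obtain ⟨μ, hμ, hsum⟩ := farkas_Pset (E := WithLp 2 (E × ℝ))
    (fun i => WithLp.toLp 2 (a i, c i)) (WithLp.toLp 2 (x, sSup S)) F I hFI (fun d h1 h2 => by
      simp only [WithLp.prod_inner_apply, RCLike.inner_apply, conj_trivial] at h1 h2 ⊢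
      have hall := hweak d.ofLp.1 d.ofLp.2 h1 h2
      rcases lt_or_ge 0 d.ofLp.2 with hs | hs
      · have : sSup S ≤ -⟪x, d.ofLp.1⟫ / d.ofLp.2 := by
          refine csSup_le hSne ?_
          rintro _ ⟨μ, hμ, hx, rfl⟩
          rw [le_div_iff₀ hs]
          linarith [hall μ hμ hx]
        rw [le_div_iff₀ hs] at this
        linarith
      · have h3 := le_csSup hSb ⟨μ0, hμ0, hμ0x, rfl⟩
        have h4 := hall μ0 hμ0 hμ0x
        nlinarith)
  rw [sum_smul_pair] at hsum
  have h1 : ∑ i, μ i • a i = x := congrArg WithLp.fst hsum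
  have h2 : ∑ i, μ i * c i = sSup S := congrArg WithLp.snd hsum
  obtain ⟨z, hz1, hz2⟩ := exists_affine_solution a c (F ∪ {i | i ∈ I ∧ 0 < μ i}) I
    (union_subset hFI fun i hi => hi.1) (fun σ hσ hσ0 => by
      by_contra! hpos
      obtain ⟨ε, hε, hεσ⟩ : ∃ ε > 0, ∀ i, 0 < μ i → 0 ≤ μ i + ε * σ i := by
        have : ∀ᶠ ε in 𝓝[>] (0:ℝ), ∀ i, 0 < μ i → 0 ≤ μ i + ε * σ i := by
          rw [eventually_all]
          intro i
          by_cases hi : 0 < μ i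
          · have ht : Tendsto (fun ε : ℝ => μ i + ε * σ i) (𝓝[>] 0) (𝓝 (μ i + 0 * σ i)) :=
              Tendsto.mono_left (Continuous.tendsto (by fun_prop) 0) nhdsWithin_le_nhds
            filter_upwards [ht.eventually_const_lt (by simpa using hi)] with ε h _ using h.le
          · simp [hi]
        obtain ⟨ε, h1, h2⟩ := (this.and self_mem_nhdsWithin).exists
        exact ⟨ε, h2, h1⟩
      have hmem : ∑ i, (μ + ε • σ) i * c i ∈ S := by
        refine ⟨μ + ε • σ, ⟨fun i hi => ?_, fun i hi => ?_⟩, ?_, rfl⟩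
        · simp [hμ.1 i hi, hσ.1 i hi]
        · rcases (hμ.2 i hi).lt_or_eq with h | h
          · simpa using hεσ i h
          · have := hσ.2 i ⟨hi.1, by
              rintro (h' | h')
              · exact hi.2 h'
              · exact h'.2.ne h⟩
            simp only [PiLp.add_apply, PiLp.smul_apply, smul_eq_mul, ← h, zero_add]
            positivity
        · simp only [PiLp.add_apply, PiLp.smul_apply, smul_eq_mul, add_smul, mul_smul,
            Finset.sum_add_distrib, ← Finset.smul_sum, h1, hσ0, smul_zero, add_zero]
      have := le_csSup hSb hmem
      simp only [PiLp.add_apply, PiLp.smul_apply, smul_eq_mul, add_mul, Finset.sum_add_distrib,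
        mul_assoc, ← Finset.mul_sum, h2] at this
      nlinarith [mul_pos hε hpos])
  refine ⟨μ, hμ, h1, z, fun i hi => hz1 i (Or.inl hi), fun i hi => ?_, fun i => ?_⟩
  · by_cases h : 0 < μ i
    · exact (hz1 i (Or.inr ⟨hi.1, h⟩)).le
    · exact hz2 i ⟨hi.1, by
        rintro (h' | h')
        · exact hi.2 h'
        · exact h h'.2⟩
  · by_cases hI : i ∈ I
    · by_cases hF : i ∈ F
      · exact Or.inr (hz1 i (Or.inl hF))
      · rcases (hμ.2 i ⟨hI, hF⟩).lt_or_eq with h | h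
        · exact Or.inr (hz1 i (Or.inr ⟨hI, h⟩))
        · exact Or.inl h.symm
    · exact Or.inl (hμ.1 i hI)

end Affine

section Pairings

variable {m l : ℕ} (q : Em m → Em l) (y : Em m)

theorem inner_gradT (lam : Em l) (v : Em m) :
    ⟪gradT q y lam, v⟫ = ∑ i, lam i * gradQ q y i v := by
  rw [gradT, ContinuousLinearMap.adjoint_inner_left, PiLp.inner_apply]
  exact Finset.sum_congr rfl fun i _ => by simp [gradQ, mul_comm]

theorem inner_hessT (lam : Em l) (v w : Em m) :
    ⟪hessT q y lam v, w⟫ = ∑ i, lam i * hessQ q y i v w := by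
  rw [hessT, ContinuousLinearMap.adjoint_inner_left, PiLp.inner_apply]
  exact Finset.sum_congr rfl fun i _ => by simp [hessQ, mul_comm]

theorem inner_gradT_single (i : Fin l) (v : Em m) :
    ⟪gradT q y (EuclideanSpace.single i 1), v⟫ = gradQ q y i v := by
  rw [inner_gradT]
  simp

theorem gradT_eq_sum (lam : Em l) :
    gradT q y lam = ∑ i, lam i • gradT q y (EuclideanSpace.single i 1) := by
  refine ext_inner_right ℝ fun v => ?_
  rw [inner_gradT, sum_inner]
  exact Finset.sum_congr rfl fun i _ => by rw [real_inner_smul_left, inner_gradT_single]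

theorem gradT_add (a b : Em l) : gradT q y (a + b) = gradT q y a + gradT q y b :=
  map_add _ _ _

theorem gradT_sub (a b : Em l) : gradT q y (a - b) = gradT q y a - gradT q y b :=
  map_sub _ _ _

theorem gradT_smul (c : ℝ) (a : Em l) : gradT q y (c • a) = c • gradT q y a :=
  map_smul _ _ _

theorem hessT_add_left (a b : Em l) (v : Em m) :
    hessT q y (a + b) v = hessT q y a v + hessT q y b v :=
  map_add _ _ _

theorem hessT_smul_left (c : ℝ) (a : Em l) (v : Em m) :
    hessT q y (c • a) v = c • hessT q y a v :=
  map_smul _ _ _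

theorem gradQ_add (i : Fin l) (v w : Em m) :
    gradQ q y i (v + w) = gradQ q y i v + gradQ q y i w := by
  simp [gradQ]

theorem gradQ_neg (i : Fin l) (v : Em m) : gradQ q y i (-v) = -gradQ q y i v := by
  simp [gradQ]

theorem gradQ_smul (i : Fin l) (c : ℝ) (v : Em m) :
    gradQ q y i (c • v) = c * gradQ q y i v := by
  simp [gradQ]

theorem hessQ_neg_neg (i : Fin l) (v : Em m) : hessQ q y i (-v) (-v) = hessQ q y i v v := by
  simp [hessQ]

variable {q y}

theorem exists_Pset_gradT_eq {F I : Set (Fin l)} (hFI : F ⊆ I) {x : Em m}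
    (h : ∀ d ∈ Kcone q y F I, ⟪x, d⟫ ≤ 0) : ∃ μ ∈ Pset F I, gradT q y μ = x := by
  obtain ⟨c, hc, hx⟩ := farkas_Pset (fun i => gradT q y (EuclideanSpace.single i 1)) x F I hFI
    (fun d h1 h2 => h d ⟨fun i hi => by rw [← inner_gradT_single]; exact h1 i hi,
      fun i hi => by rw [← inner_gradT_single]; exact h2 i hi⟩)
  exact ⟨c, hc, by rw [gradT_eq_sum, hx]⟩

theorem exists_gradQ_solution {F I : Set (Fin l)} (hFI : F ⊆ I) {c : Fin l → ℝ}
    (h : ∀ μ ∈ Pset F I, gradT q y μ = 0 → ∑ i, μ i * c i ≤ 0) :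
    ∃ z : Em m, (∀ i ∈ F, gradQ q y i z + c i = 0) ∧ ∀ i ∈ I \ F, gradQ q y i z + c i ≤ 0 := by
  obtain ⟨z, h1, h2⟩ := exists_affine_solution
    (fun i => gradT q y (EuclideanSpace.single i 1)) c F I hFI
    (fun μ hμ h0 => h μ hμ (by rw [gradT_eq_sum, h0]))
  simp only [inner_gradT_single] at h1 h2
  exact ⟨z, h1, h2⟩

theorem exists_gradQ_complementary {F I : Set (Fin l)} (hFI : F ⊆ I) {c : Fin l → ℝ} {x : Em m}
    (hP : ∃ μ ∈ Pset F I, gradT q y μ = x)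
    (hD : ∃ z : Em m, (∀ i ∈ F, gradQ q y i z + c i = 0) ∧
      ∀ i ∈ I \ F, gradQ q y i z + c i ≤ 0) :
    ∃ μ ∈ Pset F I, gradT q y μ = x ∧ ∃ z : Em m, (∀ i ∈ F, gradQ q y i z + c i = 0) ∧
      (∀ i ∈ I \ F, gradQ q y i z + c i ≤ 0) ∧ ∀ i, μ i = 0 ∨ gradQ q y i z + c i = 0 := by
  obtain ⟨μ₀, hμ₀, hx⟩ := hP
  rw [gradT_eq_sum] at hx
  simp only [← inner_gradT_single q y] at hD
  obtain ⟨μ, hμ, hμx, z, h1, h2, h3⟩ := exists_complementary_pair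
    (fun i => gradT q y (EuclideanSpace.single i 1)) c F I hFI x ⟨μ₀, hμ₀, hx⟩ hD
  simp only [inner_gradT_single] at h1 h2 h3
  exact ⟨μ, hμ, by rw [gradT_eq_sum, hμx], z, h1, h2, h3⟩

end Pairings

theorem tendsto_clm_apply {E F α : Type*} [NormedAddCommGroup E] [NormedSpace ℝ E]
    [NormedAddCommGroup F] [NormedSpace ℝ F] {L : Filter α} {A : α → E →L[ℝ] F} {B : E →L[ℝ] F}
    {w : α → E} {v : E} (hA : Tendsto A L (𝓝 B)) (hw : Tendsto w L (𝓝 v)) :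
    Tendsto (fun k => A k (w k)) L (𝓝 (B v)) :=
  (isBoundedBilinearMap_apply.continuous.tendsto (B, v)).comp (hA.prodMk_nhds hw)

section Calculus

variable {m l : ℕ} {q : Em m → Em l}

theorem hasFDerivAt_of_contDiff_two (hq : ContDiff ℝ 2 q) (y : Em m) :
    HasFDerivAt q (fderiv ℝ q y) y :=
  (hq.differentiable (by norm_num) y).hasFDerivAt

theorem contDiff_fderiv_of_contDiff_two (hq : ContDiff ℝ 2 q) : ContDiff ℝ 1 (fderiv ℝ q) :=
  hq.fderiv_right (by norm_num)

theorem continuous_fderiv_of_contDiff_two (hq : ContDiff ℝ 2 q) : Continuous (fderiv ℝ q) :=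
  (contDiff_fderiv_of_contDiff_two hq).continuous

theorem hasFDerivAt_fderiv_of_contDiff_two (hq : ContDiff ℝ 2 q) (y : Em m) :
    HasFDerivAt (fderiv ℝ q) (fderiv ℝ (fderiv ℝ q) y) y :=
  ((contDiff_fderiv_of_contDiff_two hq).differentiable (by norm_num) y).hasFDerivAt

theorem fderiv_fderiv_symm (hq : ContDiff ℝ 2 q) (y : Em m) (v w : Em m) :
    fderiv ℝ (fderiv ℝ q) y v w = fderiv ℝ (fderiv ℝ q) y w v :=
  (hq.contDiffAt.isSymmSndFDerivAt (by simp)).eq v w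

theorem hessQ_symm (hq : ContDiff ℝ 2 q) (y : Em m) (i : Fin l) (v w : Em m) :
    hessQ q y i v w = hessQ q y i w v := by
  rw [hessQ, hessQ, fderiv_fderiv_symm hq]

theorem inner_hessT_symm (hq : ContDiff ℝ 2 q) (y : Em m) (lam : Em l) (v w : Em m) :
    ⟪hessT q y lam v, w⟫ = ⟪hessT q y lam w, v⟫ := by
  rw [inner_hessT, inner_hessT]
  exact Finset.sum_congr rfl fun i _ => by rw [hessQ_symm hq]

theorem taylor_two_isLittleO (hq : ContDiff ℝ 2 q) (y : Em m) :
    (fun x => q x - q y - fderiv ℝ q y (x - y) -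
      (1 / 2 : ℝ) • fderiv ℝ (fderiv ℝ q) y (x - y) (x - y)) =o[𝓝 y] fun x => ‖x - y‖ ^ 2 := by
  set A := fderiv ℝ q y
  set B := fderiv ℝ (fderiv ℝ q) y with hB
  rw [Asymptotics.isLittleO_iff]
  intro ε hε
  have h1 := (hasFDerivAt_fderiv_of_contDiff_two hq y).isLittleO
  rw [Asymptotics.isLittleO_iff] at h1
  obtain ⟨δ, hδ, hball⟩ := Metric.eventually_nhds_iff_ball.1 (h1 hε)
  filter_upwards [Metric.ball_mem_nhds y hδ] with x hx
  set g : Em m → Em l := fun x => q x - q y - A (x - y) - (1 / 2 : ℝ) • B (x - y) (x - y) with hg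
  have hder : ∀ z, HasFDerivAt g (fderiv ℝ q z - A - B (z - y)) z := by
    intro z
    have e1 : HasFDerivAt (fun x : Em m => x - y) (ContinuousLinearMap.id ℝ (Em m)) z :=
      (hasFDerivAt_id z).sub_const y
    have e2 := ((hasFDerivAt_of_contDiff_two hq z).sub_const (q y)).sub
      (A.hasFDerivAt.comp z e1)
    have e3 := ((B.hasFDerivAt.comp z e1).clm_apply e1).const_smul (1 / 2 : ℝ)
    refine (e2.sub e3).congr_fderiv ?_
    ext1 v
    have := fderiv_fderiv_symm hq y v (z - y)
    rw [← hB] at this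
    simp only [sub_apply, ContinuousLinearMap.comp_apply,
      ContinuousLinearMap.id_apply, add_apply, smul_apply,
      ContinuousLinearMap.flip_apply, Function.comp, this]
    rw [← two_smul ℝ (B (z - y) v), smul_smul]
    norm_num
  have hmv := (convex_closedBall y ‖x - y‖).norm_image_sub_le_of_norm_hasFDerivWithin_le
    (f := g) (f' := fun z => fderiv ℝ q z - A - B (z - y)) (C := ε * ‖x - y‖) (x := y) (y := x)
    (fun z _ => (hder z).hasFDerivWithinAt) (fun z hz => by
      have hz' : ‖z - y‖ ≤ ‖x - y‖ := by simpa [dist_eq_norm] using hz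
      refine (hball z ?_).trans (mul_le_mul_of_nonneg_left hz' hε.le)
      rw [mem_ball, dist_eq_norm] at hx ⊢
      exact hz'.trans_lt hx) (by simp) (by simp [dist_eq_norm])
  have hgy : g y = 0 := by simp [hg]
  rw [hgy, sub_zero] at hmv
  rw [Real.norm_of_nonneg (by positivity)]
  exact hmv.trans (by rw [pow_two, mul_assoc])

variable {t : ℕ → ℝ} {uk : ℕ → Em m} {u : Em m}

theorem tendsto_add_smul (y : Em m) (ht : Tendsto t atTop (𝓝 0)) (hu : Tendsto uk atTop (𝓝 u)) :
    Tendsto (fun k => y + t k • uk k) atTop (𝓝 y) := by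
  simpa using (ht.smul hu).const_add y

theorem tendsto_fderiv_quotient (hq : ContDiff ℝ 2 q) (y : Em m)
    (ht0 : ∀ k, 0 < t k) (ht : Tendsto t atTop (𝓝 0)) (hu : Tendsto uk atTop (𝓝 u)) :
    Tendsto (fun k => (t k)⁻¹ • (fderiv ℝ q (y + t k • uk k) - fderiv ℝ q y)) atTop
      (𝓝 (fderiv ℝ (fderiv ℝ q) y u)) := by
  refine (hasFDerivAt_fderiv_of_contDiff_two hq y).hasFDerivWithinAt.lim (s := univ) ?_
    (by simp) ?_
  · have := (ht.smul hu)
    simp only [zero_smul] at this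
    exact this
  · refine hu.congr fun k => ?_
    rw [smul_smul, inv_mul_cancel₀ (ht0 k).ne', one_smul]

theorem tendsto_gradQ_quotient (hq : ContDiff ℝ 2 q) (y : Em m)
    (ht0 : ∀ k, 0 < t k) (ht : Tendsto t atTop (𝓝 0)) (hu : Tendsto uk atTop (𝓝 u))
    {wk : ℕ → Em m} {w : Em m} (hw : Tendsto wk atTop (𝓝 w))
    (i : Fin l) :
    Tendsto (fun k => (t k)⁻¹ * (gradQ q (y + t k • uk k) i (wk k) - gradQ q y i (wk k))) atTop
      (𝓝 (hessQ q y i u w)) := by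
  have h := tendsto_clm_apply (tendsto_fderiv_quotient hq y ht0 ht hu) hw
  have h2 := ((EuclideanSpace.proj (𝕜 := ℝ) i).continuous.tendsto _).comp h
  exact h2.congr fun k => by simp [gradQ]

theorem tendsto_gradT_quotient (hq : ContDiff ℝ 2 q) (y : Em m)
    (ht0 : ∀ k, 0 < t k) (ht : Tendsto t atTop (𝓝 0)) (hu : Tendsto uk atTop (𝓝 u))
    {lk : ℕ → Em l} {lam : Em l} (hl : Tendsto lk atTop (𝓝 lam)) :
    Tendsto (fun k => (t k)⁻¹ • (gradT q (y + t k • uk k) (lk k) - gradT q y (lk k))) atTop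
      (𝓝 (hessT q y lam u)) := by
  have h := ((ContinuousLinearMap.adjoint (𝕜 := ℝ) (E := Em m) (F := Em l)).continuous.tendsto
    _).comp (tendsto_fderiv_quotient hq y ht0 ht hu)
  refine (tendsto_clm_apply h hl).congr fun k => ?_
  simp [gradT]

theorem tendsto_taylor_two (hq : ContDiff ℝ 2 q) (y : Em m)
    (ht0 : ∀ k, 0 < t k) (ht : Tendsto t atTop (𝓝 0)) (hu : Tendsto uk atTop (𝓝 u))
    (i : Fin l) :
    Tendsto (fun k => (t k ^ 2)⁻¹ * (q (y + t k • uk k) i - q y i - t k * gradQ q y i (uk k))) atTop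
      (𝓝 (1 / 2 * hessQ q y i u u)) := by
  have hy := tendsto_add_smul y ht hu
  have h1 := (taylor_two_isLittleO hq y).comp_tendsto hy
  have hO : (fun k => ‖y + t k • uk k - y‖ ^ 2) =O[atTop] fun k => t k ^ 2 := by
    have : (fun k => t k • uk k) =O[atTop] fun k => t k * 1 := by
      simpa [smul_eq_mul] using (Asymptotics.isBigO_refl t atTop).smul (hu.isBigO_one ℝ)
    simpa using this.norm_left.pow 2
  have h2 := (h1.trans_isBigO hO).tendsto_inv_smul_nhds_zero
  have h3 := ((EuclideanSpace.proj (𝕜 := ℝ) i).continuous.tendsto _).comp h2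
  have h4 : Tendsto (fun k => 1 / 2 * hessQ q y i (uk k) (uk k)) atTop
      (𝓝 (1 / 2 * hessQ q y i u u)) := by
    refine Tendsto.const_mul _ ?_
    exact ((EuclideanSpace.proj (𝕜 := ℝ) i).continuous.tendsto _).comp
      (tendsto_clm_apply (((fderiv ℝ (fderiv ℝ q) y).continuous.tendsto _).comp hu) hu)
  have h5 := h3.add h4
  simp only [map_zero, zero_add] at h5
  refine h5.congr fun k => ?_
  have := (ht0 k).ne'
  simp only [Function.comp, gradQ, hessQ, add_sub_cancel_left, map_smul, map_sub,
    smul_apply, EuclideanSpace.coe_proj, smul_eq_mul]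
  field_simp
  ring

end Calculus

section TangentCones

variable {E F : Type*} [NormedAddCommGroup E] [NormedSpace ℝ E] [NormedAddCommGroup F]
  [NormedSpace ℝ F]

theorem tendsto_quotient_of_hasFDerivAt {f : E → F} {f' : E →L[ℝ] F} {x : E}
    (hf : HasFDerivAt f f' x) {t : ℕ → ℝ} {uk : ℕ → E} {u : E} (ht0 : ∀ k, 0 < t k)
    (ht : Tendsto t atTop (𝓝 0)) (hu : Tendsto uk atTop (𝓝 u)) :
    Tendsto (fun k => (t k)⁻¹ • (f (x + t k • uk k) - f x)) atTop (𝓝 (f' u)) := by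
  refine hf.hasFDerivWithinAt.lim (s := univ) ?_ (by simp) ?_
  · simpa using ht.smul hu
  · refine hu.congr fun k => ?_
    rw [smul_smul, inv_mul_cancel₀ (ht0 k).ne', one_smul]

theorem mem_tanCone_of_eventually {Ω : Set E} {z u : E} {t : ℕ → ℝ} {uk : ℕ → E}
    (ht0 : ∀ k, 0 < t k) (ht : Tendsto t atTop (𝓝 0)) (hu : Tendsto uk atTop (𝓝 u))
    (h : ∀ᶠ k in atTop, z + t k • uk k ∈ Ω) : u ∈ tanCone Ω z := by
  obtain ⟨N, hN⟩ := eventually_atTop.1 h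
  exact ⟨fun k => t (k + N), fun k => uk (k + N), fun k => ht0 _,
    (tendsto_add_atTop_iff_nat N).2 ht, (tendsto_add_atTop_iff_nat N).2 hu,
    fun k => hN _ (Nat.le_add_left _ _)⟩

/-- A null sequence of positive reals. -/
theorem tendsto_inv_natCast_add_one : Tendsto (fun k : ℕ => ((k : ℝ) + 1)⁻¹) atTop (𝓝 0) := by
  simpa using tendsto_one_div_add_atTop_nhds_zero_nat (𝕜 := ℝ)

theorem neg_mem_regNormalCone_of_isLocalMinOn {H : Type*} [NormedAddCommGroup H]
    [InnerProductSpace ℝ H] {f : H → ℝ} {f' : H →L[ℝ] ℝ} {x g : H} {Ω : Set H}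
    (hf : HasFDerivAt f f' x) (hg : ∀ d, f' d = -⟪g, d⟫) (hmin : IsLocalMinOn f Ω x) :
    g ∈ regNormalCone Ω x := by
  rintro d ⟨t, uk, ht0, ht, hu, hmem⟩
  have h1 := tendsto_quotient_of_hasFDerivAt hf ht0 ht hu
  have h2 : Tendsto (fun k => x + t k • uk k) atTop (𝓝[Ω] x) :=
    tendsto_nhdsWithin_iff.2 ⟨by simpa using (ht.smul hu).const_add x, Eventually.of_forall hmem⟩
  have h3 : 0 ≤ f' d := by
    refine ge_of_tendsto h1 ?_
    filter_upwards [h2.eventually hmin] with k hk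
    exact smul_nonneg (inv_nonneg.2 (ht0 k).le) (sub_nonneg.2 hk)
  rw [hg] at h3
  linarith

end TangentCones

section Subregularity

variable {m l : ℕ} {q : Em m → Em l} {y : Em m} {C : ℝ}

/-- A quantitative form of metric subregularity of `Mq q` at `(y, 0)`. -/
def SubregAt (q : Em m → Em l) (y : Em m) (C : ℝ) : Prop :=
  ∃ U ∈ 𝓝 y, ∀ x ∈ U, ∀ s > (0 : ℝ), (∀ i, q x i ≤ s) → ∃ x' ∈ Gam q, ‖x - x'‖ ≤ C * s

theorem subregAt_of_infEDist_le {κ : ℝ} (hκ : 0 < κ) {U : Set (Em m)} (hU : U ∈ 𝓝 y)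
    (h : ∀ u ∈ U, Metric.infEDist u {x | (0 : Em l) ∈ Mq q x} ≤
      ENNReal.ofReal κ * Metric.infEDist (0 : Em l) (Mq q u)) :
    SubregAt q y (κ * √l + 1) := by
  refine ⟨U, hU, fun x hx s hs hle => ?_⟩
  have h1 := h x hx
  set z : Em l := WithLp.toLp 2 fun _ => s with hz
  have hzm : z ∈ Mq q x := fun i => hle i
  have hzn : ‖z‖ = √l * s := by
    rw [EuclideanSpace.norm_eq]
    simp [hz, hs.le]
  have h2 : Metric.infEDist (0 : Em l) (Mq q x) ≤ ENNReal.ofReal (√l * s) := by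
    refine (Metric.infEDist_le_edist_of_mem hzm).trans ?_
    rw [edist_dist, dist_zero_left, hzn]
  have h3 : Metric.infEDist x {x | (0 : Em l) ∈ Mq q x} < ENNReal.ofReal ((κ * √l + 1) * s) := by
    refine (h1.trans (mul_le_mul_right h2 _)).trans_lt ?_
    rw [← ENNReal.ofReal_mul hκ.le, ENNReal.ofReal_lt_ofReal_iff (by positivity)]
    nlinarith
  obtain ⟨x', hx', hlt⟩ := Metric.infEDist_lt_iff.1 h3
  refine ⟨x', fun i => hx' i, ?_⟩
  rw [edist_dist, dist_eq_norm, ENNReal.ofReal_lt_ofReal_iff (by positivity)] at hlt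
  exact hlt.le

theorem exists_subregAt_of_metricallySubregularAt
    (h : MetricallySubregularAt (Mq q) y (0 : Em l)) : ∃ C > 0, SubregAt q y C := by
  obtain ⟨κ, hκ, U, hU, h⟩ := h
  exact ⟨_, by positivity, subregAt_of_infEDist_le hκ hU h⟩

theorem exists_subregAt_of_vicinity (h : MetricallyRegularInVicinity q y) :
    ∃ C > 0, ∀ᶠ x in 𝓝 y, x ∈ Gam q → x ≠ y → SubregAt q x C := by
  obtain ⟨V, hV, κ, hκ, h⟩ := h
  refine ⟨κ * √l + 1, by positivity, ?_⟩
  filter_upwards [hV] with x hx hxG hxy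
  obtain ⟨U, hU, W, hW, h⟩ := h x hx hxy fun i => hxG i
  exact subregAt_of_infEDist_le hκ hU fun u hu => h u hu 0 (mem_of_mem_nhds hW)

theorem tendsto_gradQ_of_quotient (hq : ContDiff ℝ 2 q) {t : ℕ → ℝ} {uk : ℕ → Em m} {u : Em m}
    (ht0 : ∀ k, 0 < t k) (ht : Tendsto t atTop (𝓝 0)) (hu : Tendsto uk atTop (𝓝 u)) (i : Fin l) :
    Tendsto (fun k => (t k)⁻¹ * (q (y + t k • uk k) i - q y i)) atTop (𝓝 (gradQ q y i u)) :=
  ((EuclideanSpace.proj (𝕜 := ℝ) i).continuous.tendsto _).comp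
    (tendsto_quotient_of_hasFDerivAt (hasFDerivAt_of_contDiff_two hq y) ht0 ht hu)

theorem continuous_apply_of_contDiff_two (hq : ContDiff ℝ 2 q) (i : Fin l) :
    Continuous fun x => q x i :=
  (EuclideanSpace.proj (𝕜 := ℝ) i).continuous.comp hq.continuous

theorem isClosed_Gam (hq : ContDiff ℝ 2 q) : IsClosed (Gam q) := by
  simp only [Gam, ofPred_forall]
  exact isClosed_iInter fun i => isClosed_le (continuous_apply_of_contDiff_two hq i)
    continuous_const

theorem gradQ_nonpos_of_mem_tanCone (hq : ContDiff ℝ 2 q) {h : Em m} (hh : h ∈ tanCone (Gam q) y)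
    {i : Fin l} (hi : i ∈ actI q y) : gradQ q y i h ≤ 0 := by
  obtain ⟨t, uk, ht0, ht, hu, hmem⟩ := hh
  refine le_of_tendsto' (tendsto_gradQ_of_quotient (y := y) hq ht0 ht hu i) fun k => ?_
  have hi' : q y i = 0 := hi
  rw [hi', sub_zero]
  exact mul_nonpos_of_nonneg_of_nonpos (inv_nonneg.2 (ht0 k).le) (hmem k i)

theorem gradT_mem_regNormalCone (hq : ContDiff ℝ 2 q) {lam : Em l} (hl : lam ∈ NRl q y) :
    gradT q y lam ∈ regNormalCone (Gam q) y := by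
  intro h hh
  rw [inner_gradT]
  refine Finset.sum_nonpos fun i _ => ?_
  by_cases hi : q y i = 0
  · exact mul_nonpos_of_nonneg_of_nonpos (hl.1 i) (gradQ_nonpos_of_mem_tanCone hq hh hi)
  · rw [hl.2 i hi, zero_mul]

theorem exists_mem_tanCone_norm_sub_le (hq : ContDiff ℝ 2 q) (hs : SubregAt q y C)
    (hy : y ∈ Gam q) {h : Em m} {s : ℝ} (hs0 : 0 < s) (hh : ∀ i ∈ actI q y, gradQ q y i h < s) :
    ∃ h' ∈ tanCone (Gam q) y, ‖h - h'‖ ≤ C * s := by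
  obtain ⟨U, hU, hsub⟩ := hs
  set t : ℕ → ℝ := fun k => ((k : ℝ) + 1)⁻¹ with ht_def
  have ht0 : ∀ k, 0 < t k := fun k => by positivity
  have ht : Tendsto t atTop (𝓝 0) := tendsto_inv_natCast_add_one
  have hx := tendsto_add_smul y ht (tendsto_const_nhds (x := h))
  have hle : ∀ᶠ k in atTop, ∀ i, q (y + t k • h) i ≤ t k * s := by
    refine eventually_all.2 fun i => ?_
    rcases (hy i).eq_or_lt with hi | hi
    · filter_upwards [(tendsto_gradQ_of_quotient (y := y) hq ht0 ht
        (tendsto_const_nhds (x := h)) i).eventually_lt_const (hh i hi)] with k hk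
      rw [hi, sub_zero, inv_mul_lt_iff₀ (ht0 k)] at hk
      exact hk.le
    · filter_upwards [(((continuous_apply_of_contDiff_two hq i).tendsto y).comp
        hx).eventually_lt_const hi] with k hk
      exact hk.le.trans (mul_pos (ht0 k) hs0).le
  have hev : ∀ᶠ k in atTop, ∃ u ∈ closedBall h (C * s), y + t k • u ∈ Gam q := by
    filter_upwards [hle, hx.eventually hU] with k hk hkU
    obtain ⟨x', hx', hn⟩ := hsub _ hkU _ (mul_pos (ht0 k) hs0) hk
    refine ⟨(t k)⁻¹ • (x' - y), ?_, ?_⟩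
    · have : (t k)⁻¹ • (x' - y) - h = (t k)⁻¹ • -(y + t k • h - x') := by
        have := (ht0 k).ne'
        rw [neg_sub, ← sub_sub, smul_sub _ (x' - y), smul_smul, inv_mul_cancel₀ this, one_smul]
      rw [mem_closedBall, dist_eq_norm, this, norm_smul, norm_neg, norm_inv,
        Real.norm_of_nonneg (ht0 k).le, inv_mul_le_iff₀ (ht0 k)]
      linarith
    · rw [smul_smul, mul_inv_cancel₀ (ht0 k).ne', one_smul, add_sub_cancel]
      exact hx'
  obtain ⟨N, hN⟩ := eventually_atTop.1 hev
  choose u hu hmem using fun k => hN (k + N) (Nat.le_add_left _ _)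
  obtain ⟨h', hh', φ, hφ, hlim⟩ := (isCompact_closedBall h (C * s)).tendsto_subseq hu
  refine ⟨h', ⟨fun k => t (φ k + N), u ∘ φ, fun k => ht0 _, ?_, hlim, fun k => hmem _⟩, ?_⟩
  · exact ((tendsto_add_atTop_iff_nat N).2 ht).comp hφ.tendsto_atTop
  · rwa [norm_sub_rev, ← dist_eq_norm]

theorem exists_bounded_multiplier (hq : ContDiff ℝ 2 q) (hC : 0 ≤ C) (hs : SubregAt q y C)
    (hy : y ∈ Gam q) {x : Em m} (hx : x ∈ regNormalCone (Gam q) y) :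
    ∃ lam ∈ Lam q y x, ∀ i, lam i ≤ C * ‖x‖ := by
  classical
  set M := C * ‖x‖ with hM
  have hM0 : 0 ≤ M := by positivity
  set B : Set (Em l) := {lam | ∀ i, 0 ≤ lam i ∧ lam i ≤ M ∧ (q y i ≠ 0 → lam i = 0)} with hB
  have hci : ∀ i : Fin l, Continuous fun a : Em l => a i := fun i =>
    (EuclideanSpace.proj (𝕜 := ℝ) i).continuous
  have hBc : IsClosed B := by
    simp only [hB, ofPred_forall, ofPred_and]
    refine isClosed_iInter fun i => (isClosed_le continuous_const (hci i)).inter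
      ((isClosed_le (hci i) continuous_const).inter ?_)
    by_cases h : q y i = 0
    · simp [h]
    · simpa [h] using isClosed_eq (hci i) continuous_const
  have hBb : Bornology.IsBounded B := by
    refine (isBounded_iff_forall_norm_le).2 ⟨√l * M, fun a ha => ?_⟩
    rw [EuclideanSpace.norm_eq]
    refine Real.sqrt_le_iff.2 ⟨by positivity, ?_⟩
    rw [mul_pow, Real.sq_sqrt (by positivity)]
    calc ∑ i, ‖a i‖ ^ 2 ≤ ∑ _i : Fin l, M ^ 2 := Finset.sum_le_sum fun i _ =>
          pow_le_pow_left₀ (norm_nonneg _) (by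
            rw [Real.norm_of_nonneg (ha i).1]; exact (ha i).2.1) 2
      _ = l * M ^ 2 := by simp
  have hBK : IsCompact B := Metric.isCompact_of_isClosed_isBounded hBc hBb
  have hBv : Convex ℝ B := by
    intro a ha b hb s r hs hr hsr i
    refine ⟨?_, ?_, fun h => ?_⟩
    · have := mul_nonneg hs (ha i).1
      have := mul_nonneg hr (hb i).1
      simp only [PiLp.add_apply, PiLp.smul_apply, smul_eq_mul]
      linarith
    · have h1 := mul_le_mul_of_nonneg_left (ha i).2.1 hs
      have h2 := mul_le_mul_of_nonneg_left (hb i).2.1 hr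
      simp only [PiLp.add_apply, PiLp.smul_apply, smul_eq_mul]
      calc _ ≤ s * M + r * M := add_le_add h1 h2
        _ = M := by rw [← add_mul, hsr, one_mul]
    · simp [(ha i).2.2 h, (hb i).2.2 h]
  set G : Em l →L[ℝ] Em m := ContinuousLinearMap.adjoint (fderiv ℝ q y) with hG
  by_cases hmem : x ∈ G '' B
  · obtain ⟨lam, hl, hlx⟩ := hmem
    exact ⟨lam, ⟨⟨fun i => (hl i).1, fun i hi => (hl i).2.2 hi⟩, hlx⟩, fun i => (hl i).2.1⟩
  exfalso
  obtain ⟨f, s, hf1, hf2⟩ := geometric_hahn_banach_closed_point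
    (hBv.linear_image G.toLinearMap) (hBK.image G.continuous).isClosed hmem
  set h := (InnerProductSpace.toDual ℝ (Em m)).symm f with hh
  have hfh : ∀ a, f a = ⟪a, h⟫ := fun a => by
    rw [real_inner_comm, hh, InnerProductSpace.toDual_symm_apply]
  set lam : Em l := WithLp.toLp 2 fun i => if q y i = 0 ∧ 0 < gradQ q y i h then M else 0
  have hlB : lam ∈ B := fun i => by
    by_cases h1 : q y i = 0 ∧ 0 < gradQ q y i h
    · simp [lam, h1, hM0]
    · simp [lam, h1, hM0]
  have h1 := (hf1 _ (mem_image_of_mem G hlB)).trans hf2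
  rw [hfh, hfh] at h1
  change ⟪gradT q y lam, h⟫ < _ at h1
  rw [inner_gradT] at h1
  set S := ∑ i, if q y i = 0 ∧ 0 < gradQ q y i h then gradQ q y i h else 0 with hS
  have hterm : ∀ i, 0 ≤ if q y i = 0 ∧ 0 < gradQ q y i h then gradQ q y i h else 0 := fun i => by
    split_ifs with h2
    exacts [h2.2.le, le_rfl]
  have h2 : ∑ i, lam i * gradQ q y i h = M * S := by
    rw [hS, Finset.mul_sum]
    refine Finset.sum_congr rfl fun i _ => ?_
    by_cases h1 : q y i = 0 ∧ 0 < gradQ q y i h <;> simp [lam, h1]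
  have hS0 : 0 ≤ S := Finset.sum_nonneg fun i _ => hterm i
  have h3 : ∀ δ > 0, ⟪x, h⟫ ≤ M * (S + δ) := by
    intro δ hδ
    obtain ⟨h', hh', hn⟩ := exists_mem_tanCone_norm_sub_le hq hs hy (h := h) (s := S + δ)
      (by linarith) (fun i hi => by
        by_cases h4 : 0 < gradQ q y i h
        · have := Finset.single_le_sum (fun i _ => hterm i) (Finset.mem_univ i)
          rw [if_pos ⟨hi, h4⟩] at this
          linarith
        · linarith)
    have h5 := hx h' hh'
    have h6 := real_inner_le_norm x (h - h')
    rw [inner_sub_right] at h6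
    have := mul_le_mul_of_nonneg_left hn (norm_nonneg x)
    calc ⟪x, h⟫ ≤ ‖x‖ * (C * (S + δ)) := by linarith
      _ = M * (S + δ) := by rw [hM]; ring
  have h4 : ⟪x, h⟫ ≤ M * S := by
    refine ge_of_tendsto (x := 𝓝[>] (0 : ℝ)) (f := fun δ => M * (S + δ)) ?_
      (eventually_nhdsWithin_of_forall fun δ hδ => h3 δ hδ)
    have : Continuous fun δ : ℝ => M * (S + δ) := by fun_prop
    simpa using (this.tendsto 0).mono_left nhdsWithin_le_nhds
  linarith

end Subregularity

theorem tendsto_nhds_of_eq {α X : Type*} [TopologicalSpace X] {L : Filter α} {f : α → X} {a b : X}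
    (h : Tendsto f L (𝓝 a)) (hab : a = b) : Tendsto f L (𝓝 b) :=
  hab ▸ h

section GraphTangents

variable {m l : ℕ} {q : Em m → Em l} {y : Em m} {C : ℝ}

theorem exists_correction_sequence (hq : ContDiff ℝ 2 q) (hs : SubregAt q y C)
    (hy : y ∈ Gam q) {h z : Em m} (h1 : ∀ i ∈ actI q y, gradQ q y i h ≤ 0)
    (h2 : ∀ i ∈ actI q y, gradQ q y i z + hessQ q y i h h ≤ 0) {t : ℕ → ℝ}
    (ht0 : ∀ k, 0 < t k) (ht : Tendsto t atTop (𝓝 0)) :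
    ∃ r : ℕ → Em m, Tendsto r atTop (𝓝 0) ∧
      ∀ᶠ k in atTop, y + t k • (h + t k • ((1 / 2 : ℝ) • z + r k)) ∈ Gam q := by
  obtain ⟨U, hU, hsub⟩ := hs
  set u : ℕ → Em m := fun k => h + t k • (1 / 2 : ℝ) • z with hu_def
  have hu : Tendsto u atTop (𝓝 h) :=
    tendsto_nhds_of_eq
      ((ht.smul (tendsto_const_nhds (x := (1 / 2 : ℝ) • z))).const_add h) (by simp)
  have hx := tendsto_add_smul y ht hu
  set e : ℕ → ℝ := fun k => ∑ i, max ((t k ^ 2)⁻¹ * q (y + t k • u k) i) 0 + t k with he_def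
  have he0 : ∀ k, 0 < e k := fun k =>
    add_pos_of_nonneg_of_pos (Finset.sum_nonneg fun i _ => le_max_right _ _) (ht0 k)
  have he : Tendsto e atTop (𝓝 0) := by
    have : Tendsto (fun k => ∑ i, max ((t k ^ 2)⁻¹ * q (y + t k • u k) i) 0) atTop
        (𝓝 (∑ _i : Fin l, (0 : ℝ))) := by
      refine tendsto_finsetSum _ fun i _ => ?_
      rcases (hy i).eq_or_lt with hi | hi
      · have ha := (tendsto_taylor_two hq y ht0 ht hu i).add_const (1 / 2 * gradQ q y i z)
        have hlim : Tendsto (fun k => max ((t k ^ 2)⁻¹ *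
            (q (y + t k • u k) i - q y i - t k * gradQ q y i (u k)) + 1 / 2 * gradQ q y i z) 0)
            atTop (𝓝 0) := by
          have hle : 1 / 2 * hessQ q y i h h + 1 / 2 * gradQ q y i z ≤ 0 := by
            linarith [h2 i hi]
          exact tendsto_nhds_of_eq (ha.max (tendsto_const_nhds (x := (0 : ℝ)))) (max_eq_right hle)
        refine squeeze_zero (fun k => le_max_right _ _) (fun k => max_le_max_right 0 ?_) hlim
        have hk := ht0 k
        have hg := mul_nonpos_of_nonneg_of_nonpos (inv_nonneg.2 hk.le) (h1 i hi)
        rw [hi, sub_zero, hu_def, gradQ_add, gradQ_smul, gradQ_smul]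
        have : (t k ^ 2)⁻¹ * (q (y + t k • (h + t k • (1 / 2 : ℝ) • z)) i -
            t k * (gradQ q y i h + t k * (1 / 2 * gradQ q y i z))) + 1 / 2 * gradQ q y i z =
            (t k ^ 2)⁻¹ * q (y + t k • (h + t k • (1 / 2 : ℝ) • z)) i -
            (t k)⁻¹ * gradQ q y i h := by
          field_simp
          ring
        linarith
      · refine tendsto_const_nhds.congr' ?_
        filter_upwards [(((continuous_apply_of_contDiff_two hq i).tendsto y).comp
          hx).eventually_lt_const hi] with k hk
        exact (max_eq_right (mul_nonpos_of_nonneg_of_nonpos (by have := ht0 k; positivity)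
          hk.le)).symm
    simpa using this.add ht
  have hev : ∀ᶠ k in atTop, ∃ r : Em m, ‖r‖ ≤ C * e k ∧
      y + t k • (h + t k • ((1 / 2 : ℝ) • z + r)) ∈ Gam q := by
    filter_upwards [hx.eventually hU] with k hkU
    have hk := ht0 k
    obtain ⟨x', hx', hn⟩ := hsub _ hkU (t k ^ 2 * e k) (mul_pos (by positivity) (he0 k))
      fun i => by
        have : (t k ^ 2)⁻¹ * q (y + t k • u k) i ≤ e k := by
          refine (le_max_left _ 0).trans ((Finset.single_le_sum
            (f := fun i => max ((t k ^ 2)⁻¹ * q (y + t k • u k) i) 0)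
            (fun i _ => le_max_right _ _) (Finset.mem_univ i)).trans ?_)
          simp only [he_def]
          linarith
        rwa [inv_mul_le_iff₀ (by positivity)] at this
    refine ⟨(t k ^ 2)⁻¹ • (x' - (y + t k • u k)), ?_, ?_⟩
    · rw [norm_smul, norm_sub_rev, norm_inv, Real.norm_of_nonneg (by positivity),
        inv_mul_le_iff₀ (by positivity)]
      linarith
    · have : y + t k • (h + t k • ((1 / 2 : ℝ) • z + (t k ^ 2)⁻¹ • (x' - (y + t k • u k)))) = x' := by
        rw [smul_add (t k) ((1 / 2 : ℝ) • z), ← add_assoc h, smul_add (t k) (h + _),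
          smul_smul (t k) (t k), ← pow_two, smul_smul (t k ^ 2), mul_inv_cancel₀ (by positivity),
          one_smul]
        simp only [hu_def]
        abel
      rwa [this]
  obtain ⟨r, hr⟩ := hev.choice
  refine ⟨r, ?_, hr.mono fun k hk => hk.2⟩
  refine squeeze_zero_norm' (hr.mono fun k hk => hk.1) ?_
  simpa using he.const_mul C

theorem exists_near_regular_normal (hq : ContDiff ℝ 2 q) {lam : Em l} (hl0 : ∀ i, 0 ≤ lam i)
    {x : Em m} (hx : x ∈ Gam q) {d : ℝ}
    (hd : -∑ i, lam i * q x i ≤ d ^ 2) (hd0 : 0 ≤ d) (hxd : ‖x - y‖ + d < 1) :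
    ∃ x' ∈ Gam q, ‖x' - x‖ ≤ d ∧ gradT q x' lam - (2 : ℝ) • (x' - x) ∈ regNormalCone (Gam q) x' := by
  set ψ : Em m → ℝ := fun p => -∑ i, lam i * q p i + ‖p - x‖ ^ 2 with hψ
  have hψc : Continuous ψ := by
    have := fun i => continuous_apply_of_contDiff_two hq i
    fun_prop
  have hK : IsCompact (Gam q ∩ closedBall y 1) :=
    (isCompact_closedBall y 1).inter_left (isClosed_Gam hq)
  obtain ⟨x', hx', hmin⟩ := hK.exists_isMinOn ⟨x, hx, by
    rw [mem_closedBall, dist_eq_norm]; linarith⟩ hψc.continuousOn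
  have hsum : ∀ p ∈ Gam q, ∑ i, lam i * q p i ≤ 0 := fun p hp =>
    Finset.sum_nonpos fun i _ => mul_nonpos_of_nonneg_of_nonpos (hl0 i) (hp i)
  have hdist : ‖x' - x‖ ≤ d := by
    have h1 : ψ x' ≤ ψ x := hmin ⟨hx, by rw [mem_closedBall, dist_eq_norm]; linarith⟩
    simp only [hψ, sub_self, norm_zero] at h1
    have h2 := hsum x' hx'.1
    exact abs_le_of_sq_le_sq' (by linarith) hd0 |>.2
  have hin_ball : x' ∈ ball y 1 := by
    rw [mem_ball, dist_eq_norm, ← sub_add_sub_cancel x' x y]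
    exact (norm_add_le _ _).trans_lt (by linarith)
  refine ⟨x', hx'.1, hdist, ?_⟩
  have hder : HasFDerivAt ψ (-∑ i, lam i • ((EuclideanSpace.proj (𝕜 := ℝ) i).comp
      (fderiv ℝ q x')) + (2 : ℝ) • (innerSL ℝ (x' - x))) x' := by
    refine HasFDerivAt.add (HasFDerivAt.neg (HasFDerivAt.fun_sum fun i _ => ?_)) ?_
    · exact (((EuclideanSpace.proj i : Em l →L[ℝ] ℝ).hasFDerivAt.comp x'
        (hasFDerivAt_of_contDiff_two hq x'))).const_mul (lam i)
    · have := ((hasFDerivAt_id (𝕜 := ℝ) x').sub_const x).norm_sq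
      refine this.congr_fderiv ?_
      ext v
      simp [two_smul]
  refine neg_mem_regNormalCone_of_isLocalMinOn hder (fun v => ?_) ?_
  · rw [inner_sub_left, inner_gradT, real_inner_smul_left]
    simp [gradQ, inner_sub_left]
    ring
  · have : IsMinOn ψ (Gam q ∩ closedBall y 1) x' := hmin
    filter_upwards [self_mem_nhdsWithin, mem_nhdsWithin_of_mem_nhds (isOpen_ball.mem_nhds hin_ball)]
      with p hp hpb
    exact this ⟨hp, ball_subset_closedBall hpb⟩

/-- A second-order sufficient condition for tangents to the graph of the regular normal cone
mapping. -/
theorem mem_tanCone_GphNhat (hq : ContDiff ℝ 2 q) (hs : SubregAt q y C)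
    (hy : y ∈ Gam q) {lam : Em l} (hl : lam ∈ NRl q y) {h z : Em m}
    (h1 : ∀ i ∈ actI q y, gradQ q y i h ≤ 0) (h1' : ∀ i, lam i * gradQ q y i h = 0)
    (h2 : ∀ i ∈ actI q y, gradQ q y i z + hessQ q y i h h ≤ 0)
    (h2' : ∀ i, lam i * (gradQ q y i z + hessQ q y i h h) = 0) :
    (h, hessT q y lam h) ∈ tanCone (GphNhat q) (y, gradT q y lam) := by
  set t : ℕ → ℝ := fun k => ((k : ℝ) + 1)⁻¹ with ht_def
  have ht0 : ∀ k, 0 < t k := fun k => by positivity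
  have ht : Tendsto t atTop (𝓝 0) := tendsto_inv_natCast_add_one
  obtain ⟨r, hr, hmem⟩ := exists_correction_sequence hq hs hy h1 h2 ht0 ht
  set u : ℕ → Em m := fun k => h + t k • ((1 / 2 : ℝ) • z + r k) with hu_def
  have hu : Tendsto u atTop (𝓝 h) :=
    tendsto_nhds_of_eq ((ht.smul (hr.const_add ((1 / 2 : ℝ) • z))).const_add h) (by simp)
  have hx := tendsto_add_smul y ht hu
  set e : ℕ → ℝ := fun k => max ((t k ^ 2)⁻¹ * -∑ i, lam i * q (y + t k • u k) i) 0 with he_def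
  have he : Tendsto e atTop (𝓝 0) := by
    have h3 : ∀ i, Tendsto (fun k => (t k ^ 2)⁻¹ * (lam i * q (y + t k • u k) i)) atTop (𝓝 0) := by
      intro i
      have ha := (tendsto_taylor_two hq y ht0 ht hu i).const_mul (lam i)
      have hg : Tendsto (fun k => lam i * gradQ q y i ((1 / 2 : ℝ) • z + r k)) atTop
          (𝓝 (lam i * gradQ q y i ((1 / 2 : ℝ) • z))) := by
        refine Tendsto.const_mul _ ?_
        have hc : Continuous fun v => gradQ q y i v :=
          (EuclideanSpace.proj (𝕜 := ℝ) i).continuous.comp (fderiv ℝ q y).continuous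
        exact tendsto_nhds_of_eq ((hc.tendsto _).comp (hr.const_add ((1 / 2 : ℝ) • z))) (by simp)
      have hsum := ha.add hg
      have h0 : lam i * (1 / 2 * hessQ q y i h h) + lam i * gradQ q y i ((1 / 2 : ℝ) • z) = 0 := by
        rw [gradQ_smul]
        linarith [h2' i]
      rw [h0] at hsum
      refine hsum.congr fun k => ?_
      have hk := (ht0 k).ne'
      have hlq : lam i * q y i = 0 := by
        by_cases hi : q y i = 0
        · rw [hi, mul_zero]
        · rw [hl.2 i hi, zero_mul]
      have e1 : lam i * ((t k ^ 2)⁻¹ * (q (y + t k • u k) i - q y i - t k * gradQ q y i (u k))) =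
          (t k ^ 2)⁻¹ * (lam i * q (y + t k • u k) i) - (t k ^ 2)⁻¹ * (lam i * q y i) -
          (t k)⁻¹ * (lam i * gradQ q y i (u k)) := by
        field_simp
      have e2 : lam i * gradQ q y i (u k) = t k * (lam i * gradQ q y i ((1 / 2 : ℝ) • z + r k)) := by
        rw [hu_def, gradQ_add, gradQ_smul, mul_add, h1' i]
        ring
      rw [e1, e2, hlq, ← mul_assoc (t k)⁻¹, inv_mul_cancel₀ hk]
      ring
    have h4 := (tendsto_finsetSum Finset.univ fun i _ => h3 i).neg.max
      (tendsto_const_nhds (x := (0 : ℝ)))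
    simp only [Finset.sum_const_zero, neg_zero, max_self] at h4
    refine h4.congr fun k => ?_
    simp only [he_def, mul_neg, Finset.mul_sum]
  have hes : Tendsto (fun k => √(e k)) atTop (𝓝 0) :=
    tendsto_nhds_of_eq ((Real.continuous_sqrt.tendsto 0).comp he) Real.sqrt_zero
  have hsmall : ∀ᶠ k in atTop, ‖y + t k • u k - y‖ + t k * √(e k) < 1 := by
    have h5 : Tendsto (fun k => ‖y + t k • u k - y‖ + t k * √(e k)) atTop (𝓝 (‖y - y‖ + 0 * 0)) :=
      (hx.sub_const y).norm.add (ht.mul hes)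
    rw [sub_self, norm_zero, mul_zero, add_zero] at h5
    exact h5.eventually_lt_const one_pos
  have hev : ∀ᶠ k in atTop, ∃ x' ∈ Gam q, ‖x' - (y + t k • u k)‖ ≤ t k * √(e k) ∧
      gradT q x' lam - (2 : ℝ) • (x' - (y + t k • u k)) ∈ regNormalCone (Gam q) x' := by
    filter_upwards [hmem, hsmall] with k hk hks
    have hk0 := ht0 k
    refine exists_near_regular_normal hq hl.1 hk ?_ (by positivity) hks
    rw [mul_pow, Real.sq_sqrt (le_max_right _ _), ← inv_mul_le_iff₀ (by positivity)]
    exact le_max_left _ _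
  obtain ⟨x', hx'⟩ := hev.choice
  set p : ℕ → Em m := fun k => (t k)⁻¹ • (x' k - (y + t k • u k)) with hp_def
  have hp : Tendsto p atTop (𝓝 0) := by
    refine squeeze_zero_norm' (hx'.mono fun k hk => ?_) hes
    rw [norm_smul, norm_inv, Real.norm_of_nonneg (ht0 k).le, inv_mul_le_iff₀ (ht0 k)]
    exact hk.2.1
  have hup : Tendsto (fun k => u k + p k) atTop (𝓝 h) := by simpa using hu.add hp
  have hxe : ∀ k, y + t k • (u k + p k) = x' k := fun k => by
    rw [hp_def, smul_add, smul_smul, mul_inv_cancel₀ (ht0 k).ne', one_smul]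
    abel
  have hgt := (tendsto_gradT_quotient hq y ht0 ht hup (tendsto_const_nhds (x := lam))).sub
    (hp.const_smul (2 : ℝ))
  rw [smul_zero, sub_zero] at hgt
  refine mem_tanCone_of_eventually ht0 ht (hup.prodMk_nhds hgt) (hx'.mono fun k hk => ?_)
  have e3 : (y, gradT q y lam) + t k • (u k + p k, (t k)⁻¹ • (gradT q (y + t k • (u k + p k)) lam -
      gradT q y lam) - (2 : ℝ) • p k) =
      (x' k, gradT q (x' k) lam - (2 : ℝ) • (x' k - (y + t k • u k))) := by
    refine Prod.ext (hxe k) ?_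
    have h6 : t k • p k = x' k - (y + t k • u k) := by
      rw [hp_def, smul_smul, mul_inv_cancel₀ (ht0 k).ne', one_smul]
    simp only [Prod.snd_add, Prod.smul_snd]
    rw [hxe, smul_sub, smul_smul, mul_inv_cancel₀ (ht0 k).ne', one_smul, smul_comm, h6]
    abel
  rw [e3]
  exact ⟨hk.1, hk.2.2⟩

end GraphTangents

section DirectionalMultipliers

variable {m l : ℕ} {q : Em m → Em l} {y x v : Em m} {lam : Em l}

theorem mem_LamDir_of_complementary (hl : lam ∈ Lam q y x) {z : Em m} (hz : z ∈ Xibar q y v)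
    (hc : ∀ i, lam i * (gradQ q y i z + hessQ q y i v v) = 0) : lam ∈ LamDir q y x v := by
  refine ⟨hl, fun lam' hl' => ?_⟩
  have key : ∀ a ∈ Lam q y x, ∑ i, a i * hessQ q y i v v =
      ∑ i, a i * (gradQ q y i z + hessQ q y i v v) - ⟪x, z⟫ := by
    intro a ha
    rw [← ha.2, inner_gradT, ← Finset.sum_sub_distrib]
    exact Finset.sum_congr rfl fun i _ => by ring
  rw [key _ hl', key _ hl]
  have h1 : ∑ i, lam i * (gradQ q y i z + hessQ q y i v v) = 0 :=
    Finset.sum_eq_zero fun i _ => hc i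
  have h2 : ∑ i, lam' i * (gradQ q y i z + hessQ q y i v v) ≤ 0 := by
    refine Finset.sum_nonpos fun i _ => ?_
    by_cases hi : q y i = 0
    · exact mul_nonpos_of_nonneg_of_nonpos (hl'.1.1 i) (hz i hi)
    · rw [hl'.1.2 i hi, zero_mul]
  linarith

theorem exists_add_smul_mem_NRl (hl : lam ∈ NRl q y) {σ : Em l}
    (hσ : σ ∈ Pset (Iplus lam) (actI q y)) : ∃ ε > (0 : ℝ), lam + ε • σ ∈ NRl q y := by
  have h : ∀ᶠ ε in 𝓝[>] (0 : ℝ), ∀ i, 0 < lam i → 0 ≤ lam i + ε * σ i := by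
    refine eventually_all.2 fun i => ?_
    by_cases hi : 0 < lam i
    · have hc : Continuous fun ε : ℝ => lam i + ε * σ i := by fun_prop
      have : ∀ᶠ ε in 𝓝 (0 : ℝ), 0 < lam i + ε * σ i :=
        (hc.tendsto 0).eventually_const_lt (by simpa using hi)
      exact (this.filter_mono nhdsWithin_le_nhds).mono fun ε h _ => h.le
    · exact Eventually.of_forall fun ε h => absurd h hi
  obtain ⟨ε, hε, hpos⟩ := (h.and self_mem_nhdsWithin).exists
  have hpos' : (0 : ℝ) < ε := hpos
  refine ⟨ε, hpos', fun i => ?_, fun i hi => ?_⟩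
  · change 0 ≤ lam i + ε * σ i
    by_cases h1 : 0 < lam i
    · exact hε i h1
    · refine add_nonneg (hl.1 i) (mul_nonneg hpos'.le ?_)
      by_cases h2 : i ∈ actI q y
      · exact hσ.2 i ⟨h2, h1⟩
      · exact (hσ.1 i h2).ge
  · change lam i + ε * σ i = 0
    rw [hl.2 i hi, hσ.1 i hi, mul_zero, add_zero]

theorem Iplus_subset_actI (hl : lam ∈ NRl q y) : Iplus lam ⊆ actI q y := fun i hi => by
  by_contra h
  have h1 : 0 < lam i := hi
  exact h1.ne' (hl.2 i h)

theorem exists_Xibar_of_mem_LamDir (hl : lam ∈ LamDir q y x v) :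
    ∃ z ∈ Xibar q y v, ∀ i ∈ Iplus lam, gradQ q y i z + hessQ q y i v v = 0 := by
  obtain ⟨z, h1, h2⟩ := exists_gradQ_solution (q := q) (y := y) (Iplus_subset_actI hl.1.1)
    (c := fun i => hessQ q y i v v) (fun σ hσ h0 => by
      obtain ⟨ε, hε, hmem⟩ := exists_add_smul_mem_NRl hl.1.1 hσ
      have h := hl.2 _ ⟨hmem, by rw [gradT_add, gradT_smul, h0, smul_zero, add_zero, hl.1.2]⟩
      have e : ∑ i, (lam + ε • σ) i * hessQ q y i v v =
          ∑ i, lam i * hessQ q y i v v + ε * ∑ i, σ i * hessQ q y i v v := by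
        rw [Finset.mul_sum, ← Finset.sum_add_distrib]
        exact Finset.sum_congr rfl fun i _ => by
          simp only [PiLp.add_apply, PiLp.smul_apply, smul_eq_mul]
          ring
      rw [e] at h
      exact nonpos_of_mul_nonpos_right (by linarith) hε)
  refine ⟨z, fun i hi => ?_, h1⟩
  by_cases hp : i ∈ Iplus lam
  exacts [(h1 i hp).le, h2 i ⟨hi, hp⟩]

theorem gradT_sum_eq_zero {σ : Em l} (h0 : gradT q y σ = 0) (w : Em m) :
    ∑ i, σ i * gradQ q y i w = 0 := by
  rw [← inner_gradT, h0, inner_zero_left]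

theorem Pset_sum_nonpos {F I : Set (Fin l)} {σ : Em l} (hσ : σ ∈ Pset F I) {c : Fin l → ℝ}
    (h1 : ∀ i ∈ F, c i = 0) (h2 : ∀ i ∈ I \ F, c i ≤ 0) : ∑ i, σ i * c i ≤ 0 := by
  refine Finset.sum_nonpos fun i _ => ?_
  by_cases hF : i ∈ F
  · rw [h1 i hF, mul_zero]
  by_cases hI : i ∈ I
  · exact mul_nonpos_of_nonneg_of_nonpos (hσ.2 i ⟨hI, hF⟩) (h2 i ⟨hI, hF⟩)
  · rw [hσ.1 i hI, zero_mul]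

theorem exists_Xibar_of_sequence (hq : ContDiff ℝ 2 q) {t : ℕ → ℝ} {uk : ℕ → Em m} {u : Em m}
    (ht0 : ∀ k, 0 < t k) (ht : Tendsto t atTop (𝓝 0)) (hu : Tendsto uk atTop (𝓝 u))
    (hmem : ∀ k, y + t k • uk k ∈ Gam q) {I : Set (Fin l)} (hI : I ⊆ actI q y)
    (hIk : ∀ k, ∀ i ∈ I, q (y + t k • uk k) i = 0) :
    ∃ z ∈ Xibar q y u, ∀ i ∈ I, gradQ q y i z + hessQ q y i u u = 0 := by
  obtain ⟨z, h1, h2⟩ := exists_gradQ_solution (q := q) (y := y) hI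
    (c := fun i => hessQ q y i u u) (fun σ hσ h0 => by
      have hlim := tendsto_finsetSum Finset.univ fun i _ =>
        (tendsto_taylor_two hq y ht0 ht hu i).const_mul (σ i)
      have hle : ∑ i, σ i * (1 / 2 * hessQ q y i u u) ≤ 0 := by
        refine le_of_tendsto' hlim fun k => ?_
        have e : ∑ i, σ i * ((t k ^ 2)⁻¹ * (q (y + t k • uk k) i - q y i -
            t k * gradQ q y i (uk k))) = (t k ^ 2)⁻¹ * (∑ i, σ i * q (y + t k • uk k) i) -
            (t k ^ 2)⁻¹ * t k * ∑ i, σ i * gradQ q y i (uk k) := by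
          rw [Finset.mul_sum, Finset.mul_sum, ← Finset.sum_sub_distrib]
          refine Finset.sum_congr rfl fun i _ => ?_
          have h3 : σ i * q y i = 0 := by
            by_cases hi : q y i = 0
            · rw [hi, mul_zero]
            · rw [hσ.1 i hi, zero_mul]
          linear_combination -(t k ^ 2)⁻¹ * h3
        rw [e, gradT_sum_eq_zero h0, mul_zero, sub_zero]
        have := ht0 k
        exact mul_nonpos_of_nonneg_of_nonpos (by positivity)
          (Pset_sum_nonpos hσ (hIk k) fun i _ => hmem k i)
      have e2 : ∑ i, σ i * (1 / 2 * hessQ q y i u u) = 1 / 2 * ∑ i, σ i * hessQ q y i u u := by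
        rw [Finset.mul_sum]
        exact Finset.sum_congr rfl fun i _ => by ring
      rw [e2] at hle
      linarith)
  refine ⟨z, fun i hi => ?_, h1⟩
  by_cases hp : i ∈ I
  exacts [(h1 i hp).le, h2 i ⟨hi, hp⟩]

theorem continuous_gradQ (q : Em m → Em l) (y : Em m) (i : Fin l) :
    Continuous fun w => gradQ q y i w :=
  (EuclideanSpace.proj (𝕜 := ℝ) i).continuous.comp (fderiv ℝ q y).continuous

theorem continuous_hessQ_right (q : Em m → Em l) (y v : Em m) (i : Fin l) :
    Continuous fun w => hessQ q y i v w :=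
  (EuclideanSpace.proj (𝕜 := ℝ) i).continuous.comp (fderiv ℝ (fderiv ℝ q) y v).continuous

theorem continuous_hessQ_diag (q : Em m → Em l) (y : Em m) (i : Fin l) :
    Continuous fun w => hessQ q y i w w :=
  (EuclideanSpace.proj (𝕜 := ℝ) i).continuous.comp
    ((fderiv ℝ (fderiv ℝ q) y).continuous.clm_apply continuous_id)

theorem tendsto_gradQ (hq : ContDiff ℝ 2 q) {yk wk : ℕ → Em m} {w : Em m}
    (hy : Tendsto yk atTop (𝓝 y)) (hw : Tendsto wk atTop (𝓝 w)) (i : Fin l) :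
    Tendsto (fun k => gradQ q (yk k) i (wk k)) atTop (𝓝 (gradQ q y i w)) :=
  ((EuclideanSpace.proj (𝕜 := ℝ) i).continuous.tendsto _).comp
    (tendsto_clm_apply (((continuous_fderiv_of_contDiff_two hq).tendsto y).comp hy) hw)

theorem tendsto_gradT (hq : ContDiff ℝ 2 q) {yk : ℕ → Em m} {lk : ℕ → Em l}
    (hy : Tendsto yk atTop (𝓝 y)) (hl : Tendsto lk atTop (𝓝 lam)) :
    Tendsto (fun k => gradT q (yk k) (lk k)) atTop (𝓝 (gradT q y lam)) :=
  tendsto_clm_apply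
    (((ContinuousLinearMap.adjoint (𝕜 := ℝ) (E := Em m) (F := Em l)).continuous.tendsto _).comp
      (((continuous_fderiv_of_contDiff_two hq).tendsto y).comp hy)) hl

theorem tendsto_hessT (hq : ContDiff ℝ 2 q) {yk wk : ℕ → Em m} {lk : ℕ → Em l} {w : Em m}
    (hy : Tendsto yk atTop (𝓝 y)) (hl : Tendsto lk atTop (𝓝 lam)) (hw : Tendsto wk atTop (𝓝 w)) :
    Tendsto (fun k => hessT q (yk k) (lk k) (wk k)) atTop (𝓝 (hessT q y lam w)) := by
  have hc : Continuous (fderiv ℝ (fderiv ℝ q)) :=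
    (contDiff_fderiv_of_contDiff_two hq).continuous_fderiv (by norm_num)
  exact tendsto_clm_apply
    (((ContinuousLinearMap.adjoint (𝕜 := ℝ) (E := Em m) (F := Em l)).continuous.tendsto _).comp
      (tendsto_clm_apply ((hc.tendsto y).comp hy) hw)) hl

theorem Xibar_nonempty_of_mem_Tlin (hq : ContDiff ℝ 2 q) {C : ℝ} (hs : SubregAt q y C)
    (hy : y ∈ Gam q) (hv : v ∈ Tlin q y) : (Xibar q y v).Nonempty := by
  obtain ⟨z, -, h2⟩ := exists_gradQ_solution (q := q) (y := y) (empty_subset (actI q y))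
    (c := fun i => hessQ q y i v v) (fun σ hσ h0 => by
      have hex : ∀ n : ℕ, ∃ h' ∈ tanCone (Gam q) y, ‖v - h'‖ ≤ C * ((n : ℝ) + 1)⁻¹ := fun n =>
        exists_mem_tanCone_norm_sub_le hq hs hy (by positivity)
          fun i hi => (hv i hi).trans_lt (by positivity)
      choose h hh hn using hex
      have hlim : Tendsto h atTop (𝓝 v) := by
        rw [tendsto_iff_norm_sub_tendsto_zero]
        exact squeeze_zero (fun n => norm_nonneg _) (g := fun n : ℕ => C * ((n : ℝ) + 1)⁻¹)
          (fun n => (norm_sub_rev _ _).trans_le (hn n))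
          (tendsto_nhds_of_eq (tendsto_inv_natCast_add_one.const_mul C) (mul_zero C))
      have hcont : Continuous fun w => ∑ i, σ i * hessQ q y i w w :=
        continuous_finsetSum _ fun i _ => (continuous_hessQ_diag q y i).const_mul _
      refine le_of_tendsto' ((hcont.tendsto v).comp hlim) fun n => ?_
      obtain ⟨t, uk, ht0, ht, hu, hmem⟩ := hh n
      obtain ⟨z, hz, -⟩ := exists_Xibar_of_sequence hq ht0 ht hu hmem (empty_subset _)
        (fun k i hi => absurd hi (notMem_empty i))
      have h3 := Pset_sum_nonpos hσ (c := fun i => gradQ q y i z + hessQ q y i (h n) (h n))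
        (fun i hi => absurd hi (notMem_empty i)) (fun i hi => hz i hi.1)
      simp only [mul_add, Finset.sum_add_distrib, gradT_sum_eq_zero h0, zero_add] at h3
      exact h3)
  exact ⟨z, fun i hi => h2 i ⟨hi, notMem_empty i⟩⟩

theorem mem_KconeDir_iff {P I : Set (Fin l)} (hPI : P ⊆ I) {w : Em m} :
    w ∈ KconeDir q y P I v ↔ w ∈ Kcone q y P I ∧
      ∀ σ ∈ Pset P I, gradT q y σ = 0 → ∑ i, σ i * hessQ q y i v w ≤ 0 := by
  refine ⟨fun ⟨hw, z, h1, h2⟩ => ⟨hw, fun σ hσ h0 => ?_⟩, fun ⟨hw, h⟩ =>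
    ⟨hw, exists_gradQ_solution hPI h⟩⟩
  have h3 := Pset_sum_nonpos hσ h1 h2
  simp only [mul_add, Finset.sum_add_distrib, gradT_sum_eq_zero h0, zero_add] at h3
  exact h3

theorem mem_Kcone_of_tendsto (hq : ContDiff ℝ 2 q) {P I : Set (Fin l)} {yk wk : ℕ → Em m}
    {w : Em m} (hy : Tendsto yk atTop (𝓝 y)) (hw : Tendsto wk atTop (𝓝 w))
    (h : ∀ k, wk k ∈ Kcone q (yk k) P I) : w ∈ Kcone q y P I :=
  ⟨fun i hi => tendsto_nhds_unique (tendsto_gradQ hq hy hw i)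
      (tendsto_const_nhds.congr fun k => ((h k).1 i hi).symm),
    fun i hi => le_of_tendsto' (tendsto_gradQ hq hy hw i) fun k => (h k).2 i hi⟩

theorem mem_KconeDir_of_tendsto (hq : ContDiff ℝ 2 q) {P I : Set (Fin l)} (hPI : P ⊆ I)
    {wk : ℕ → Em m} {w : Em m} (hw : Tendsto wk atTop (𝓝 w))
    (h : ∀ k, wk k ∈ KconeDir q y P I v) : w ∈ KconeDir q y P I v := by
  rw [mem_KconeDir_iff hPI]
  refine ⟨mem_Kcone_of_tendsto hq tendsto_const_nhds hw fun k => (h k).1, fun σ hσ h0 => ?_⟩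
  have hcont : Continuous fun w => ∑ i, σ i * hessQ q y i v w :=
    continuous_finsetSum _ fun i _ => (continuous_hessQ_right q y v i).const_mul _
  exact le_of_tendsto' ((hcont.tendsto w).comp hw) fun k =>
    ((mem_KconeDir_iff hPI).1 (h k)).2 σ hσ h0

/-- Outer limits of the cones `Kcone q (y + t k • u k) P I` lie in the directional cone. -/
theorem mem_KconeDir_of_tendsto_Kcone (hq : ContDiff ℝ 2 q) {P I : Set (Fin l)} (hPI : P ⊆ I)
    {t : ℕ → ℝ} {uk : ℕ → Em m} {u : Em m} (ht0 : ∀ k, 0 < t k) (ht : Tendsto t atTop (𝓝 0))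
    (hu : Tendsto uk atTop (𝓝 u)) {wk : ℕ → Em m} {w : Em m} (hw : Tendsto wk atTop (𝓝 w))
    (h : ∀ k, wk k ∈ Kcone q (y + t k • uk k) P I) : w ∈ KconeDir q y P I u := by
  rw [mem_KconeDir_iff hPI]
  refine ⟨mem_Kcone_of_tendsto hq (tendsto_add_smul y ht hu) hw h, fun σ hσ h0 => ?_⟩
  have hlim := tendsto_finsetSum Finset.univ fun i _ =>
    (tendsto_gradQ_quotient hq y ht0 ht hu hw i).const_mul (σ i)
  refine le_of_tendsto' hlim fun k => ?_
  have e : ∑ i, σ i * ((t k)⁻¹ * (gradQ q (y + t k • uk k) i (wk k) - gradQ q y i (wk k))) =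
      (t k)⁻¹ * ∑ i, σ i * gradQ q (y + t k • uk k) i (wk k) -
      (t k)⁻¹ * ∑ i, σ i * gradQ q y i (wk k) := by
    rw [Finset.mul_sum, Finset.mul_sum, ← Finset.sum_sub_distrib]
    exact Finset.sum_congr rfl fun i _ => by ring
  rw [e, gradT_sum_eq_zero h0, mul_zero, sub_zero]
  exact mul_nonpos_of_nonneg_of_nonpos (inv_nonneg.2 (ht0 k).le)
    (Pset_sum_nonpos hσ (h k).1 (h k).2)

theorem exists_Kcone_projection (q : Em m → Em l) (y : Em m) (P I : Set (Fin l)) (x : Em m) :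
    ∃ p ∈ Kcone q y P I, (∀ d ∈ Kcone q y P I, ⟪x - p, d⟫ ≤ 0) ∧ ⟪x - p, p⟫ = 0 := by
  have hcone : ∀ a ∈ Kcone q y P I, ∀ b ∈ Kcone q y P I, ∀ s r : ℝ, 0 ≤ s → 0 ≤ r →
      s • a + r • b ∈ Kcone q y P I := by
    intro a ha b hb s r hs hr
    refine ⟨fun i hi => ?_, fun i hi => ?_⟩
    · rw [gradQ_add, gradQ_smul, gradQ_smul, ha.1 i hi, hb.1 i hi, mul_zero, mul_zero, add_zero]
    · rw [gradQ_add, gradQ_smul, gradQ_smul]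
      exact add_nonpos (mul_nonpos_of_nonneg_of_nonpos hs (ha.2 i hi))
        (mul_nonpos_of_nonneg_of_nonpos hr (hb.2 i hi))
  have hclosed : IsClosed (Kcone q y P I) := by
    simp only [Kcone, ofPred_forall, ofPred_and]
    exact (isClosed_iInter fun i => isClosed_iInter fun _ =>
      isClosed_eq (continuous_gradQ q y i) continuous_const).inter
      (isClosed_iInter fun i => isClosed_iInter fun _ =>
      isClosed_le (continuous_gradQ q y i) continuous_const)
  have hzero : (0 : Em m) ∈ Kcone q y P I := by simp [Kcone, gradQ]
  have hconv : Convex ℝ (Kcone q y P I) := fun a ha b hb s r hs hr _ => hcone a ha b hb s r hs hr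
  obtain ⟨p, hp, hmin⟩ := exists_norm_eq_iInf_of_complete_convex ⟨0, hzero⟩
    hclosed.isComplete hconv x
  have h1 := (norm_eq_iInf_iff_real_inner_le_zero hconv hp).1 hmin
  have h2 : ⟪x - p, p⟫ = 0 := by
    have ha := h1 0 hzero
    have hb := h1 _ (hcone p hp p hp 1 1 zero_le_one zero_le_one)
    simp only [one_smul, zero_sub, inner_neg_right, add_sub_cancel_right] at ha hb
    linarith
  refine ⟨p, hp, fun d hd => ?_, h2⟩
  have := h1 d hd
  rwa [inner_sub_right, h2, sub_zero] at this

/-- Under a quantitative rank condition the cones `Kcone q (y + t k • u k) P I` approximate the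
directional cone from inside. -/
theorem exists_Kcone_tendsto (hq : ContDiff ℝ 2 q) {P I : Set (Fin l)} (hPI : P ⊆ I)
    {t : ℕ → ℝ} {uk : ℕ → Em m} {u : Em m} (ht0 : ∀ k, 0 < t k) (ht : Tendsto t atTop (𝓝 0))
    (hu : Tendsto uk atTop (𝓝 u)) {c : ℝ} (hc : 0 < c)
    (hrank : ∀ k, ∀ μ : Em l, (∀ i ∉ I, μ i = 0) → c * t k * ‖μ‖ ≤ ‖gradT q (y + t k • uk k) μ‖)
    {w : Em m} (hw : w ∈ KconeDir q y P I u) :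
    ∃ wk : ℕ → Em m, (∀ k, wk k ∈ Kcone q (y + t k • uk k) P I) ∧ Tendsto wk atTop (𝓝 w) := by
  choose wk hwk hpol hort using fun k => exists_Kcone_projection q (y + t k • uk k) P I w
  refine ⟨wk, hwk, ?_⟩
  obtain ⟨hwK, z, hz1, hz2⟩ := hw
  have hwz : Tendsto (fun k => w + t k • z) atTop (𝓝 w) :=
    tendsto_add_smul w ht tendsto_const_nhds
  set e : ℕ → Fin l → ℝ := fun k i =>
    (t k)⁻¹ * (gradQ q (y + t k • uk k) i (w + t k • z) - gradQ q y i (w + t k • z))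
  set ε : ℕ → ℝ := fun k => ∑ i, |e k i - hessQ q y i u w|
  have hε : Tendsto ε atTop (𝓝 0) := by
    have := tendsto_finsetSum Finset.univ fun i _ =>
      ((tendsto_gradQ_quotient hq y ht0 ht hu hwz i).sub_const (hessQ q y i u w)).abs
    exact tendsto_nhds_of_eq this (by simp)
  rw [tendsto_iff_norm_sub_tendsto_zero]
  refine squeeze_zero (fun k => norm_nonneg _) (g := fun k => ε k / c + t k * ‖z‖) (fun k => ?_) ?_
  swap
  · exact tendsto_nhds_of_eq ((hε.div_const c).add (ht.mul_const ‖z‖)) (by simp)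
  have hk := ht0 k
  obtain ⟨μ, hμ, hr⟩ := exists_Pset_gradT_eq hPI (hpol k)
  set r := w - wk k with hr_def
  have h1 : ‖r‖ ^ 2 = ⟪r, w⟫ := by
    rw [← real_inner_self_eq_norm_sq]
    nth_rewrite 2 [hr_def]
    rw [inner_sub_right, hort k, sub_zero]
  have h2 : ⟪r, w + t k • z⟫ ≤ t k * (‖μ‖ * ε k) := by
    rw [← hr, inner_gradT]
    have h3 : ∀ i, gradQ q (y + t k • uk k) i (w + t k • z) = gradQ q y i w +
        t k * (gradQ q y i z + hessQ q y i u w) + t k * (e k i - hessQ q y i u w) := by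
      intro i
      have : t k * e k i =
          gradQ q (y + t k • uk k) i (w + t k • z) - gradQ q y i (w + t k • z) := by
        rw [← mul_assoc, mul_inv_cancel₀ hk.ne', one_mul]
      rw [mul_sub, this, gradQ_add q y, gradQ_smul q y]
      ring
    have h4 := Pset_sum_nonpos hμ
      (c := fun i => gradQ q y i w + t k * (gradQ q y i z + hessQ q y i u w))
      (fun i hi => by rw [hwK.1 i hi, hz1 i hi, mul_zero, add_zero])
      (fun i hi => add_nonpos (hwK.2 i hi) (mul_nonpos_of_nonneg_of_nonpos hk.le (hz2 i hi)))
    have h5 : ∑ i, μ i * (t k * (e k i - hessQ q y i u w)) ≤ t k * (‖μ‖ * ε k) := by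
      rw [Finset.mul_sum, Finset.mul_sum]
      refine Finset.sum_le_sum fun i _ => ?_
      rw [mul_left_comm]
      refine mul_le_mul_of_nonneg_left ((le_abs_self _).trans ?_) hk.le
      rw [abs_mul]
      exact mul_le_mul_of_nonneg_right (by simpa using PiLp.norm_apply_le μ i) (abs_nonneg _)
    calc _ = ∑ i, μ i * (gradQ q y i w + t k * (gradQ q y i z + hessQ q y i u w)) +
          ∑ i, μ i * (t k * (e k i - hessQ q y i u w)) := by
          rw [← Finset.sum_add_distrib]
          exact Finset.sum_congr rfl fun i _ => by rw [h3]; ring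
      _ ≤ _ := by linarith
  have h6 : t k * ‖μ‖ ≤ ‖r‖ / c := by
    rw [le_div_iff₀ hc, ← hr]
    linarith [hrank k μ hμ.1]
  have hε0 : 0 ≤ ε k := Finset.sum_nonneg fun i _ => abs_nonneg _
  have h7 : ‖r‖ ^ 2 ≤ ‖r‖ * (ε k / c + t k * ‖z‖) := by
    rw [inner_add_right, real_inner_smul_right] at h2
    have h8 := mul_le_mul_of_nonneg_left ((neg_le_abs _).trans (abs_real_inner_le_norm r z)) hk.le
    have h9 := mul_le_mul_of_nonneg_right h6 hε0
    have h10 : ‖r‖ / c * ε k = ‖r‖ * (ε k / c) := by ring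
    rw [h1, mul_add]
    linarith
  rw [norm_sub_rev]
  rcases (norm_nonneg r).eq_or_lt with h0 | h0
  · rw [← hr_def, ← h0]
    positivity
  · exact le_of_mul_le_mul_left (by rw [← pow_two]; exact h7) h0

theorem exists_polarCone_Kcone_tendsto (hq : ContDiff ℝ 2 q) {P I : Set (Fin l)} (hPI : P ⊆ I)
    {t : ℕ → ℝ} {uk : ℕ → Em m} {u : Em m} (ht0 : ∀ k, 0 < t k) (ht : Tendsto t atTop (𝓝 0))
    (hu : Tendsto uk atTop (𝓝 u)) (hx : x ∈ polarCone (KconeDir q y P I u)) :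
    ∃ xk : ℕ → Em m, (∀ k, xk k ∈ polarCone (Kcone q (y + t k • uk k) P I)) ∧
      Tendsto xk atTop (𝓝 x) := by
  choose p hp hpol hort using fun k => exists_Kcone_projection q (y + t k • uk k) P I x
  refine ⟨fun k => x - p k, fun k => hpol k, ?_⟩
  have hsq : ∀ k, ‖p k‖ ^ 2 = ⟪x, p k⟫ := fun k => by
    have := hort k
    rw [inner_sub_left, real_inner_self_eq_norm_sq] at this
    linarith
  have hbd : ∀ k, p k ∈ closedBall (0 : Em m) ‖x‖ := fun k => by
    rw [mem_closedBall_zero_iff]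
    rcases (norm_nonneg (p k)).eq_or_lt with h0 | h0
    · rw [← h0]; positivity
    · have := (hsq k).le.trans (real_inner_le_norm x (p k))
      rw [pow_two] at this
      exact le_of_mul_le_mul_right this h0
  have hlim : Tendsto p atTop (𝓝 0) := by
    refine tendsto_of_subseq_tendsto fun ns hns => ?_
    obtain ⟨p₀, -, φ, hφ, hp₀⟩ := (isCompact_closedBall (0 : Em m) ‖x‖).tendsto_subseq
      fun k => hbd (ns k)
    have hcomp : Tendsto (fun k => ns (φ k)) atTop atTop := hns.comp hφ.tendsto_atTop
    have hmem : p₀ ∈ KconeDir q y P I u :=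
      mem_KconeDir_of_tendsto_Kcone hq hPI (fun k => ht0 (ns (φ k))) (ht.comp hcomp)
        (hu.comp hcomp) hp₀ fun k => hp _
    have h1 : ‖p₀‖ ^ 2 = ⟪x, p₀⟫ :=
      tendsto_nhds_unique (hp₀.norm.pow 2) ((tendsto_const_nhds.inner hp₀).congr fun k =>
        (hsq (ns (φ k))).symm)
    have h2 : ‖p₀‖ ^ 2 ≤ 0 := h1.le.trans (hx p₀ hmem)
    have h3 : p₀ = 0 := by
      rw [← norm_eq_zero]
      exact pow_eq_zero_iff two_ne_zero |>.1 (le_antisymm h2 (by positivity))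
    exact ⟨φ, h3 ▸ hp₀⟩
  simpa using hlim.const_sub x

end DirectionalMultipliers

section TwoRegularity

variable {m l : ℕ} {q : Em m → Em l} {y v : Em m}

theorem exists_fderiv_expansion (hq : ContDiff ℝ 2 q) (y v : Em m) {η : ℝ} (hη : 0 < η) :
    ∃ ε > (0 : ℝ), ∃ τ > (0 : ℝ), ∀ t, 0 < t → t < τ → ∀ x, ‖x - y - t • v‖ ≤ ε * t →
      ‖fderiv ℝ q x - fderiv ℝ q y - t • fderiv ℝ (fderiv ℝ q) y v‖ ≤ η * t := by
  set B := fderiv ℝ (fderiv ℝ q) y with hB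
  have h1 := (hasFDerivAt_fderiv_of_contDiff_two hq y).isLittleO
  rw [Asymptotics.isLittleO_iff] at h1
  obtain ⟨δ, hδ, hball⟩ := Metric.eventually_nhds_iff_ball.1
    (h1 (show 0 < η / (2 * (‖v‖ + 1)) by positivity))
  refine ⟨min 1 (η / (2 * (‖B‖ + 1))), by positivity, δ / (‖v‖ + 1), by positivity,
    fun t ht htτ x hx => ?_⟩
  have hxy : ‖x - y‖ ≤ (‖v‖ + 1) * t := by
    have h2 : ‖x - y‖ ≤ ‖x - y - t • v‖ + ‖t • v‖ := by
      simpa using norm_add_le (x - y - t • v) (t • v)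
    rw [norm_smul, Real.norm_of_nonneg ht.le] at h2
    have := mul_le_mul_of_nonneg_right (min_le_left 1 (η / (2 * (‖B‖ + 1)))) ht.le
    linarith
  have h2 := hball x (by
    rw [mem_ball, dist_eq_norm]
    rw [lt_div_iff₀ (by positivity)] at htτ
    linarith)
  have h3 : ‖fderiv ℝ q x - fderiv ℝ q y - B (x - y)‖ ≤ η / 2 * t := by
    refine h2.trans ((mul_le_mul_of_nonneg_left hxy (by positivity)).trans_eq ?_)
    field_simp
  have h4 : ‖B (x - y - t • v)‖ ≤ η / 2 * t := by
    refine (B.le_opNorm _).trans ?_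
    have h5 := mul_le_mul_of_nonneg_right (min_le_right 1 (η / (2 * (‖B‖ + 1)))) ht.le
    calc ‖B‖ * ‖x - y - t • v‖ ≤ (‖B‖ + 1) * (η / (2 * (‖B‖ + 1)) * t) :=
          mul_le_mul (by linarith) (hx.trans h5) (norm_nonneg _) (by positivity)
      _ = η / 2 * t := by field_simp
  have e : fderiv ℝ q x - fderiv ℝ q y - t • B v =
      (fderiv ℝ q x - fderiv ℝ q y - B (x - y)) + B (x - y - t • v) := by
    rw [map_sub B (x - y), map_smul]
    abel
  rw [e]
  exact (norm_add_le _ _).trans (by linarith)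

theorem TwoRegular.exists_lower_bound (hq : ContDiff ℝ 2 q) {J : Set (Fin l)}
    (h : TwoRegular q y v J) :
    ∃ c > (0 : ℝ), ∃ ε > (0 : ℝ), ∃ τ > (0 : ℝ), ∀ t, 0 < t → t < τ → ∀ x,
      ‖x - y - t • v‖ ≤ ε * t → ∀ μ : Em l, (∀ i ∉ J, μ i = 0) →
      c * t * ‖μ‖ ≤ ‖gradT q x μ‖ := by
  classical
  choose u w huw hw using fun j : Fin l => h (Pi.single j 1)
  set M := ∑ j, (‖u j‖ + ‖w j‖) + 1 with hM
  have hM0 : 0 < M := by positivity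
  set B := fderiv ℝ (fderiv ℝ q) y with hB
  obtain ⟨ε, hε, τ, hτ, hexp⟩ := exists_fderiv_expansion hq y v
    (show 0 < 1 / (4 * M) by positivity)
  refine ⟨1 / (4 * M), by positivity, ε, hε,
    min τ (min 1 (1 / (4 * M) / (1 / (4 * M) + ‖B v‖))), by positivity, fun t ht htτ x hx μ hμ => ?_⟩
  have ht1 : t < τ := htτ.trans_le (min_le_left _ _)
  have ht2 : t < 1 := htτ.trans_le ((min_le_right _ _).trans (min_le_left _ _))
  have ht3 : t < 1 / (4 * M) / (1 / (4 * M) + ‖B v‖) :=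
    htτ.trans_le ((min_le_right _ _).trans (min_le_right _ _))
  have hE1 := hexp t ht ht1 x hx
  set D := fderiv ℝ q x with hD
  set A := fderiv ℝ q y with hA
  have hE2 : ‖D - A‖ ≤ 1 / (4 * M) := by
    have h1 : ‖D - A‖ ≤ ‖D - A - t • B v‖ + ‖t • B v‖ := by
      simpa using norm_add_le (D - A - t • B v) (t • B v)
    rw [norm_smul, Real.norm_of_nonneg ht.le] at h1
    rw [lt_div_iff₀ (by positivity)] at ht3
    linarith
  set U : Em m := ∑ j, μ j • u j with hU
  set W : Em m := ∑ j, μ j • w j with hW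
  have hbound : ‖U‖ ≤ M * ‖μ‖ ∧ ‖W‖ ≤ M * ‖μ‖ := by
    have hμj : ∀ j, |μ j| ≤ ‖μ‖ := fun j => by simpa using PiLp.norm_apply_le μ j
    have hsum : ∀ a : Fin l → Em m, (∀ j, ‖a j‖ ≤ ‖u j‖ + ‖w j‖) →
        ‖∑ j, μ j • a j‖ ≤ M * ‖μ‖ := by
      intro a ha
      calc ‖∑ j, μ j • a j‖ ≤ ∑ j, (‖u j‖ + ‖w j‖) * ‖μ‖ := by
            refine norm_sum_le_of_le _ fun j _ => ?_
            rw [norm_smul, mul_comm]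
            exact mul_le_mul (ha j) (hμj j) (norm_nonneg _) (by positivity)
        _ ≤ M * ‖μ‖ := by
            rw [← Finset.sum_mul]
            exact mul_le_mul_of_nonneg_right (by linarith) (norm_nonneg _)
    exact ⟨hsum u fun j => le_add_of_nonneg_right (norm_nonneg _),
      hsum w fun j => le_add_of_nonneg_left (norm_nonneg _)⟩
  have hUW : ∀ i ∈ J, (A U) i + (B v W) i = μ i := by
    intro i hi
    have h1 : ∀ j, (A (u j)) i + (B v (w j)) i = Pi.single (M := fun _ => ℝ) j 1 i :=
      fun j => huw j i hi
    calc (A U) i + (B v W) i = ∑ j, μ j * ((A (u j)) i + (B v (w j)) i) := by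
          simp [hU, hW, map_sum, mul_add, Finset.sum_add_distrib]
      _ = μ i := by simp [h1, Pi.single_apply]
  have hAW : ∀ i ∈ J, (A W) i = 0 := by
    intro i hi
    have h1 : ∀ j, (A (w j)) i = 0 := fun j => hw j i hi
    simp [hW, map_sum, h1]
  have hid : ⟪gradT q x μ, t • U + W⟫ =
      t * ‖μ‖ ^ 2 + t * ⟪μ, (D - A) U⟫ + ⟪μ, (D - A - t • B v) W⟫ := by
    rw [gradT, ContinuousLinearMap.adjoint_inner_left]
    have h1 : ⟪μ, t • A U + (A W + t • B v W)⟫ = t * ‖μ‖ ^ 2 := by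
      rw [← real_inner_self_eq_norm_sq, ← real_inner_smul_right, PiLp.inner_apply,
        PiLp.inner_apply]
      refine Finset.sum_congr rfl fun i _ => ?_
      by_cases hi : i ∈ J
      · have := hUW i hi
        simp only [PiLp.add_apply, PiLp.smul_apply, smul_eq_mul, hAW i hi, zero_add]
        rw [← mul_add, this]
      · simp [hμ i hi]
    have h2 : D (t • U + W) = (t • A U + (A W + t • B v W)) + t • (D - A) U +
        (D - A - t • B v) W := by
      simp only [map_add, map_smul, sub_apply, smul_apply, smul_sub]
      abel
    rw [← hD, h2, inner_add_right, inner_add_right, h1, real_inner_smul_right]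
  have h1 : ⟪gradT q x μ, t • U + W⟫ ≤ ‖gradT q x μ‖ * (2 * M * ‖μ‖) := by
    refine (real_inner_le_norm _ _).trans (mul_le_mul_of_nonneg_left ?_ (norm_nonneg _))
    refine (norm_add_le _ _).trans ?_
    rw [norm_smul, Real.norm_of_nonneg ht.le]
    have := mul_le_mul ht2.le hbound.1 (norm_nonneg _) zero_le_one
    linarith [hbound.2]
  have h2 : -⟪μ, (D - A) U⟫ ≤ ‖μ‖ ^ 2 / 4 := by
    refine (neg_le_abs _).trans ((abs_real_inner_le_norm _ _).trans ?_)
    calc ‖μ‖ * ‖(D - A) U‖ ≤ ‖μ‖ * (1 / (4 * M) * (M * ‖μ‖)) :=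
          mul_le_mul_of_nonneg_left (((D - A).le_opNorm U).trans
            (mul_le_mul hE2 hbound.1 (norm_nonneg _) (by positivity))) (norm_nonneg _)
      _ = ‖μ‖ ^ 2 / 4 := by field_simp
  have h3 : -⟪μ, (D - A - t • B v) W⟫ ≤ t * (‖μ‖ ^ 2 / 4) := by
    refine (neg_le_abs _).trans ((abs_real_inner_le_norm _ _).trans ?_)
    calc ‖μ‖ * ‖(D - A - t • B v) W‖ ≤ ‖μ‖ * (1 / (4 * M) * t * (M * ‖μ‖)) :=
          mul_le_mul_of_nonneg_left (((D - A - t • B v).le_opNorm W).trans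
            (mul_le_mul hE1 hbound.2 (norm_nonneg _) (by positivity))) (norm_nonneg _)
      _ = t * (‖μ‖ ^ 2 / 4) := by field_simp
  have h4 : t * ‖μ‖ ^ 2 / 2 ≤ ‖gradT q x μ‖ * (2 * M * ‖μ‖) := by
    have := mul_le_mul_of_nonneg_left h2 ht.le
    linarith
  rcases (norm_nonneg μ).eq_or_lt with h0 | h0
  · rw [← h0, mul_zero]
    positivity
  · have h5 : t * ‖μ‖ / 2 ≤ ‖gradT q x μ‖ * (2 * M) := by
      refine le_of_mul_le_mul_right ?_ h0
      linarith
    rw [mul_assoc, one_div, inv_mul_le_iff₀ (by positivity)]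
    linarith

end TwoRegularity

section BaseNormals

variable {m l : ℕ} {q : Em m → Em l} {y x v : Em m} {lam : Em l}

theorem exists_subseq_const_tendsto {X E : Type*} [Finite X] [PseudoMetricSpace E] [ProperSpace E]
    (f : ℕ → X) {g : ℕ → E} {s : Set E} (hs : Bornology.IsBounded s) (hg : ∀ k, g k ∈ s) :
    ∃ φ : ℕ → ℕ, StrictMono φ ∧ ∃ a b, (∀ k, f (φ k) = a) ∧ Tendsto (g ∘ φ) atTop (𝓝 b) := by
  obtain ⟨a, ha⟩ : ∃ a, ∃ᶠ k in atTop, f k = a := by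
    by_contra! h
    have h1 : ∀ᶠ k in atTop, ∀ a, f k ≠ a := eventually_all.2 fun a => by
      simpa [Filter.not_frequently] using h a
    obtain ⟨k, hk⟩ := h1.exists
    exact hk _ rfl
  obtain ⟨φ, hφ, hfa⟩ := extraction_of_frequently_atTop ha
  obtain ⟨b, -, ψ, hψ, hb⟩ := tendsto_subseq_of_bounded hs (x := g ∘ φ) fun k => hg _
  exact ⟨φ ∘ ψ, hφ.comp hψ, a, b, fun k => hfa _, hb⟩

theorem gradT_mem_tanCone_GphNhat (hq : ContDiff ℝ 2 q) (hy : y ∈ Gam q) (hl : lam ∈ NRl q y)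
    {σ : Em l} (hσ : σ ∈ Pset (Iplus lam) (actI q y)) :
    ((0 : Em m), gradT q y σ) ∈ tanCone (GphNhat q) (y, gradT q y lam) := by
  obtain ⟨ε, hε, hmem⟩ := exists_add_smul_mem_NRl hl hσ
  refine ⟨fun k => ε * ((k : ℝ) + 1)⁻¹, fun _ => (0, gradT q y σ), fun k => by positivity,
    tendsto_nhds_of_eq (tendsto_inv_natCast_add_one.const_mul ε) (mul_zero ε),
    tendsto_const_nhds, fun k => ?_⟩
  set s : ℝ := ((k : ℝ) + 1)⁻¹ with hs
  have hs0 : 0 ≤ s := by positivity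
  have hs1 : s ≤ 1 := inv_le_one_of_one_le₀ (by linarith [Nat.cast_nonneg (α := ℝ) k])
  have hN : lam + (ε * s) • σ ∈ NRl q y := by
    refine ⟨fun i => ?_, fun i hi => ?_⟩
    · have h1 := hl.1 i
      have h2 := hmem.1 i
      simp only [PiLp.add_apply, PiLp.smul_apply, smul_eq_mul] at h2 ⊢
      nlinarith
    · have h1 := hl.2 i hi
      have h2 := hσ.1 i hi
      simp [h1, h2]
  have e : (y, gradT q y lam) + (ε * s) • ((0 : Em m), gradT q y σ) =
      (y, gradT q y (lam + (ε * s) • σ)) := by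
    rw [gradT_add, gradT_smul]
    simp
  rw [e]
  exact ⟨hy, gradT_mem_regNormalCone hq hN⟩

theorem mem_Kcone_of_mem_regNormalConeP (hq : ContDiff ℝ 2 q) (hy : y ∈ Gam q)
    (hl : lam ∈ NRl q y) {p : Em m × Em m}
    (hp : p ∈ regNormalConeP (GphNhat q) (y, gradT q y lam)) :
    p.2 ∈ Kcone q y (Iplus lam) (actI q y) := by
  have key : ∀ (i : Fin l) (c : ℝ), EuclideanSpace.single i c ∈ Pset (Iplus lam) (actI q y) →
      c * gradQ q y i p.2 ≤ 0 := by
    intro i c h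
    have h1 := hp _ (gradT_mem_tanCone_GphNhat hq hy hl h)
    rw [inner_zero_right, zero_add, real_inner_comm, inner_gradT] at h1
    rw [Finset.sum_eq_single i (fun j _ hj => by simp [hj]) (by simp)] at h1
    simpa using h1
  have hI := Iplus_subset_actI hl
  refine ⟨fun i hi => le_antisymm ?_ ?_, fun i hi => ?_⟩
  · simpa using key i 1 ⟨fun j hj => by
      simp [show j ≠ i from fun h => hj (h ▸ hI hi)], fun j hj => by
      simp [show j ≠ i from fun h => hj.2 (h ▸ hi)]⟩
  · simpa using key i (-1) ⟨fun j hj => by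
      simp [show j ≠ i from fun h => hj (h ▸ hI hi)], fun j hj => by
      simp [show j ≠ i from fun h => hj.2 (h ▸ hi)]⟩
  · simpa using key i 1 ⟨fun j hj => by
      simp [show j ≠ i from fun h => hj (h ▸ hi.1)], fun j hj => by
      by_cases h : j = i <;> simp [h]⟩

theorem inner_nonpos_of_mem_regNormalConeP (hq : ContDiff ℝ 2 q) {C : ℝ} (hs : SubregAt q y C)
    (hy : y ∈ Gam q) (hl : lam ∈ NRl q y) {p : Em m × Em m}
    (hp : p ∈ regNormalConeP (GphNhat q) (y, gradT q y lam)) {h z : Em m}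
    (h1 : ∀ i ∈ actI q y, gradQ q y i h ≤ 0) (h1' : ∀ i, lam i * gradQ q y i h = 0)
    (h2 : ∀ i ∈ actI q y, gradQ q y i z + hessQ q y i h h ≤ 0)
    (h2' : ∀ i, lam i * (gradQ q y i z + hessQ q y i h h) = 0) :
    ⟪p.1 + hessT q y lam p.2, h⟫ ≤ 0 := by
  have h3 := hp _ (mem_tanCone_GphNhat hq hs hy hl h1 h1' h2 h2')
  rw [inner_add_left, inner_hessT_symm hq, real_inner_comm p.2]
  exact h3

theorem inner_eq_zero_of_mem_regNormalConeP (hq : ContDiff ℝ 2 q) {C : ℝ} (hs : SubregAt q y C)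
    (hy : y ∈ Gam q) {p : Em m × Em m} (hp : p ∈ regNormalConeP (GphNhat q) (y, x))
    (hv : v ∈ Nspace q y) (hl : lam ∈ LamDir q y x v) :
    ⟪p.1 + hessT q y lam p.2, v⟫ = 0 := by
  obtain ⟨z, hz, hzP⟩ := exists_Xibar_of_mem_LamDir hl
  have hlN := hl.1.1
  have hp' : p ∈ regNormalConeP (GphNhat q) (y, gradT q y lam) := by rwa [hl.1.2]
  have h1' : ∀ i, lam i * gradQ q y i v = 0 := fun i => by
    by_cases hi : i ∈ actI q y
    · rw [hv i hi, mul_zero]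
    · rw [hlN.2 i hi, zero_mul]
  have h2' : ∀ i, lam i * (gradQ q y i z + hessQ q y i v v) = 0 := fun i => by
    rcases (hlN.1 i).eq_or_lt with h | h
    · rw [← h, zero_mul]
    · rw [hzP i h, mul_zero]
  refine le_antisymm (inner_nonpos_of_mem_regNormalConeP hq hs hy hlN hp'
    (fun i hi => (hv i hi).le) h1' hz h2') ?_
  have h3 := inner_nonpos_of_mem_regNormalConeP hq hs hy hlN hp' (h := -v) (z := z)
    (fun i hi => by rw [gradQ_neg, hv i hi, neg_zero])
    (fun i => by rw [gradQ_neg, mul_neg, h1' i, neg_zero])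
    (fun i hi => by rw [hessQ_neg_neg]; exact hz i hi)
    (fun i => by rw [hessQ_neg_neg]; exact h2' i)
  rw [inner_neg_right] at h3
  linarith

theorem exists_Lam_le (q : Em m → Em l) (y : Em m) : ∃ C : ℝ, 0 ≤ C ∧ ∀ x, ∀ μ ∈ Lam q y x,
    ∃ lam ∈ Lam q y x, (∀ i, μ i = 0 → lam i = 0) ∧ ∀ i, lam i ≤ C * ‖x‖ := by
  obtain ⟨C, hC, h⟩ := exists_bounded_nonneg_comb
    fun i : Fin l => gradT q y (EuclideanSpace.single i 1)
  refine ⟨C, hC, fun x μ hμ => ?_⟩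
  obtain ⟨c, hc0, hcs, hce, hcb⟩ := h (fun i => μ i) hμ.1.1
  have e : gradT q y (WithLp.toLp 2 c) = x := by
    rw [← hμ.2, gradT_eq_sum q y (WithLp.toLp 2 c), gradT_eq_sum q y μ]
    exact hce
  refine ⟨WithLp.toLp 2 c, ⟨⟨hc0, fun i hi => hcs i (hμ.1.2 i hi)⟩, e⟩, hcs, fun i => ?_⟩
  have h1 := hcb i
  rw [← gradT_eq_sum q y μ, hμ.2] at h1
  exact h1

theorem mem_LamDir_of_frequently {vk : ℕ → Em m}
    (hv : Tendsto vk atTop (𝓝 v)) (h : ∃ᶠ k in atTop, lam ∈ LamDir q y x (vk k)) :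
    lam ∈ LamDir q y x v := by
  obtain ⟨φ, hφ, hk⟩ := extraction_of_frequently_atTop h
  have hcont : ∀ a : Em l, Continuous fun w => ∑ i, a i * hessQ q y i w w := fun a =>
    continuous_finsetSum _ fun i _ => (continuous_hessQ_diag q y i).const_mul _
  exact ⟨(hk 0).1, fun a ha => le_of_tendsto_of_tendsto'
    (((hcont a).tendsto v).comp (hv.comp hφ.tendsto_atTop))
    (((hcont lam).tendsto v).comp (hv.comp hφ.tendsto_atTop)) fun k => (hk k).2 a ha⟩

theorem exists_LamDir_inner_nonpos (hq : ContDiff ℝ 2 q) {C : ℝ} (hC0 : 0 ≤ C)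
    (hs : SubregAt q y C) (hy : y ∈ Gam q) {C' : ℝ}
    (hC' : ∀ μ ∈ Lam q y x, ∃ lam ∈ Lam q y x, (∀ i, μ i = 0 → lam i = 0) ∧ ∀ i, lam i ≤ C' * ‖x‖)
    (hx : x ∈ regNormalCone (Gam q) y) {p : Em m × Em m}
    (hp : p ∈ regNormalConeP (GphNhat q) (y, x)) (hv : v ∈ Nspace q y) {r : Em m}
    (hr : ∀ i ∈ actI q y, gradQ q y i r ≤ 0) (hxr : ⟪x, r⟫ = 0) :
    ∃ lam ∈ LamDir q y x v, (∀ i, lam i ≤ C' * ‖x‖) ∧ ⟪p.1 + hessT q y lam p.2, r⟫ ≤ 0 := by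
  set s : ℕ → ℝ := fun n => ((n : ℝ) + 1)⁻¹ with hsdef
  have hs0 : ∀ n, 0 < s n := fun n => by positivity
  set vk : ℕ → Em m := fun n => v + s n • r with hvk
  have hvlim : Tendsto vk atTop (𝓝 v) :=
    tendsto_add_smul v tendsto_inv_natCast_add_one tendsto_const_nhds
  have hgrad : ∀ n, ∀ i ∈ actI q y, gradQ q y i (vk n) = s n * gradQ q y i r := fun n i hi => by
    rw [hvk, gradQ_add q y, gradQ_smul q y, hv i hi, zero_add]
  have hlin : ∀ n, ∀ i ∈ actI q y, gradQ q y i (vk n) ≤ 0 := fun n i hi => by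
    rw [hgrad n i hi]
    exact mul_nonpos_of_nonneg_of_nonpos (hs0 n).le (hr i hi)
  have hex : ∀ n, ∃ μ ∈ Lam q y x, (∀ i, μ i ≤ C' * ‖x‖) ∧ ∃ z ∈ Xibar q y (vk n),
      ∀ i, μ i * (gradQ q y i z + hessQ q y i (vk n) (vk n)) = 0 := by
    intro n
    obtain ⟨μ₀, hμ₀, -⟩ := exists_bounded_multiplier hq hC0 hs hy hx
    obtain ⟨z₀, hz₀⟩ := Xibar_nonempty_of_mem_Tlin hq hs hy (v := vk n) (hlin n)
    obtain ⟨μ, hμ, hμx, z, -, hz, hcomp⟩ := exists_gradQ_complementary (q := q) (y := y)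
      (empty_subset (actI q y)) (c := fun i => hessQ q y i (vk n) (vk n)) (x := x)
      ⟨μ₀, ⟨hμ₀.1.2, fun i _ => hμ₀.1.1 i⟩, hμ₀.2⟩
      ⟨z₀, fun i hi => absurd hi (notMem_empty i), fun i hi => hz₀ i hi.1⟩
    obtain ⟨a, ha, has, hab⟩ := hC' μ ⟨⟨fun i => by
      by_cases hi : i ∈ actI q y
      · exact hμ.2 i ⟨hi, notMem_empty i⟩
      · exact (hμ.1 i hi).ge, hμ.1⟩, hμx⟩
    refine ⟨a, ha, hab, z, fun i hi => hz i ⟨hi, notMem_empty i⟩, fun i => ?_⟩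
    rcases hcomp i with h | h
    · rw [has i h, zero_mul]
    · rw [h, mul_zero]
  choose μ hμ hμb z hz hcomp using hex
  obtain ⟨φ, hφ, S, -, hS, -⟩ := exists_subseq_const_tendsto (fun n => {i | μ n i ≠ 0})
    (g := fun _ => (0 : ℝ)) (Bornology.isBounded_singleton (x := (0 : ℝ))) fun _ => rfl
  have hdir : ∀ k, μ (φ 0) ∈ LamDir q y x (vk (φ k)) := fun k =>
    mem_LamDir_of_complementary (hμ _) (hz (φ k)) fun i => by
      by_cases hi : μ (φ k) i = 0
      · have : i ∉ {i | μ (φ 0) i ≠ 0} := by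
          rw [hS 0, ← hS k]
          simpa using hi
        rw [not_not.1 this, zero_mul]
      · rw [(mul_eq_zero.1 (hcomp (φ k) i)).resolve_left hi, mul_zero]
  have hmem : μ (φ 0) ∈ LamDir q y x v :=
    mem_LamDir_of_frequently (hvlim.comp hφ.tendsto_atTop) (Frequently.of_forall hdir)
  refine ⟨_, hmem, hμb _, ?_⟩
  have h0 := inner_eq_zero_of_mem_regNormalConeP hq hs hy hp hv hmem
  have hp' : p ∈ regNormalConeP (GphNhat q) (y, gradT q y (μ (φ 0))) := by rwa [(hμ _).2]
  have hzero : ∀ i, μ (φ 0) i * gradQ q y i r = 0 := by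
    have h1 : ∑ i, μ (φ 0) i * gradQ q y i r = 0 := by rw [← inner_gradT, (hμ _).2, hxr]
    have h2 : ∀ i ∈ Finset.univ, μ (φ 0) i * gradQ q y i r ≤ 0 := fun i _ => by
      by_cases hi : i ∈ actI q y
      · exact mul_nonpos_of_nonneg_of_nonpos ((hμ _).1.1 i) (hr i hi)
      · rw [(hμ _).1.2 i hi, zero_mul]
    exact fun i => (Finset.sum_eq_zero_iff_of_nonpos h2).1 h1 i (Finset.mem_univ i)
  have h1 := inner_nonpos_of_mem_regNormalConeP hq hs hy (hμ _).1 hp' (hlin (φ 0)) (fun i => by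
    by_cases hi : i ∈ actI q y
    · rw [hgrad _ i hi, mul_left_comm, hzero, mul_zero]
    · rw [(hμ _).1.2 i hi, zero_mul]) (hz (φ 0)) (hcomp _)
  rw [hvk, inner_add_right, h0, zero_add, real_inner_smul_right] at h1
  exact nonpos_of_mul_nonpos_right h1 (hs0 _)

theorem isClosed_Lam (q : Em m → Em l) (y x : Em m) : IsClosed (Lam q y x) := by
  have hp : ∀ i, Continuous fun a : Em l => a i := fun i => by fun_prop
  have e : Lam q y x = {a | ∀ i, 0 ≤ a i} ∩ {a | ∀ i, q y i ≠ 0 → a i = 0} ∩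
      {a | gradT q y a = x} := by
    ext a
    simp [Lam, NRl]
  rw [e]
  refine (IsClosed.inter ?_ ?_).inter ?_
  · simp only [Set.ofPred_forall]
    exact isClosed_iInter fun i => isClosed_le continuous_const (hp i)
  · simp only [Set.ofPred_forall]
    exact isClosed_iInter fun i => isClosed_iInter fun _ => isClosed_eq (hp i) continuous_const
  · exact isClosed_eq (ContinuousLinearMap.continuous _) continuous_const

theorem isClosed_LamDir (q : Em m → Em l) (y x v : Em m) : IsClosed (LamDir q y x v) := by
  have hp : ∀ i, Continuous fun a : Em l => a i := fun i => by fun_prop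
  have e : LamDir q y x v = Lam q y x ∩ ⋂ b ∈ Lam q y x,
      {a | ∑ i, b i * hessQ q y i v v ≤ ∑ i, a i * hessQ q y i v v} := by
    ext a
    simp [LamDir]
  rw [e]
  exact (isClosed_Lam q y x).inter <| isClosed_iInter fun b => isClosed_iInter fun _ =>
    isClosed_le continuous_const (continuous_finsetSum _ fun i _ => (hp i).mul_const _)

theorem convex_LamDir (q : Em m → Em l) (y x v : Em m) : Convex ℝ (LamDir q y x v) := by
  intro a ha b hb s t hs ht hst
  refine ⟨⟨⟨fun i => ?_, fun i hi => ?_⟩, ?_⟩, fun c hc => ?_⟩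
  · have h1 := ha.1.1.1 i
    have h2 := hb.1.1.1 i
    simp only [PiLp.add_apply, PiLp.smul_apply, smul_eq_mul]
    positivity
  · simp [ha.1.1.2 i hi, hb.1.1.2 i hi]
  · rw [gradT_add, gradT_smul, gradT_smul, ha.1.2, hb.1.2, ← add_smul, hst, one_smul]
  · have h1 := mul_le_mul_of_nonneg_left (ha.2 c hc) hs
    have h2 := mul_le_mul_of_nonneg_left (hb.2 c hc) ht
    have e : ∑ i, (s • a + t • b) i * hessQ q y i v v =
        s * ∑ i, a i * hessQ q y i v v + t * ∑ i, b i * hessQ q y i v v := by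
      rw [Finset.mul_sum, Finset.mul_sum, ← Finset.sum_add_distrib]
      refine Finset.sum_congr rfl fun i _ => ?_
      simp only [PiLp.add_apply, PiLp.smul_apply, smul_eq_mul]
      ring
    rw [e]
    calc _ = (s + t) * ∑ i, c i * hessQ q y i v v := by rw [hst, one_mul]
      _ ≤ _ := by linarith

theorem isCompact_LamDir_le (q : Em m → Em l) (y x v : Em m) (c : ℝ) :
    IsCompact {a | a ∈ LamDir q y x v ∧ ∀ i, a i ≤ c} := by
  have hp : ∀ i, Continuous fun a : Em l => a i := fun i => by fun_prop
  refine Metric.isCompact_of_isClosed_isBounded ?_ ?_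
  · simp only [Set.ofPred_and, Set.ofPred_forall]
    exact (isClosed_LamDir q y x v).inter
      (isClosed_iInter fun i => isClosed_le (hp i) continuous_const)
  · rw [isBounded_iff_forall_norm_le]
    refine ⟨∑ _i : Fin l, |c|, fun a ha => ?_⟩
    calc ‖a‖ = ‖∑ i, EuclideanSpace.single i (a i)‖ := by
          congr 1
          ext j
          simp
      _ ≤ ∑ i, ‖EuclideanSpace.single i (a i)‖ := norm_sum_le _ _
      _ ≤ _ := Finset.sum_le_sum fun i _ => by
          rw [PiLp.norm_single, Real.norm_eq_abs, abs_of_nonneg (ha.1.1.1.1 i)]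
          exact (ha.2 i).trans (le_abs_self c)

theorem isClosed_polarCone {H : Type*} [NormedAddCommGroup H] [InnerProductSpace ℝ H] (K : Set H) :
    IsClosed (polarCone K) := by
  simp only [polarCone, Set.ofPred_forall]
  exact isClosed_iInter fun y => isClosed_iInter fun _ =>
    isClosed_le (continuous_id.inner continuous_const) continuous_const

theorem convex_polarCone {H : Type*} [NormedAddCommGroup H] [InnerProductSpace ℝ H] (K : Set H) :
    Convex ℝ (polarCone K) := by
  intro a ha b hb s t hs ht _ d hd
  rw [inner_add_left, real_inner_smul_left, real_inner_smul_left]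
  have h1 := mul_nonpos_of_nonneg_of_nonpos hs (ha d hd)
  have h2 := mul_nonpos_of_nonneg_of_nonpos ht (hb d hd)
  linarith

theorem smul_mem_polarCone {H : Type*} [NormedAddCommGroup H] [InnerProductSpace ℝ H] {K : Set H}
    {a : H} (ha : a ∈ polarCone K) {s : ℝ} (hs : 0 ≤ s) : s • a ∈ polarCone K := fun d hd => by
  rw [real_inner_smul_left]
  exact mul_nonpos_of_nonneg_of_nonpos hs (ha d hd)

theorem exists_LamDir_mem_polarCone (hq : ContDiff ℝ 2 q) {C : ℝ} (hC0 : 0 ≤ C)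
    (hs : SubregAt q y C) (hy : y ∈ Gam q) {C' : ℝ}
    (hC' : ∀ μ ∈ Lam q y x, ∃ lam ∈ Lam q y x, (∀ i, μ i = 0 → lam i = 0) ∧ ∀ i, lam i ≤ C' * ‖x‖)
    (hx : x ∈ regNormalCone (Gam q) y) {p : Em m × Em m}
    (hp : p ∈ regNormalConeP (GphNhat q) (y, x)) (hv : v ∈ Nspace q y) :
    ∃ lam ∈ LamDir q y x v, (∀ i, lam i ≤ C' * ‖x‖) ∧
      p.1 + hessT q y lam p.2 ∈
        polarCone {r | (∀ i ∈ actI q y, gradQ q y i r ≤ 0) ∧ ⟪x, r⟫ = 0} := by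
  set K : Set (Em m) := {r | (∀ i ∈ actI q y, gradQ q y i r ≤ 0) ∧ ⟪x, r⟫ = 0} with hK
  set B : Set (Em l) := {a | a ∈ LamDir q y x v ∧ ∀ i, a i ≤ C' * ‖x‖} with hB
  set F : Em l → Em m := fun a => p.1 + hessT q y a p.2 with hF
  by_contra! hcon
  have hBconv : Convex ℝ B := by
    intro a ha b hb s t hs ht hst
    refine ⟨convex_LamDir q y x v ha.1 hb.1 hs ht hst, fun i => ?_⟩
    have h1 := mul_le_mul_of_nonneg_left (ha.2 i) hs
    have h2 := mul_le_mul_of_nonneg_left (hb.2 i) ht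
    simp only [PiLp.add_apply, PiLp.smul_apply, smul_eq_mul]
    calc _ ≤ (s + t) * (C' * ‖x‖) := by linarith
      _ = _ := by rw [hst, one_mul]
  have hSconv : Convex ℝ (F '' B) := by
    rintro _ ⟨a, ha, rfl⟩ _ ⟨b, hb, rfl⟩ s t hs ht hst
    refine ⟨s • a + t • b, hBconv ha hb hs ht hst, ?_⟩
    simp only [hF, hessT_add_left, hessT_smul_left, smul_add]
    nth_rewrite 1 [← one_smul ℝ p.1]
    rw [← hst, add_smul]
    abel
  have hFc : Continuous F := continuous_const.add (ContinuousLinearMap.continuous _)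
  have hScomp : IsCompact (F '' B) := (isCompact_LamDir_le q y x v _).image hFc
  obtain ⟨f, u, u', h1, h2, h3⟩ := geometric_hahn_banach_compact_closed hSconv hScomp
    (convex_polarCone K) (isClosed_polarCone K) (by
      rw [Set.disjoint_left]
      rintro _ ⟨a, ha, rfl⟩ h
      exact hcon a ha.1 ha.2 h)
  have hu' : u' < 0 := by
    have := h3 0 fun d _ => by rw [inner_zero_left]
    rwa [map_zero] at this
  have hf0 : ∀ b ∈ polarCone K, 0 ≤ f b := by
    intro b hb
    by_contra! hneg
    have := h3 _ (smul_mem_polarCone hb (s := u' / f b) (div_nonneg_of_nonpos hu'.le hneg.le))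
    rw [map_smul, smul_eq_mul, div_mul_cancel₀ _ hneg.ne] at this
    exact lt_irrefl _ this
  set g := (InnerProductSpace.toDual ℝ (Em m)).symm f with hg
  have hfg : ∀ a, f a = ⟪g, a⟫ := fun a => by simp [hg]
  have hr : ∀ i ∈ actI q y, gradQ q y i (-g) ≤ 0 := fun i hi => by
    have := hf0 (gradT q y (EuclideanSpace.single i 1)) fun d hd => by
      rw [inner_gradT_single]
      exact hd.1 i hi
    rw [hfg, real_inner_comm, inner_gradT_single] at this
    rw [gradQ_neg]
    linarith
  have hxr : ⟪x, -g⟫ = 0 := by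
    have h4 := hf0 x fun d hd => hd.2.le
    have h5 := hf0 (-x) fun d hd => by rw [inner_neg_left, hd.2, neg_zero]
    rw [hfg, real_inner_comm] at h4 h5
    rw [inner_neg_left] at h5
    rw [inner_neg_right]
    linarith
  obtain ⟨a, ha, hab, h4⟩ := exists_LamDir_inner_nonpos hq hC0 hs hy hC' hx hp hv hr hxr
  have h5 := h1 _ ⟨a, ⟨ha, hab⟩, rfl⟩
  rw [hfg, real_inner_comm] at h5
  rw [inner_neg_right] at h4
  linarith

theorem polarCone_anti {H : Type*} [NormedAddCommGroup H] [InnerProductSpace ℝ H] {K L : Set H}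
    (h : K ⊆ L) : polarCone L ⊆ polarCone K := fun _ ha d hd => ha d (h hd)

theorem gradT_mem_polarCone {P I : Set (Fin l)} {μ : Em l} (hμ : μ ∈ Pset P I) :
    gradT q y μ ∈ polarCone (Kcone q y P I) := fun d hd => by
  rw [inner_gradT]
  exact Pset_sum_nonpos hμ hd.1 hd.2

theorem exists_LamDir_mem_KconeDir (hq : ContDiff ℝ 2 q) {C : ℝ} (hC0 : 0 ≤ C)
    (hs : SubregAt q y C) (hy : y ∈ Gam q) {C' : ℝ}
    (hC' : ∀ μ ∈ Lam q y x, ∃ lam ∈ Lam q y x, (∀ i, μ i = 0 → lam i = 0) ∧ ∀ i, lam i ≤ C' * ‖x‖)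
    (hx : x ∈ regNormalCone (Gam q) y) {p : Em m × Em m}
    (hp : p ∈ regNormalConeP (GphNhat q) (y, x)) (hv : v ∈ Nspace q y) :
    ∃ lam ∈ Lam q y x, (∀ i, lam i ≤ C' * ‖x‖) ∧ ∃ J ∈ Jbar q y v, Iplus lam ⊆ J ∧
      p.2 ∈ KconeDir q y (Iplus lam) J v ∧
      p.1 + hessT q y lam p.2 ∈ polarCone (KconeDir q y (Iplus lam) J v) := by
  obtain ⟨lam, hl, hlb, hpol⟩ := exists_LamDir_mem_polarCone hq hC0 hs hy hC' hx hp hv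
  have hPI := Iplus_subset_actI hl.1.1
  have hsub : Kcone q y (Iplus lam) (actI q y) ⊆
      {r | (∀ i ∈ actI q y, gradQ q y i r ≤ 0) ∧ ⟪x, r⟫ = 0} := by
    intro r hr
    refine ⟨fun i hi => ?_, ?_⟩
    · by_cases h : i ∈ Iplus lam
      · exact (hr.1 i h).le
      · exact hr.2 i ⟨hi, h⟩
    · rw [← hl.1.2, inner_gradT]
      refine Finset.sum_eq_zero fun i _ => ?_
      rcases (hl.1.1.1 i).eq_or_lt with h | h
      · rw [← h, zero_mul]
      · rw [hr.1 i h, mul_zero]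
  obtain ⟨z₀, hz₀, hz₀'⟩ := exists_Xibar_of_mem_LamDir hl
  obtain ⟨μ, hμ, hμx, z, hz1, hz2, hcomp⟩ := exists_gradQ_complementary hPI
    (exists_Pset_gradT_eq hPI fun d hd => hpol d (hsub hd))
    ⟨z₀, hz₀', fun i hi => hz₀ i hi.1⟩
  have hz : z ∈ Xibar q y v := fun i hi => by
    by_cases h : i ∈ Iplus lam
    · exact (hz1 i h).le
    · exact hz2 i ⟨hi, h⟩
  have hPJ : Iplus lam ⊆ Jset q y v z := fun i hi => ⟨⟨hPI hi, hv i (hPI hi)⟩, hz1 i hi⟩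
  have hJI : Jset q y v z ⊆ actI q y := fun i hi => hi.1.1
  have hμJ : μ ∈ Pset (Iplus lam) (Jset q y v z) := by
    refine ⟨fun i hi => ?_, fun i hi => hμ.2 i ⟨hJI hi.1, hi.2⟩⟩
    by_cases h : i ∈ actI q y
    · exact (hcomp i).resolve_right fun h0 => hi ⟨⟨h, hv i h⟩, h0⟩
    · exact hμ.1 i h
  have hp' : p ∈ regNormalConeP (GphNhat q) (y, gradT q y lam) := by rwa [hl.1.2]
  have hw := mem_Kcone_of_mem_regNormalConeP hq hy hl.1.1 hp'
  have hinner : ∀ σ ∈ Pset (Iplus lam) (Jset q y v z), gradT q y σ = 0 →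
      ∑ i, σ i * hessQ q y i v p.2 ≤ 0 := by
    intro σ hσ h0
    obtain ⟨ε, hε, hmem⟩ := exists_add_smul_mem_NRl hl.1.1 (σ := σ) ⟨fun i hi =>
      hσ.1 i fun h => hi (hJI h), fun i hi => by
        by_cases h : i ∈ Jset q y v z
        · exact hσ.2 i ⟨h, hi.2⟩
        · exact (hσ.1 i h).ge⟩
    have hdir : lam + ε • σ ∈ LamDir q y x v := by
      refine mem_LamDir_of_complementary
        ⟨hmem, by rw [gradT_add, gradT_smul, h0, smul_zero, add_zero, hl.1.2]⟩ hz fun i => ?_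
      by_cases h : i ∈ Jset q y v z
      · rw [h.2, mul_zero]
      · have h1 : lam i = 0 := le_antisymm (not_lt.1 fun h2 => h (hPJ h2)) (hl.1.1.1 i)
        simp [h1, hσ.1 i h]
    have h1 := inner_eq_zero_of_mem_regNormalConeP hq hs hy hp hv hl
    have h2 := inner_eq_zero_of_mem_regNormalConeP hq hs hy hp hv hdir
    rw [hessT_add_left, hessT_smul_left, ← add_assoc, inner_add_left, h1, zero_add,
      real_inner_smul_left, inner_hessT_symm hq, inner_hessT] at h2
    exact ((mul_eq_zero.1 h2).resolve_left hε.ne').le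
  refine ⟨lam, hl.1, hlb, Jset q y v z, ⟨z, hz, rfl⟩, hPJ, (mem_KconeDir_iff hPJ).2
    ⟨⟨hw.1, fun i hi => hw.2 i ⟨hJI hi.1, hi.2⟩⟩, hinner⟩, ?_⟩
  rw [← hμx]
  exact polarCone_anti (fun d hd => hd.1) (gradT_mem_polarCone hμJ)

theorem zero_mem_tanCone {H : Type*} [NormedAddCommGroup H] [NormedSpace ℝ H] {Ω : Set H} {z : H}
    (hz : z ∈ Ω) : (0 : H) ∈ tanCone Ω z :=
  ⟨fun k : ℕ => ((k : ℝ) + 1)⁻¹, fun _ => 0, fun k => by positivity,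
    tendsto_inv_natCast_add_one, tendsto_const_nhds, fun k => by simpa using hz⟩

theorem mem_unionQ_of_mem_LamDir (hl : lam ∈ LamDir q y x v) {J P I : Set (Fin l)}
    (hJ : J ∈ Jbar q y v) (hP : Iplus lam ⊆ P) (hPI : P ⊆ I) (hIJ : I ⊆ J) {p : Em m × Em m}
    (hp : p ∈ Qset q y v lam P I) : p ∈ unionQ q y x v (hessT q y lam v) := by
  refine ⟨lam, 0, ⟨hl, zero_mem_tanCone hl.1.1, ?_⟩, J, hJ, P, I, ?_, hPI, hIJ, hp⟩
  · have : gradT q y (0 : Em l) = 0 := map_zero _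
    rw [this, add_zero]
  · rintro i (hi | hi)
    · exact hP hi
    · exact absurd hi.2 (lt_irrefl _)

theorem Iplus_subset_of_tendsto {lk : ℕ → Em l} {P : Set (Fin l)}
    (hlk : Tendsto lk atTop (𝓝 lam)) (hP : ∀ k, Iplus (lk k) = P) :
    Iplus lam ⊆ P := by
  intro i hi
  by_contra h
  have hc : Tendsto (fun k => lk k i) atTop (𝓝 (lam i)) :=
    ((EuclideanSpace.proj (𝕜 := ℝ) i).continuous.tendsto _).comp hlk
  have h1 : lam i ≤ 0 := le_of_tendsto' hc fun k => not_lt.1 fun h2 => h (hP k ▸ h2)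
  exact absurd hi h1.not_gt

theorem apply_nonneg_of_tendsto {lk : ℕ → Em l} (hlk : Tendsto lk atTop (𝓝 lam)) {i : Fin l}
    (h : ∀ k, 0 ≤ lk k i) : 0 ≤ lam i :=
  ge_of_tendsto' (((EuclideanSpace.proj (𝕜 := ℝ) i).continuous.tendsto _).comp hlk) h

theorem isBounded_nonneg_le (l : ℕ) (c : ℝ) :
    Bornology.IsBounded {a : Em l | ∀ i, 0 ≤ a i ∧ a i ≤ c} := by
  rw [isBounded_iff_forall_norm_le]
  refine ⟨∑ _i : Fin l, |c|, fun a ha => ?_⟩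
  calc ‖a‖ = ‖∑ i, EuclideanSpace.single i (a i)‖ := by
        congr 1
        ext j
        simp
    _ ≤ ∑ i, ‖EuclideanSpace.single i (a i)‖ := norm_sum_le _ _
    _ ≤ _ := Finset.sum_le_sum fun i _ => by
        rw [PiLp.norm_single, Real.norm_eq_abs, abs_of_nonneg (ha i).1]
        exact (ha i).2.trans (le_abs_self c)

theorem exists_norm_bound_of_tendsto {E : Type*} [NormedAddCommGroup E] {f : ℕ → E} {a : E}
    (h : Tendsto f atTop (𝓝 a)) : ∃ R : ℝ, 0 ≤ R ∧ ∀ k, ‖f k‖ ≤ R := by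
  obtain ⟨R, hR⟩ := isBounded_iff_forall_norm_le.1 (isBounded_range_of_tendsto f h)
  exact ⟨R, (norm_nonneg _).trans (hR _ (mem_range_self 0)), fun k => hR _ (mem_range_self k)⟩

theorem exists_mem_unionQ_of_base (hq : ContDiff ℝ 2 q) {C : ℝ} (hC0 : 0 ≤ C)
    (hs : SubregAt q y C) (hy : y ∈ Gam q) (hv : v ∈ Nspace q y) {xk : ℕ → Em m}
    {pk : ℕ → Em m × Em m} {p : Em m × Em m} (hx : Tendsto xk atTop (𝓝 x))
    (hp : Tendsto pk atTop (𝓝 p)) (hxk : ∀ k, xk k ∈ regNormalCone (Gam q) y)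
    (hpk : ∀ k, pk k ∈ regNormalConeP (GphNhat q) (y, xk k)) :
    ∃ vstar, (v, vstar) ∈ tanCone (GphNhat q) (y, x) ∧ p ∈ unionQ q y x v vstar := by
  obtain ⟨C', hC'0, hC'⟩ := exists_Lam_le q y
  choose lk hlk hlb J hJ hPJ hw hpol using fun k =>
    exists_LamDir_mem_KconeDir hq hC0 hs hy (hC' (xk k)) (hxk k) (hpk k) hv
  obtain ⟨R, hR0, hR⟩ := exists_norm_bound_of_tendsto hx
  obtain ⟨φ, hφ, ⟨P, J0⟩, lam, hconst, hlim⟩ := exists_subseq_const_tendsto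
    (fun k => (Iplus (lk k), J k)) (isBounded_nonneg_le l (C' * R)) (g := lk) fun k i =>
      ⟨(hlk k).1.1 i, (hlb k i).trans (mul_le_mul_of_nonneg_left (hR k) hC'0)⟩
  have hPc : ∀ k, Iplus (lk (φ k)) = P := fun k => (Prod.mk.inj (hconst k)).1
  have hJc : ∀ k, J (φ k) = J0 := fun k => (Prod.mk.inj (hconst k)).2
  have hP : Iplus lam ⊆ P := Iplus_subset_of_tendsto hlim hPc
  have hPJ0 : P ⊆ J0 := hPc 0 ▸ hJc 0 ▸ hPJ (φ 0)
  have hJ0 : J0 ∈ Jbar q y v := hJc 0 ▸ hJ (φ 0)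
  have hφt := hφ.tendsto_atTop
  have hl0 : ∀ i, 0 ≤ lam i := fun i => apply_nonneg_of_tendsto hlim fun k => (hlk (φ k)).1.1 i
  obtain ⟨z, hz, hJz⟩ := hJ0
  have hJI : J0 ⊆ actI q y := by
    rw [hJz]
    exact fun i hi => hi.1.1
  have hlzero : ∀ i ∉ J0, lam i = 0 := fun i hi =>
    le_antisymm (not_lt.1 fun h => hi (hPJ0 (hP h))) (hl0 i)
  have hgrad : gradT q y lam = x := tendsto_nhds_unique
    (tendsto_gradT hq (tendsto_const_nhds (x := y)) hlim)
    ((hx.comp hφt).congr fun k => (hlk (φ k)).2.symm)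
  have hLam : lam ∈ Lam q y x := ⟨⟨hl0, fun i hi => hlzero i fun h => hi (hJI h)⟩, hgrad⟩
  have hcomp : ∀ i, lam i * (gradQ q y i z + hessQ q y i v v) = 0 := fun i => by
    by_cases hi : i ∈ J0
    · have : i ∈ Jset q y v z := hJz ▸ hi
      rw [this.2, mul_zero]
    · rw [hlzero i hi, zero_mul]
  have hdir := mem_LamDir_of_complementary hLam hz hcomp
  refine ⟨hessT q y lam v, ?_, mem_unionQ_of_mem_LamDir hdir ⟨z, hz, hJz⟩ hP hPJ0 Subset.rfl
    ⟨?_, ?_⟩⟩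
  · have := mem_tanCone_GphNhat hq hs hy hLam.1 (h := v) (z := z) (fun i hi => (hv i hi).le)
      (fun i => by
        by_cases hi : i ∈ actI q y
        · rw [hv i hi, mul_zero]
        · rw [hLam.1.2 i hi, zero_mul]) hz hcomp
    rwa [hgrad] at this
  · refine mem_KconeDir_of_tendsto hq hPJ0 ((continuous_snd.tendsto p).comp (hp.comp hφt))
      fun k => ?_
    have := hw (φ k)
    rwa [hPc, hJc] at this
  · refine (isClosed_polarCone _).mem_of_tendsto (((continuous_fst.tendsto p).comp
      (hp.comp hφt)).add (tendsto_hessT hq (tendsto_const_nhds (x := y)) hlim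
        ((continuous_snd.tendsto p).comp (hp.comp hφt)))) (Eventually.of_forall fun k => ?_)
    have := hpol (φ k)
    rwa [hPc, hJc] at this

end BaseNormals

section LimitingNormals

variable {m l : ℕ} {q : Em m → Em l} {y x v u : Em m} {lam : Em l}

theorem exists_maximalJ {J : Set (Fin l)} (hJ : J ∈ Jbar q y v) :
    ∃ J', J ⊆ J' ∧ MaximalJ q y v J' := by
  obtain ⟨J', h, hmax⟩ := (toFinite (Jbar q y v)).exists_le_maximal hJ
  exact ⟨J', h, hmax.prop, fun K hK hJK => hJK.antisymm (hmax.le_of_ge hK hJK)⟩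

theorem TwoRegular.eventually_lower_bound (hq : ContDiff ℝ 2 q) {J : Set (Fin l)}
    (h : TwoRegular q y u J) {t : ℕ → ℝ} {uk : ℕ → Em m} (ht0 : ∀ k, 0 < t k)
    (ht : Tendsto t atTop (𝓝 0)) (hu : Tendsto uk atTop (𝓝 u)) :
    ∃ c > (0 : ℝ), ∀ᶠ k in atTop, ∀ μ : Em l, (∀ i ∉ J, μ i = 0) →
      c * t k * ‖μ‖ ≤ ‖gradT q (y + t k • uk k) μ‖ := by
  obtain ⟨c, hc, ε, hε, τ, hτ, hb⟩ := h.exists_lower_bound hq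
  refine ⟨c, hc, ?_⟩
  filter_upwards [ht.eventually (gt_mem_nhds hτ), hu.eventually (Metric.ball_mem_nhds u hε)]
    with k hk hk'
  refine hb (t k) (ht0 k) hk _ ?_
  rw [add_sub_cancel_left, ← smul_sub, norm_smul, Real.norm_of_nonneg (ht0 k).le, mul_comm]
  rw [dist_eq_norm] at hk'
  exact mul_le_mul_of_nonneg_right hk'.le (ht0 k).le

theorem exists_subseq_multipliers (hq : ContDiff ℝ 2 q) {C : ℝ} (hC0 : 0 ≤ C)
    (hC : ∀ᶠ x in 𝓝 y, x ∈ Gam q → x ≠ y → SubregAt q x C) {t : ℕ → ℝ} {uk xk : ℕ → Em m}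
    (ht0 : ∀ k, 0 < t k) (ht : Tendsto t atTop (𝓝 0)) (hu : Tendsto uk atTop (𝓝 u))
    (hu0 : u ≠ 0) (hx : Tendsto xk atTop (𝓝 x))
    (hmem : ∀ k, (y + t k • uk k, xk k) ∈ GphNhat q) :
    ∃ φ : ℕ → ℕ, StrictMono φ ∧ ∃ (lk : ℕ → Em l) (lam : Em l) (P I : Set (Fin l)),
      Tendsto lk atTop (𝓝 lam) ∧ ∀ k, SubregAt q (y + t (φ k) • uk (φ k)) C ∧
      lk k ∈ Lam q (y + t (φ k) • uk (φ k)) (xk (φ k)) ∧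
      Iplus (lk k) = P ∧ actI q (y + t (φ k) • uk (φ k)) = I := by
  have hev : ∀ᶠ k in atTop, SubregAt q (y + t k • uk k) C := by
    filter_upwards [(tendsto_add_smul y ht hu).eventually hC, hu.eventually_ne hu0] with k h1 h2
    exact h1 (hmem k).1 (by simp [(ht0 k).ne', h2])
  obtain ⟨φ, hφ, hs⟩ := extraction_of_frequently_atTop hev.frequently
  choose lk hlk hlb using fun k => exists_bounded_multiplier hq hC0 (hs k) (hmem (φ k)).1
    (hmem (φ k)).2
  obtain ⟨R, hR0, hR⟩ := exists_norm_bound_of_tendsto hx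
  obtain ⟨ψ, hψ, ⟨P, I⟩, lam, hconst, hlim⟩ := exists_subseq_const_tendsto
    (fun k => (Iplus (lk k), actI q (y + t (φ k) • uk (φ k))))
    (isBounded_nonneg_le l (C * R)) (g := lk) fun k i =>
      ⟨(hlk k).1.1 i, (hlb k i).trans (mul_le_mul_of_nonneg_left (hR _) hC0)⟩
  exact ⟨φ ∘ ψ, hφ.comp hψ, lk ∘ ψ, lam, P, I, hlim, fun k => ⟨hs _, hlk _,
    (Prod.mk.inj (hconst k)).1, (Prod.mk.inj (hconst k)).2⟩⟩

theorem limit_multiplier_properties (hq : ContDiff ℝ 2 q) {t : ℕ → ℝ} {uk xk : ℕ → Em m}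
    (ht0 : ∀ k, 0 < t k) (ht : Tendsto t atTop (𝓝 0)) (hu : Tendsto uk atTop (𝓝 u))
    (hx : Tendsto xk atTop (𝓝 x)) (hmem : ∀ k, y + t k • uk k ∈ Gam q)
    {lk : ℕ → Em l} (hlim : Tendsto lk atTop (𝓝 lam)) {P I : Set (Fin l)}
    (hlk : ∀ k, lk k ∈ Lam q (y + t k • uk k) (xk k)) (hP : ∀ k, Iplus (lk k) = P)
    (hI : ∀ k, actI q (y + t k • uk k) = I) :
    P ⊆ I ∧ Iplus lam ⊆ P ∧ u ∈ Kbar q y x ∧ lam ∈ LamDir q y x u ∧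
      (∃ J ∈ Jbar q y u, I ⊆ J) ∧ (u, hessT q y lam u) ∈ tanCone (GphNhat q) (y, x) := by
  have hyk := tendsto_add_smul y ht hu
  have hPI : P ⊆ I := by
    rw [← hP 0, ← hI 0]
    exact Iplus_subset_actI (hlk 0).1
  have hPl : Iplus lam ⊆ P := Iplus_subset_of_tendsto hlim hP
  have hzero : ∀ k, ∀ i ∈ I, q (y + t k • uk k) i = 0 := fun k i hi => by
    rw [← hI k] at hi
    exact hi
  have hIy : I ⊆ actI q y := fun i hi => tendsto_nhds_unique
    (((continuous_apply_of_contDiff_two hq i).tendsto y).comp hyk)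
    (tendsto_const_nhds.congr fun k => (hzero k i hi).symm)
  have hgradI : ∀ i ∈ I, gradQ q y i u = 0 := fun i hi => by
    refine tendsto_nhds_unique (tendsto_gradQ_of_quotient (y := y) hq ht0 ht hu i)
      (tendsto_const_nhds.congr fun k => ?_)
    rw [hzero k i hi, show q y i = 0 from hIy hi, sub_zero, mul_zero]
  have hl0 : ∀ i, 0 ≤ lam i := fun i => apply_nonneg_of_tendsto hlim fun k => (hlk k).1.1 i
  have hlzero : ∀ i ∉ I, lam i = 0 := fun i hi =>
    le_antisymm (not_lt.1 fun h => hi (hPI (hPl h))) (hl0 i)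
  have hgrad : gradT q y lam = x := tendsto_nhds_unique (tendsto_gradT hq hyk hlim)
    (hx.congr fun k => (hlk k).2.symm)
  have hLam : lam ∈ Lam q y x := ⟨⟨hl0, fun i hi => hlzero i fun h => hi (hIy h)⟩, hgrad⟩
  have htan : u ∈ tanCone (Gam q) y := ⟨t, uk, ht0, ht, hu, hmem⟩
  obtain ⟨z, hz, hzI⟩ := exists_Xibar_of_sequence hq ht0 ht hu hmem hIy hzero
  refine ⟨hPI, hPl, ⟨htan, ?_⟩, mem_LamDir_of_complementary hLam hz fun i => ?_,
    ⟨_, ⟨z, hz, rfl⟩, fun i hi => ⟨⟨hIy hi, hgradI i hi⟩, hzI i hi⟩⟩, ?_⟩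
  · rw [← hgrad, inner_gradT]
    refine Finset.sum_eq_zero fun i _ => ?_
    by_cases hi : i ∈ I
    · rw [hgradI i hi, mul_zero]
    · rw [hlzero i hi, zero_mul]
  · by_cases hi : i ∈ I
    · rw [hzI i hi, mul_zero]
    · rw [hlzero i hi, zero_mul]
  · refine ⟨t, fun k => (uk k, (t k)⁻¹ • (gradT q (y + t k • uk k) lam - gradT q y lam)), ht0, ht,
      hu.prodMk_nhds (tendsto_gradT_quotient hq y ht0 ht hu tendsto_const_nhds), fun k => ?_⟩
    have e : (y, x) + t k • (uk k, (t k)⁻¹ • (gradT q (y + t k • uk k) lam - gradT q y lam)) =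
        (y + t k • uk k, gradT q (y + t k • uk k) lam) := by
      rw [Prod.smul_mk, Prod.mk_add_mk, smul_smul, mul_inv_cancel₀ (ht0 k).ne', one_smul, hgrad,
        add_sub_cancel]
    rw [e]
    refine ⟨hmem k, gradT_mem_regNormalCone hq ⟨hl0, fun i hi => hlzero i fun h => hi ?_⟩⟩
    exact hzero k i h

theorem mem_polarCone_Kcone_of_mem_regNormalConeP (hq : ContDiff ℝ 2 q) {C : ℝ}
    (hs : SubregAt q y C) (hy : y ∈ Gam q) (hl : lam ∈ NRl q y)
    (hlicq : ∀ μ : Em l, (∀ i ∉ actI q y, μ i = 0) → gradT q y μ = 0 → μ = 0) {p : Em m × Em m}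
    (hp : p ∈ regNormalConeP (GphNhat q) (y, gradT q y lam)) :
    p.1 + hessT q y lam p.2 ∈ polarCone (Kcone q y (Iplus lam) (actI q y)) := by
  intro h hh
  obtain ⟨z, hz, -⟩ := exists_gradQ_solution (q := q) (y := y) (Subset.refl (actI q y))
    (c := fun i => hessQ q y i h h) fun μ hμ h0 => by
      rw [hlicq μ hμ.1 h0]
      simp
  have hsplit : ∀ i, i ∈ Iplus lam ∨ lam i = 0 := fun i =>
    (hl.1 i).lt_or_eq.imp id Eq.symm
  refine inner_nonpos_of_mem_regNormalConeP hq hs hy hl hp (z := z) (fun i hi => ?_)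
    (fun i => ?_) (fun i hi => (hz i hi).le) fun i => ?_
  · by_cases h' : i ∈ Iplus lam
    · exact (hh.1 i h').le
    · exact hh.2 i ⟨hi, h'⟩
  · rcases hsplit i with h' | h'
    · rw [hh.1 i h', mul_zero]
    · rw [h', zero_mul]
  · rcases hsplit i with h' | h'
    · rw [hz i (Iplus_subset_actI hl h'), mul_zero]
    · rw [h', zero_mul]

theorem eq_zero_of_lower_bound {J : Set (Fin l)} {c : ℝ} (hc : 0 < c)
    (h : ∀ μ : Em l, (∀ i ∉ J, μ i = 0) → c * ‖μ‖ ≤ ‖gradT q y μ‖) {μ : Em l}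
    (hμ : ∀ i ∉ J, μ i = 0) (h0 : gradT q y μ = 0) : μ = 0 := by
  have h1 := h μ hμ
  rw [h0, norm_zero] at h1
  exact norm_le_zero_iff.1 (nonpos_of_mul_nonpos_right h1 hc)

theorem exists_mem_unionQ_of_direction (hq : ContDiff ℝ 2 q) {C : ℝ} (hC0 : 0 ≤ C)
    (hC : ∀ᶠ x in 𝓝 y, x ∈ Gam q → x ≠ y → SubregAt q x C)
    (h2reg : ∀ u ∈ Kbar q y x, u ≠ 0 → ∀ J, MaximalJ q y u J → TwoRegular q y u J)
    {t : ℕ → ℝ} {uk xk : ℕ → Em m} (ht0 : ∀ k, 0 < t k) (ht : Tendsto t atTop (𝓝 0))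
    (hu : Tendsto uk atTop (𝓝 u)) (hu0 : u ≠ 0) (hx : Tendsto xk atTop (𝓝 x))
    {pk : ℕ → Em m × Em m} {p : Em m × Em m} (hp : Tendsto pk atTop (𝓝 p))
    (hmem : ∀ k, (y + t k • uk k, xk k) ∈ GphNhat q)
    (hpk : ∀ k, pk k ∈ regNormalConeP (GphNhat q) (y + t k • uk k, xk k)) :
    ∃ vstar, (u, vstar) ∈ tanCone (GphNhat q) (y, x) ∧ p ∈ unionQ q y x u vstar := by
  obtain ⟨φ, hφ, lk, lam, P, I, hlim, hprop⟩ :=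
    exists_subseq_multipliers hq hC0 hC ht0 ht hu hu0 hx hmem
  have hφt := hφ.tendsto_atTop
  obtain ⟨hPI, hPl, hK, hdir, ⟨J, hJ, hIJ⟩, htan⟩ := limit_multiplier_properties hq
    (fun k => ht0 (φ k)) (ht.comp hφt) (hu.comp hφt) (hx.comp hφt) (fun k => (hmem (φ k)).1)
    hlim (fun k => (hprop k).2.1) (fun k => (hprop k).2.2.1) (fun k => (hprop k).2.2.2)
  refine ⟨_, htan, mem_unionQ_of_mem_LamDir hdir hJ hPl hPI hIJ ?_⟩
  obtain ⟨J', hJJ', hmax⟩ := exists_maximalJ hJ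
  obtain ⟨c, hc, hev⟩ := (h2reg u hK hu0 J' hmax).eventually_lower_bound hq
    (fun k => ht0 (φ k)) (ht.comp hφt) (hu.comp hφt)
  obtain ⟨ψ, hψ, hrank'⟩ := extraction_of_frequently_atTop hev.frequently
  have hψt := hψ.tendsto_atTop
  have hct : Tendsto (φ ∘ ψ) atTop atTop := hφt.comp hψt
  have hrank : ∀ k, ∀ μ : Em l, (∀ i ∉ I, μ i = 0) → c * (t ∘ φ ∘ ψ) k * ‖μ‖ ≤
      ‖gradT q (y + (t ∘ φ ∘ ψ) k • (uk ∘ φ ∘ ψ) k) μ‖ := fun k μ hμ =>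
    hrank' k μ fun i hi => hμ i fun h => hi (hJJ' (hIJ h))
  have hw : ∀ k, (pk (φ (ψ k))).2 ∈ Kcone q (y + (t ∘ φ ∘ ψ) k • (uk ∘ φ ∘ ψ) k) P I ∧
      (pk (φ (ψ k))).1 + hessT q (y + (t ∘ φ ∘ ψ) k • (uk ∘ φ ∘ ψ) k) (lk (ψ k)) (pk (φ (ψ k))).2
        ∈ polarCone (Kcone q (y + (t ∘ φ ∘ ψ) k • (uk ∘ φ ∘ ψ) k) P I) := by
    intro k
    obtain ⟨hs, hl, hP, hI⟩ := hprop (ψ k)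
    have hp' := hpk (φ (ψ k))
    rw [← hl.2] at hp'
    have h1 := mem_Kcone_of_mem_regNormalConeP hq (hmem _).1 hl.1 hp'
    have h2 := mem_polarCone_Kcone_of_mem_regNormalConeP hq hs (hmem _).1 hl.1 (fun μ hμ h0 =>
      eq_zero_of_lower_bound (mul_pos hc (ht0 (φ (ψ k)))) (hrank k) (by rwa [hI] at hμ) h0) hp'
    rw [hP, hI] at h1 h2
    exact ⟨h1, h2⟩
  have hpc := hp.comp hct
  have hp2 : Tendsto (fun k => (pk (φ (ψ k))).2) atTop (𝓝 p.2) :=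
    (continuous_snd.tendsto p).comp hpc
  refine ⟨mem_KconeDir_of_tendsto_Kcone hq hPI (fun k => ht0 (φ (ψ k))) (ht.comp hct)
    (hu.comp hct) hp2 fun k => (hw k).1, fun d hd => ?_⟩
  obtain ⟨dk, hdk, hdlim⟩ := exists_Kcone_tendsto hq hPI (fun k => ht0 (φ (ψ k))) (ht.comp hct)
    (hu.comp hct) hc hrank hd
  exact le_of_tendsto' ((((continuous_fst.tendsto p).comp hpc).add
    (tendsto_hessT hq (tendsto_add_smul y (ht.comp hct) (hu.comp hct)) (hlim.comp hψt) hp2)).inner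
      hdlim) fun k => (hw k).2 _ (hdk k)

theorem exists_mem_unionQ_of_mem_limNormalConeP (hq : ContDiff ℝ 2 q) (hy : y ∈ Gam q)
    (hsub : MetricallySubregularAt (Mq q) y (0 : Em l)) (hvic : MetricallyRegularInVicinity q y)
    (h2reg : ∀ u ∈ Kbar q y x, u ≠ 0 → ∀ J, MaximalJ q y u J → TwoRegular q y u J)
    (hN : Nspace q y ≠ {0}) {p : Em m × Em m} (hp : p ∈ limNormalConeP (GphNhat q) (y, x)) :
    ∃ v vstar, v ≠ 0 ∧ (v, vstar) ∈ tanCone (GphNhat q) (y, x) ∧ p ∈ unionQ q y x v vstar := by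
  obtain ⟨zk, pk, hz, hpk, hzlim, hplim⟩ := hp
  obtain ⟨C, hC0, hs⟩ := exists_subregAt_of_metricallySubregularAt hsub
  obtain ⟨C', hC0', hs'⟩ := exists_subregAt_of_vicinity hvic
  have hz1 : Tendsto (fun k => (zk k).1) atTop (𝓝 y) := (continuous_fst.tendsto (y, x)).comp hzlim
  have hz2 : Tendsto (fun k => (zk k).2) atTop (𝓝 x) := (continuous_snd.tendsto (y, x)).comp hzlim
  by_cases hfreq : ∃ᶠ k in atTop, (zk k).1 = y
  · obtain ⟨φ, hφ, hk⟩ := extraction_of_frequently_atTop hfreq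
    have hφt := hφ.tendsto_atTop
    obtain ⟨v, hv, hv0⟩ : ∃ v ∈ Nspace q y, v ≠ 0 := by
      by_contra! h
      exact hN (Subset.antisymm h fun v hv => by
        rw [mem_singleton_iff.1 hv]
        exact fun i _ => by simp [gradQ])
    have he : ∀ k, zk (φ k) = (y, (zk (φ k)).2) := fun k => Prod.ext (hk k) rfl
    obtain ⟨vstar, h1, h2⟩ := exists_mem_unionQ_of_base hq hC0.le hs hy hv (hz2.comp hφt)
      (hplim.comp hφt) (fun k => by
        have := (hz (φ k)).2
        rwa [hk] at this) (fun k => by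
        have := hpk (φ k)
        rwa [he] at this)
    exact ⟨v, vstar, hv0, h1, h2⟩
  · obtain ⟨φ, hφ, hk⟩ := extraction_of_frequently_atTop (not_frequently.1 hfreq).frequently
    have hφt := hφ.tendsto_atTop
    set t : ℕ → ℝ := fun k => ‖(zk (φ k)).1 - y‖ with ht
    have ht0 : ∀ k, 0 < t k := fun k => norm_sub_pos_iff.2 (hk k)
    set uk : ℕ → Em m := fun k => (t k)⁻¹ • ((zk (φ k)).1 - y) with huk
    have htlim : Tendsto t atTop (𝓝 0) :=
      tendsto_iff_norm_sub_tendsto_zero.1 (hz1.comp hφt)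
    have hnorm : ∀ k, uk k ∈ sphere (0 : Em m) 1 := fun k => by
      rw [mem_sphere_zero_iff_norm, huk, norm_smul, norm_inv, Real.norm_of_nonneg (ht0 k).le]
      exact inv_mul_cancel₀ (ht0 k).ne'
    obtain ⟨u, hu, ψ, hψ, hulim⟩ := (isCompact_sphere (0 : Em m) 1).tendsto_subseq hnorm
    have hψt := hψ.tendsto_atTop
    have hu0 : u ≠ 0 := ne_zero_of_mem_unit_sphere ⟨u, hu⟩
    have he : ∀ k, zk (φ k) = (y + t k • uk k, (zk (φ k)).2) := fun k => by
      refine Prod.ext ?_ rfl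
      simp only [huk, smul_smul, mul_inv_cancel₀ (ht0 k).ne', one_smul, add_sub_cancel]
    have hct : Tendsto (φ ∘ ψ) atTop atTop := hφt.comp hψt
    obtain ⟨vstar, h1, h2⟩ := exists_mem_unionQ_of_direction hq hC0'.le hs' h2reg
      (fun k => ht0 (ψ k)) (htlim.comp hψt) hulim hu0 (hz2.comp hct) (hplim.comp hct)
      (fun k => by
        have := hz (φ (ψ k))
        rwa [he] at this) (fun k => by
        have := hpk (φ (ψ k))
        rwa [he] at this)
    exact ⟨u, vstar, hu0, h1, h2⟩

theorem MaximalJ.gradQ_nonpos {J : Set (Fin l)} (hJ : MaximalJ q y v J) (hv : v ∈ Tlin q y)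
    {b : Em m} (hb : ∀ j ∈ J, gradQ q y j b = 0) {i : Fin l} (hi : i ∈ IbarDir q y v) :
    gradQ q y i b ≤ 0 := by
  classical
  by_contra! hpos
  obtain ⟨⟨z, hz, hJz⟩, hmax⟩ := hJ
  set g : Fin l → ℝ := fun i => gradQ q y i z + hessQ q y i v v with hg
  obtain ⟨k, hk, hmin⟩ := Finset.exists_min_image
    (Finset.univ.filter fun i => i ∈ IbarDir q y v ∧ 0 < gradQ q y i b)
    (fun i => -g i / gradQ q y i b) ⟨i, by simp [hi, hpos]⟩
  simp only [Finset.mem_filter, Finset.mem_univ, true_and] at hk hmin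
  set s := -g k / gradQ q y k b with hs
  have hs0 : 0 ≤ s := div_nonneg (neg_nonneg.2 (hz k hk.1.1)) hk.2.le
  have hM : ∀ᶠ M : ℝ in atTop, ∀ i, gradQ q y i v < 0 →
      g i + s * gradQ q y i b + M * gradQ q y i v ≤ 0 := by
    refine eventually_all.2 fun i => ?_
    by_cases h : gradQ q y i v < 0
    · filter_upwards [eventually_ge_atTop ((g i + s * gradQ q y i b) / -gradQ q y i v)] with M hM _
      rw [div_le_iff₀ (by linarith)] at hM
      linarith
    · exact Eventually.of_forall fun M h' => absurd h' h
  obtain ⟨M, hM⟩ := hM.exists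
  set z' := z + s • b + M • v with hz'
  have hval : ∀ i, gradQ q y i z' + hessQ q y i v v =
      g i + s * gradQ q y i b + M * gradQ q y i v := fun i => by
    rw [hz', gradQ_add, gradQ_add, gradQ_smul, gradQ_smul]
    ring
  have hz'X : z' ∈ Xibar q y v := by
    intro i hi
    rw [hval]
    rcases (hv i hi).lt_or_eq with h | h
    · exact hM i h
    rw [h, mul_zero, add_zero]
    by_cases hbi : 0 < gradQ q y i b
    · have := hmin i ⟨⟨hi, h⟩, hbi⟩
      rw [le_div_iff₀ hbi] at this
      linarith
    · have h1 := mul_nonpos_of_nonneg_of_nonpos hs0 (not_lt.1 hbi)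
      have h2 : g i ≤ 0 := hz i hi
      linarith
  have hsub : J ⊆ Jset q y v z' := by
    intro j hj
    have hj' : j ∈ Jset q y v z := hJz ▸ hj
    refine ⟨hj'.1, ?_⟩
    have h1 : g j = 0 := hj'.2
    rw [hval, hb j hj, hj'.1.2, h1]
    simp
  have hkJ : k ∈ Jset q y v z' := by
    refine ⟨hk.1, ?_⟩
    rw [hval, hk.1.2, hs, div_mul_cancel₀ _ hk.2.ne']
    simp
  rw [← hmax _ ⟨z', hz'X, rfl⟩ hsub] at hkJ
  exact hk.2.ne' (hb k hkJ)

theorem MaximalJ.exists_gradQ_comb {J : Set (Fin l)} (hJ : MaximalJ q y v J) (hv : v ∈ Tlin q y)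
    {i : Fin l} (hi : i ∈ IbarDir q y v) :
    ∃ μ : Em l, (∀ j ∉ J, μ j = 0) ∧ ∀ w, gradQ q y i w = ∑ j, μ j * gradQ q y j w := by
  obtain ⟨μ, hμ, he⟩ := exists_Pset_gradT_eq (q := q) (y := y) (Subset.refl J)
    (x := gradT q y (EuclideanSpace.single i 1)) fun d hd => by
      rw [inner_gradT_single]
      exact hJ.gradQ_nonpos hv hd.1 hi
  exact ⟨μ, hμ.1, fun w => by rw [← inner_gradT_single, ← he, inner_gradT]⟩

theorem exists_zero_of_lower_bound {E F : Type*} [NormedAddCommGroup E] [InnerProductSpace ℝ E]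
    [FiniteDimensional ℝ E] [NormedAddCommGroup F] [InnerProductSpace ℝ F] {r : E → F}
    {r' : E → E →L[ℝ] F} (hr : ∀ x, HasFDerivAt r (r' x) x) {x₀ a : E} {R σ : ℝ} (hσ : 0 < σ)
    (ha : ‖a - x₀‖ + ‖r a‖ / σ < R)
    (hb : ∀ x, ‖x - x₀‖ ≤ R → r x ≠ 0 →
      ∃ g : E, (∀ d, ⟪r x, r' x d⟫ = ⟪g, d⟫) ∧ σ * ‖r x‖ < ‖g‖) :
    ∃ x, r x = 0 ∧ ‖x - a‖ ≤ ‖r a‖ / σ := by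
  have hrc : Continuous r := continuous_iff_continuousAt.2 fun x => (hr x).continuousAt
  have hdiv : 0 ≤ ‖r a‖ / σ := by positivity
  have haR : a ∈ closedBall x₀ R := by
    rw [mem_closedBall, dist_eq_norm]
    linarith
  obtain ⟨x, hx, hmin⟩ := (isCompact_closedBall x₀ R).exists_isMinOn ⟨a, haR⟩
    (f := fun x => ‖r x‖ + σ * ‖x - a‖) (by fun_prop)
  have hxa : ‖x - a‖ ≤ ‖r a‖ / σ := by
    have h1 : ‖r x‖ + σ * ‖x - a‖ ≤ ‖r a‖ + σ * ‖a - a‖ := hmin haR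
    rw [sub_self, norm_zero, mul_zero, add_zero] at h1
    rw [le_div_iff₀ hσ]
    linarith [norm_nonneg (r x)]
  refine ⟨x, ?_, hxa⟩
  by_contra hx0
  obtain ⟨g, hg, hlt⟩ := hb x (by rwa [mem_closedBall, dist_eq_norm] at hx) hx0
  have hin_ball : ‖x - x₀‖ < R := by
    have := norm_sub_le_norm_sub_add_norm_sub x a x₀
    linarith
  have hd : HasFDerivAt (fun x => ‖r x‖ ^ 2) (2 • (innerSL ℝ (r x)).comp (r' x)) x :=
    (hr x).norm_sq
  set s : ℕ → ℝ := fun n => ((n : ℝ) + 1)⁻¹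
  have hs0 : ∀ n, 0 < s n := fun n => by positivity
  have hslim : Tendsto s atTop (𝓝 0) := tendsto_inv_natCast_add_one
  have hlim := tendsto_quotient_of_hasFDerivAt hd hs0 hslim (tendsto_const_nhds (x := -g))
  have hrx : 0 < ‖r x‖ := norm_pos_iff.2 hx0
  have hev : ∀ᶠ n in atTop, -(2 * ‖r x‖ * (σ * ‖g‖)) ≤
      (s n)⁻¹ • (‖r (x + s n • -g)‖ ^ 2 - ‖r x‖ ^ 2) := by
    have hxs : Tendsto (fun n => x + s n • -g) atTop (𝓝 x) :=
      tendsto_nhds_of_eq (tendsto_const_nhds.add (hslim.smul_const (-g))) (by simp)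
    have hsg : Tendsto (fun n => s n * (σ * ‖g‖)) atTop (𝓝 0) :=
      tendsto_nhds_of_eq (hslim.mul_const _) (zero_mul _)
    filter_upwards [hxs.eventually (Metric.isOpen_ball.mem_nhds
      (show x ∈ ball x₀ R by rwa [mem_ball, dist_eq_norm])),
      hsg.eventually (gt_mem_nhds hrx)] with n hn hn'
    have h1 : ‖r x‖ + σ * ‖x - a‖ ≤ ‖r (x + s n • -g)‖ + σ * ‖x + s n • -g - a‖ :=
      hmin (ball_subset_closedBall hn)
    have h2 : ‖x + s n • -g - a‖ ≤ ‖x - a‖ + s n * ‖g‖ := by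
      rw [add_sub_right_comm]
      refine (norm_add_le _ _).trans_eq ?_
      rw [norm_smul, norm_neg, Real.norm_of_nonneg (hs0 n).le]
    have h3 : ‖r x‖ - s n * (σ * ‖g‖) ≤ ‖r (x + s n • -g)‖ := by
      have := mul_le_mul_of_nonneg_left h2 hσ.le
      linarith
    have h4 : (‖r x‖ - s n * (σ * ‖g‖)) ^ 2 ≤ ‖r (x + s n • -g)‖ ^ 2 :=
      pow_le_pow_left₀ (by linarith) h3 2
    rw [smul_eq_mul, le_inv_mul_iff₀ (hs0 n)]
    nlinarith [sq_nonneg (s n * (σ * ‖g‖))]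
  have h5 := ge_of_tendsto hlim hev
  have h6 : (2 • (innerSL ℝ (r x)).comp (r' x)) (-g) = -(2 * ‖g‖ ^ 2) := by
    have : ⟪r x, r' x g⟫ = ‖g‖ ^ 2 := by rw [hg, real_inner_self_eq_norm_sq]
    simp [this]
  rw [h6] at h5
  have hg0 : 0 < ‖g‖ := lt_of_le_of_lt (by positivity) hlt
  nlinarith

/-- The coordinate projection of `ℝ^l` that keeps the entries indexed by `J`. -/
noncomputable def coordProj {l : ℕ} (J : Set (Fin l)) : Em l →L[ℝ] Em l :=
  letI := Classical.decPred (· ∈ J)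
  LinearMap.toContinuousLinearMap
    { toFun := fun a => WithLp.toLp 2 fun i => if i ∈ J then a i else 0
      map_add' := fun a b => by ext i; by_cases h : i ∈ J <;> simp [h]
      map_smul' := fun c a => by ext i; by_cases h : i ∈ J <;> simp [h] }

theorem coordProj_apply_of_mem {J : Set (Fin l)} {i : Fin l} (hi : i ∈ J) (a : Em l) :
    coordProj J a i = a i := by
  simp [coordProj, hi]

theorem coordProj_apply_of_notMem {J : Set (Fin l)} {i : Fin l} (hi : i ∉ J) (a : Em l) :
    coordProj J a i = 0 := by
  simp [coordProj, hi]

theorem exists_solution_of_lower_bound (hq : ContDiff ℝ 2 q) {J : Set (Fin l)} {x₀ a : Em m}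
    {R σ : ℝ} (hσ : 0 < σ) (c : Em l) (ha : ‖a - x₀‖ + ‖coordProj J (q a - c)‖ / σ < R)
    (hb : ∀ x, ‖x - x₀‖ ≤ R → ∀ μ : Em l, (∀ i ∉ J, μ i = 0) → 2 * σ * ‖μ‖ ≤ ‖gradT q x μ‖) :
    ∃ x, (∀ i ∈ J, q x i = c i) ∧ ‖x - a‖ ≤ ‖coordProj J (q a - c)‖ / σ := by
  obtain ⟨x, hx, hxa⟩ := exists_zero_of_lower_bound
    (r := fun x => coordProj J (q x - c)) (r' := fun x => (coordProj J).comp (fderiv ℝ q x))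
    (fun x => (coordProj J).hasFDerivAt.comp x ((hasFDerivAt_of_contDiff_two hq x).sub_const c))
    hσ ha fun x hx hne => by
      refine ⟨gradT q x (coordProj J (q x - c)), fun d => ?_, ?_⟩
      · rw [inner_gradT, real_inner_comm, PiLp.inner_apply]
        refine Finset.sum_congr rfl fun i _ => ?_
        by_cases hi : i ∈ J
        · rw [ContinuousLinearMap.comp_apply, coordProj_apply_of_mem hi (fderiv ℝ q x d)]
          simp [gradQ]
        · simp [coordProj_apply_of_notMem hi]
      · have h1 := hb x hx _ fun i hi => coordProj_apply_of_notMem hi (q x - c)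
        have h2 := mul_pos hσ (norm_pos_iff.2 hne)
        linarith
  refine ⟨x, fun i hi => ?_, hxa⟩
  have h : coordProj J (q x - c) i = 0 := by
    rw [hx]
    rfl
  rw [coordProj_apply_of_mem hi] at h
  exact sub_eq_zero.1 h

theorem tendsto_of_forall_apply {f : ℕ → Em l} {a : Em l}
    (h : ∀ i, Tendsto (fun k => f k i) atTop (𝓝 (a i))) : Tendsto f atTop (𝓝 a) :=
  ((PiLp.continuous_toLp 2 _).tendsto a.ofLp).comp (tendsto_pi_nhds.2 h)

theorem TwoRegular.exists_arc (hq : ContDiff ℝ 2 q) {J : Set (Fin l)} (h : TwoRegular q y v J)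
    (hJ : ∀ j ∈ J, j ∈ IbarDir q y v) (z : Em m) (b : Fin l → ℝ) :
    ∃ (t : ℕ → ℝ) (uk : ℕ → Em m), (∀ k, 0 < t k) ∧ Tendsto t atTop (𝓝 0) ∧
      Tendsto uk atTop (𝓝 v) ∧ ∀ᶠ k in atTop, ∀ j ∈ J, q (y + t k • uk k) j =
        t k ^ 2 * (1 / 2 * (gradQ q y j z + hessQ q y j v v)) - t k ^ 3 * b j := by
  obtain ⟨c, hc, ε, hε, τ, hτ, hlow⟩ := h.exists_lower_bound hq
  set t : ℕ → ℝ := fun n => ((n : ℝ) + 1)⁻¹ with ht_def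
  have ht0 : ∀ k, 0 < t k := fun n => by positivity
  have ht : Tendsto t atTop (𝓝 0) := tendsto_inv_natCast_add_one
  set w : ℕ → Em m := fun n => v + (t n / 2) • z with hw_def
  have hw : Tendsto w atTop (𝓝 v) :=
    tendsto_nhds_of_eq (tendsto_const_nhds.add ((ht.div_const 2).smul_const z)) (by simp)
  set d : ℕ → Em l := fun n => WithLp.toLp 2 fun j =>
    t n ^ 2 * (1 / 2 * (gradQ q y j z + hessQ q y j v v)) - t n ^ 3 * b j with hd_def
  set e : ℕ → Em l := fun n => coordProj J (q (y + t n • w n) - d n) with he_def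
  have he : Tendsto (fun n => (t n ^ 2)⁻¹ • e n) atTop (𝓝 0) := by
    refine tendsto_of_forall_apply fun j => ?_
    by_cases hj : j ∈ J
    · have h1 := ((tendsto_taylor_two hq y ht0 ht hw j).sub_const (1 / 2 * hessQ q y j v v)).add
        (ht.mul_const (b j))
      refine tendsto_nhds_of_eq (h1.congr fun n => ?_) (by simp)
      have hA : gradQ q y j (w n) = t n / 2 * gradQ q y j z := by
        rw [hw_def]
        simp only [gradQ_add, gradQ_smul]
        rw [(hJ j hj).2, zero_add]
      have h2 : e n j = q (y + t n • w n) j -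
          (t n ^ 2 * (1 / 2 * (gradQ q y j z + hessQ q y j v v)) - t n ^ 3 * b j) :=
        coordProj_apply_of_mem hj _
      have h3 := (ht0 n).ne'
      rw [PiLp.smul_apply, smul_eq_mul, h2, hA, (hJ j hj).1]
      field_simp
      ring
    · refine tendsto_const_nhds.congr fun n => ?_
      have h2 : e n j = 0 := coordProj_apply_of_notMem hj _
      rw [PiLp.smul_apply, h2, smul_zero]
      rfl
  set δ : ℕ → ℝ := fun n => ‖(t n ^ 2)⁻¹ • e n‖ * (2 / c) with hδ_def
  have hδ : Tendsto δ atTop (𝓝 0) :=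
    tendsto_nhds_of_eq (he.norm.mul_const _) (by simp)
  have hδe : ∀ n, ‖e n‖ / (c * t n / 2) = t n * δ n := fun n => by
    have h3 := ht0 n
    simp only [hδ_def, norm_smul, norm_inv, norm_pow, Real.norm_of_nonneg (ht0 n).le]
    field_simp
  have hev : ∀ᶠ n in atTop, ∃ x, (∀ j ∈ J, q x j = d n j) ∧ ‖x - (y + t n • w n)‖ ≤ t n * δ n := by
    have hR : Tendsto (fun n => ‖w n - v‖ + δ n) atTop (𝓝 0) :=
      tendsto_nhds_of_eq ((hw.sub_const v).norm.add hδ) (by simp)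
    filter_upwards [ht.eventually (gt_mem_nhds hτ), hR.eventually (gt_mem_nhds hε)] with n hn hn'
    rw [← hδe]
    refine exists_solution_of_lower_bound hq (x₀ := y + t n • v) (R := ε * t n)
      (by have := ht0 n; positivity) (d n) ?_ fun x hx μ hμ => ?_
    · rw [hδe, show y + t n • w n - (y + t n • v) = t n • (w n - v) by module, norm_smul,
        Real.norm_of_nonneg (ht0 n).le]
      nlinarith [ht0 n]
    · have := hlow (t n) (ht0 n) hn x (by rwa [sub_sub]) μ hμ
      linarith
  obtain ⟨X, hX⟩ := hev.choice
  have hXu : ∀ n, y + t n • ((t n)⁻¹ • (X n - y)) = X n := fun n => by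
    rw [smul_inv_smul₀ (ht0 n).ne']
    abel
  refine ⟨t, fun n => (t n)⁻¹ • (X n - y), ht0, ht, ?_, ?_⟩
  · have h0 : Tendsto (fun n => (t n)⁻¹ • (X n - y) - w n) atTop (𝓝 0) := by
      refine squeeze_zero_norm' ?_ hδ
      filter_upwards [hX] with n hn
      have h1 : (t n)⁻¹ • (X n - y) - w n = (t n)⁻¹ • (X n - (y + t n • w n)) := by
        rw [← sub_sub (X n), smul_sub _ (X n - y), inv_smul_smul₀ (ht0 n).ne']
      rw [h1, norm_smul, norm_inv, Real.norm_of_nonneg (ht0 n).le, inv_mul_le_iff₀ (ht0 n)]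
      exact hn.2
    exact tendsto_nhds_of_eq ((h0.add hw).congr fun n => sub_add_cancel _ _) (zero_add v)
  · filter_upwards [hX] with n hn j hj
    rw [hXu]
    exact hn.1 j hj

theorem MaximalJ.exists_feasible_arc (hq : ContDiff ℝ 2 q) (hy : y ∈ Gam q) (hv : v ∈ Tlin q y)
    {z : Em m} (hz : z ∈ Xibar q y v) {J I : Set (Fin l)} (hJ : MaximalJ q y v J)
    (h2 : TwoRegular q y v J) (hzJ : Jset q y v z ⊆ J) (hI : I ⊆ Jset q y v z) :
    ∃ (t : ℕ → ℝ) (uk : ℕ → Em m), (∀ k, 0 < t k) ∧ Tendsto t atTop (𝓝 0) ∧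
      Tendsto uk atTop (𝓝 v) ∧
      ∀ k, y + t k • uk k ∈ Gam q ∧ actI q (y + t k • uk k) = I := by
  classical
  have hJI : ∀ j ∈ J, j ∈ IbarDir q y v := by
    obtain ⟨z', _, rfl⟩ := hJ.1
    exact fun j hj => hj.1
  obtain ⟨t, uk, ht0, ht, hu, he⟩ := h2.exists_arc hq hJI z fun j => if j ∈ I then 0 else 1
  set g : Fin l → ℝ := fun i => gradQ q y i z + hessQ q y i v v with hg
  have hgrad : ∀ i ∈ IbarDir q y v,
      Tendsto (fun k => (t k ^ 2)⁻¹ * (t k * gradQ q y i (uk k))) atTop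
        (𝓝 (1 / 2 * gradQ q y i z)) := by
    have hj : ∀ j ∈ J, Tendsto (fun k => (t k ^ 2)⁻¹ * (t k * gradQ q y j (uk k))) atTop
        (𝓝 (1 / 2 * gradQ q y j z)) := fun j hj => by
      have h1 : Tendsto (fun k => 1 / 2 * g j - t k * (if j ∈ I then 0 else 1)) atTop
          (𝓝 (1 / 2 * g j)) :=
        tendsto_nhds_of_eq (tendsto_const_nhds.sub (ht.mul_const _)) (by simp)
      refine tendsto_nhds_of_eq ((h1.sub (tendsto_taylor_two hq y ht0 ht hu j)).congr' ?_)
        (by simp only [hg]; ring)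
      filter_upwards [he] with k hk
      have h3 := (ht0 k).ne'
      rw [hk j hj, (hJI j hj).1]
      field_simp
      ring
    intro i hi
    obtain ⟨μ, hμ, hμe⟩ := hJ.exists_gradQ_comb hv hi
    have h1 : Tendsto (fun k => ∑ j, μ j * ((t k ^ 2)⁻¹ * (t k * gradQ q y j (uk k)))) atTop
        (𝓝 (∑ j, μ j * (1 / 2 * gradQ q y j z))) := by
      refine tendsto_finsetSum _ fun j _ => ?_
      by_cases hjJ : j ∈ J
      · exact (hj j hjJ).const_mul _
      · simp [hμ j hjJ]
    refine tendsto_nhds_of_eq (h1.congr fun k => ?_) ?_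
    · rw [hμe, Finset.mul_sum, Finset.mul_sum]
      exact Finset.sum_congr rfl fun j _ => by ring
    · rw [hμe, Finset.mul_sum]
      exact Finset.sum_congr rfl fun j _ => by ring
  have hneg : ∀ i ∉ I, ∀ᶠ k in atTop, q (y + t k • uk k) i < 0 := by
    intro i hiI
    by_cases hiJ : i ∈ J
    · filter_upwards [he] with k hk
      have h1 : g i ≤ 0 := hz i (hJI i hiJ).1
      have h3 := ht0 k
      rw [hk i hiJ, if_neg hiI]
      have h4 : 0 < t k ^ 3 := by positivity
      have h5 : t k ^ 2 * (1 / 2 * g i) ≤ 0 :=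
        mul_nonpos_of_nonneg_of_nonpos (by positivity) (by linarith)
      simp only [hg] at h5
      linarith
    by_cases hiv : i ∈ IbarDir q y v
    · have h1 : 1 / 2 * hessQ q y i v v + 1 / 2 * gradQ q y i z < 0 := by
        have h2 : g i ≤ 0 := hz i hiv.1
        have h3 : g i ≠ 0 := fun h => hiJ (hzJ ⟨hiv, h⟩)
        have h4 : g i < 0 := lt_of_le_of_ne h2 h3
        simp only [hg] at h4
        linarith
      filter_upwards [((tendsto_taylor_two hq y ht0 ht hu i).add (hgrad i hiv)).eventually
        (gt_mem_nhds h1)] with k hk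
      rw [← mul_add, sub_add_cancel, hiv.1, sub_zero] at hk
      exact (pos_iff_neg_of_mul_neg hk).1 (by have := ht0 k; positivity)
    by_cases hia : i ∈ actI q y
    · have h1 : gradQ q y i v < 0 := lt_of_le_of_ne (hv i hia) fun h => hiv ⟨hia, h⟩
      filter_upwards [(tendsto_gradQ_of_quotient (y := y) hq ht0 ht hu i).eventually
        (gt_mem_nhds h1)] with k hk
      rw [show q y i = 0 from hia, sub_zero] at hk
      exact (pos_iff_neg_of_mul_neg hk).1 (by have := ht0 k; positivity)
    · have h1 : q y i < 0 := lt_of_le_of_ne (hy i) hia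
      exact ((continuous_apply_of_contDiff_two hq i).continuousAt.tendsto.comp
        (tendsto_add_smul y ht hu)).eventually (gt_mem_nhds h1)
  have hall : ∀ᶠ k in atTop, y + t k • uk k ∈ Gam q ∧ actI q (y + t k • uk k) = I := by
    have hneg' : ∀ᶠ k in atTop, ∀ i, i ∉ I → q (y + t k • uk k) i < 0 :=
      eventually_all.2 fun i => by
        by_cases hi : i ∈ I
        · exact Eventually.of_forall fun k h => absurd hi h
        · filter_upwards [hneg i hi] with k hk _ using hk
    filter_upwards [he, hneg'] with k hk hk'
    have h0 : ∀ i ∈ I, q (y + t k • uk k) i = 0 := fun i hi => by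
      have h3 : gradQ q y i z + hessQ q y i v v = 0 := (hI hi).2
      rw [hk i (hzJ (hI hi)), h3, if_pos hi]
      ring
    refine ⟨fun i => ?_, Set.ext fun i => ⟨fun h => ?_, h0 i⟩⟩
    · by_cases hi : i ∈ I
      · exact (h0 i hi).le
      · exact (hk' i hi).le
    · by_contra hi
      exact (hk' i hi).ne h
  obtain ⟨N, hN⟩ := eventually_atTop.1 hall
  exact ⟨fun k => t (k + N), fun k => uk (k + N), fun k => ht0 _,
    (tendsto_add_atTop_iff_nat N).2 ht, (tendsto_add_atTop_iff_nat N).2 hu,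
    fun k => hN _ (Nat.le_add_left N k)⟩

theorem mem_regNormalConeP_of_licq (hq : ContDiff ℝ 2 q) {C : ℝ} (hC0 : 0 ≤ C)
    (hs : ∀ᶠ x in 𝓝 y, x ∈ Gam q → SubregAt q x C) (hl : lam ∈ NRl q y)
    (hlicq : ∀ μ : Em l, (∀ i ∉ actI q y, μ i = 0) → gradT q y μ = 0 → μ = 0) {p : Em m × Em m}
    (hp2 : p.2 ∈ Kcone q y (Iplus lam) (actI q y))
    (hp1 : p.1 + hessT q y lam p.2 ∈ polarCone (Kcone q y (Iplus lam) (actI q y))) :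
    p ∈ regNormalConeP (GphNhat q) (y, gradT q y lam) := by
  rintro ⟨h, hst⟩ ⟨t, hk, ht0, ht, hlim, hmem⟩
  have hlim1 : Tendsto (fun k => (hk k).1) atTop (𝓝 h) := (continuous_fst.tendsto _).comp hlim
  have hlim2 : Tendsto (fun k => (hk k).2) atTop (𝓝 hst) := (continuous_snd.tendsto _).comp hlim
  have hyk := tendsto_add_smul y ht hlim1
  have hxk := tendsto_add_smul (gradT q y lam) ht hlim2
  have hh : h ∈ tanCone (Gam q) y := ⟨t, _, ht0, ht, hlim1, fun k => (hmem k).1⟩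
  have hmult : ∀ᶠ k in atTop, ∃ a ∈ Lam q (y + t k • (hk k).1) (gradT q y lam + t k • (hk k).2),
      ∀ i, a i ≤ C * ‖gradT q y lam + t k • (hk k).2‖ := by
    filter_upwards [hyk.eventually hs] with k hk
    exact exists_bounded_multiplier hq hC0 (hk (hmem k).1) (hmem k).1 (hmem k).2
  obtain ⟨N, hN⟩ := eventually_atTop.1 hmult
  choose! a ha hab using hN
  obtain ⟨R, hR0, hR⟩ := exists_norm_bound_of_tendsto hxk
  obtain ⟨φ, hφ, -, lam', -, hlam'⟩ := exists_subseq_const_tendsto (fun _ => ())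
    (isBounded_nonneg_le l (C * R)) (g := fun k => a (k + N)) fun k i =>
      ⟨(ha _ (Nat.le_add_left N k)).1.1 i, (hab _ (Nat.le_add_left N k) i).trans
        (mul_le_mul_of_nonneg_left (hR _) hC0)⟩
  have hψ : Tendsto (fun k => φ k + N) atTop atTop :=
    (tendsto_add_atTop_iff_nat N).2 tendsto_id |>.comp hφ.tendsto_atTop
  set s : ℕ → ℝ := fun k => t (φ k + N)
  set yk : ℕ → Em m := fun k => (hk (φ k + N)).1
  set xk : ℕ → Em m := fun k => (hk (φ k + N)).2
  set lk : ℕ → Em l := fun k => a (φ k + N)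
  have hs0 : ∀ k, 0 < s k := fun k => ht0 _
  have hst0 : Tendsto s atTop (𝓝 0) := ht.comp hψ
  have hyk1 : Tendsto yk atTop (𝓝 h) := hlim1.comp hψ
  have hxk1 : Tendsto xk atTop (𝓝 hst) := hlim2.comp hψ
  have hy1 : Tendsto (fun k => y + s k • yk k) atTop (𝓝 y) := tendsto_add_smul y hst0 hyk1
  have hlk : ∀ k, lk k ∈ Lam q (y + s k • yk k) (gradT q y lam + s k • xk k) :=
    fun k => ha _ (Nat.le_add_left N _)
  have hlk' : Tendsto lk atTop (𝓝 lam') := hlam'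
  have hqi : ∀ i, Tendsto (fun k => q (y + s k • yk k) i) atTop (𝓝 (q y i)) := fun i =>
    (continuous_apply_of_contDiff_two hq i).continuousAt.tendsto.comp hy1
  have hzero : ∀ i ∉ actI q y, ∀ᶠ k in atTop, lk k i = 0 := fun i hi => by
    filter_upwards [(hqi i).eventually_ne hi] with k hk using (hlk k).1.2 i hk
  have happ : ∀ i, Tendsto (fun k => lk k i) atTop (𝓝 (lam' i)) := fun i =>
    ((EuclideanSpace.proj (𝕜 := ℝ) i).continuous.tendsto _).comp hlk'
  have heq : lam' = lam := by
    refine sub_eq_zero.1 (hlicq _ (fun i hi => ?_) ?_)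
    · have h1 : lam' i = 0 := tendsto_nhds_unique (happ i)
        (tendsto_const_nhds.congr' ((hzero i hi).mono fun k hk => hk.symm))
      rw [PiLp.sub_apply, h1, hl.2 i hi, sub_zero]
    · rw [gradT_sub, sub_eq_zero]
      refine tendsto_nhds_unique (tendsto_gradT hq hy1 hlk') ?_
      exact (tendsto_add_smul (gradT q y lam) hst0 hxk1).congr fun k => (hlk k).2.symm
  subst heq
  have hhK : h ∈ Kcone q y (Iplus lam') (actI q y) := by
    refine ⟨fun i hi => ?_, fun i hi => gradQ_nonpos_of_mem_tanCone hq hh hi.1⟩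
    have hi0 : q y i = 0 := Iplus_subset_actI hl hi
    refine tendsto_nhds_unique (tendsto_gradQ_of_quotient (y := y) hq hs0 hst0 hyk1 i)
      (tendsto_const_nhds.congr' ?_)
    filter_upwards [(happ i).eventually (lt_mem_nhds (show 0 < lam' i from hi))] with k hk
    have h1 : q (y + s k • yk k) i = 0 := by
      by_contra h
      exact hk.ne' ((hlk k).1.2 i h)
    rw [h1, hi0, sub_zero, mul_zero]
  have hd : Tendsto (fun k => (s k)⁻¹ • gradT q y (lk k - lam')) atTop
      (𝓝 (hst - hessT q y lam' h)) := by
    refine (hxk1.sub (tendsto_gradT_quotient hq y hs0 hst0 hyk1 hlk')).congr fun k => ?_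
    rw [(hlk k).2, gradT_sub]
    have h1 : xk k = (s k)⁻¹ • (s k • xk k) := (inv_smul_smul₀ (hs0 k).ne' _).symm
    nth_rewrite 1 [h1]
    rw [← smul_sub]
    congr 1
    abel
  have hle : ⟪hst - hessT q y lam' h, p.2⟫ ≤ 0 := by
    refine le_of_tendsto (hd.inner tendsto_const_nhds) ?_
    have hz : ∀ᶠ k in atTop, ∀ i, i ∉ actI q y → lk k i = 0 := eventually_all.2 fun i => by
      by_cases hi : i ∈ actI q y
      · exact Eventually.of_forall fun k h => absurd hi h
      · filter_upwards [hzero i hi] with k hk _ using hk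
    filter_upwards [hz] with k hk
    rw [real_inner_smul_left, inner_gradT]
    refine mul_nonpos_of_nonneg_of_nonpos (inv_nonneg.2 (hs0 k).le)
      (Pset_sum_nonpos (F := Iplus lam') (I := actI q y) ⟨fun i hi => ?_, fun i hi => ?_⟩ hp2.1 hp2.2)
    · rw [PiLp.sub_apply, hk i hi, hl.2 i hi, sub_zero]
    · have h1 : lam' i = 0 := le_antisymm (not_lt.1 hi.2) (hl.1 i)
      rw [PiLp.sub_apply, h1, sub_zero]
      exact (hlk k).1.1 i
  have h1 := hp1 h hhK
  rw [inner_add_left, inner_hessT_symm hq] at h1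
  rw [inner_sub_left] at hle
  change ⟪p.1, h⟫ + ⟪p.2, hst⟫ ≤ 0
  rw [real_inner_comm] at hle
  linarith

theorem mem_limNormalConeP_of_mem_unionQ (hq : ContDiff ℝ 2 q) (hy : y ∈ Gam q)
    (hvic : MetricallyRegularInVicinity q y)
    (h2reg : ∀ u ∈ Kbar q y x, u ≠ 0 → ∀ J, MaximalJ q y u J → TwoRegular q y u J)
    {vstar : Em m} (hv0 : v ≠ 0) (hv : (v, vstar) ∈ tanCone (GphNhat q) (y, x))
    {p : Em m × Em m} (hp : p ∈ unionQ q y x v vstar) : p ∈ limNormalConeP (GphNhat q) (y, x) := by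
  classical
  obtain ⟨C, hC, hCs⟩ := exists_subregAt_of_vicinity hvic
  have hvK : v ∈ Kbar q y x ∧ v ∈ Tlin q y := by
    obtain ⟨t, hk, ht0, ht, hlim, hmem⟩ := hv
    have hlim1 : Tendsto (fun k => (hk k).1) atTop (𝓝 v) := (continuous_fst.tendsto _).comp hlim
    have hlim2 : Tendsto (fun k => (hk k).2) atTop (𝓝 vstar) :=
      (continuous_snd.tendsto _).comp hlim
    have hx := tendsto_add_smul x ht hlim2
    obtain ⟨φ, hφ, lk, a, P, I, hlk, h⟩ :=
      exists_subseq_multipliers hq hC.le hCs ht0 ht hlim1 hv0 hx hmem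
    have hφ' := hφ.tendsto_atTop
    exact ⟨(limit_multiplier_properties hq (fun k => ht0 (φ k)) (ht.comp hφ') (hlim1.comp hφ')
      (hx.comp hφ') (fun k => (hmem (φ k)).1) hlk (fun k => (h k).2.1) (fun k => (h k).2.2.1)
      (fun k => (h k).2.2.2)).2.2.1, fun i hi => gradQ_nonpos_of_mem_tanCone hq
        ⟨t, _, ht0, ht, hlim1, fun k => (hmem k).1⟩ hi⟩
  obtain ⟨lam, mu, ⟨hlam, -, -⟩, J, hJ, P, I, hP, hPI, hIJ, hp2, hp1⟩ := hp
  obtain ⟨J', hJJ', hmax⟩ := exists_maximalJ hJ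
  obtain ⟨z, hz, rfl⟩ := hJ
  have h2 := h2reg v hvK.1 hv0 J' hmax
  obtain ⟨t, uk, ht0, ht, hu, hmem⟩ := hmax.exists_feasible_arc hq hy hvK.2 hz h2 hJJ' hIJ
  obtain ⟨c, hc, hlow⟩ := h2.eventually_lower_bound hq ht0 ht hu
  have hyk := tendsto_add_smul y ht hu
  have hev : ∀ᶠ k in atTop, (∀ μ : Em l, (∀ i ∉ J', μ i = 0) →
      c * t k * ‖μ‖ ≤ ‖gradT q (y + t k • uk k) μ‖) ∧ y + t k • uk k ≠ y ∧
      ∀ᶠ x in 𝓝 (y + t k • uk k), x ∈ Gam q → x ≠ y → SubregAt q x C := by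
    filter_upwards [hlow, hu.eventually_ne hv0, hyk.eventually hCs.eventually_nhds]
      with k h1 h2 h3
    refine ⟨h1, fun h => h2 ?_, h3⟩
    rw [add_eq_left, smul_eq_zero] at h
    exact h.resolve_left (ht0 k).ne'
  obtain ⟨N, hN⟩ := eventually_atTop.1 hev
  replace hN := fun k => hN (k + N) (Nat.le_add_left N k)
  have htN := (tendsto_add_atTop_iff_nat N).2 ht
  have huN := (tendsto_add_atTop_iff_nat N).2 hu
  have hykN := tendsto_add_smul y htN huN
  have hsub : ∀ {μ : Em l}, (∀ i ∉ I, μ i = 0) → ∀ i ∉ J', μ i = 0 :=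
    fun h i hi => h i fun hI => hi (hJJ' (hIJ hI))
  obtain ⟨wk, hwk, hw⟩ := exists_Kcone_tendsto hq hPI (fun k => ht0 (k + N)) htN huN hc
    (fun k μ hμ => (hN k).1 μ (hsub hμ)) hp2
  obtain ⟨ak, hak, ha⟩ := exists_polarCone_Kcone_tendsto hq hPI (fun k => ht0 (k + N)) htN huN hp1
  set χ : Em l := WithLp.toLp 2 fun i => if i ∈ P then 1 else 0
  have hχ : ∀ i, χ i = if i ∈ P then 1 else 0 := fun i => rfl
  set lk : ℕ → Em l := fun k => lam + ((k : ℝ) + 1)⁻¹ • χ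
  have hlk : Tendsto lk atTop (𝓝 lam) := tendsto_nhds_of_eq
    (tendsto_const_nhds.add (tendsto_inv_natCast_add_one.smul_const χ)) (by simp)
  have hlkP : ∀ k, ∀ i ∈ P, 0 < lk k i := fun k i hi => by
    have h1 := hlam.1.1.1 i
    have h2 : lk k i = lam i + ((k : ℝ) + 1)⁻¹ * χ i := rfl
    rw [h2, hχ, if_pos hi]
    positivity
  have hlk0 : ∀ k, ∀ i ∉ P, lk k i = 0 := fun k i hi => by
    have h1 : lam i = 0 := le_antisymm (not_lt.1 fun h => hi (hP (Or.inl h))) (hlam.1.1.1 i)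
    have h2 : lk k i = lam i + ((k : ℝ) + 1)⁻¹ * χ i := rfl
    rw [h2, hχ, if_neg hi, h1]
    simp
  have hIp : ∀ k, Iplus (lk k) = P := fun k => Set.ext fun i =>
    ⟨fun h => by_contra fun hi => (show 0 < lk k i from h).ne' (hlk0 k i hi), hlkP k i⟩
  have hNR : ∀ k, lk k ∈ NRl q (y + t (k + N) • uk (k + N)) := fun k => by
    refine ⟨fun i => ?_, fun i hi => hlk0 k i fun hiP => hi ?_⟩
    · by_cases hi : i ∈ P
      · exact (hlkP k i hi).le
      · exact (hlk0 k i hi).ge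
    · have h1 : i ∈ actI q (y + t (k + N) • uk (k + N)) := (hmem (k + N)).2 ▸ hPI hiP
      exact h1
  refine ⟨fun k => (y + t (k + N) • uk (k + N), gradT q (y + t (k + N) • uk (k + N)) (lk k)),
    fun k => (ak k - hessT q (y + t (k + N) • uk (k + N)) (lk k) (wk k), wk k),
    fun k => ⟨(hmem (k + N)).1, gradT_mem_regNormalCone hq (hNR k)⟩, fun k => ?_, ?_, ?_⟩
  · refine mem_regNormalConeP_of_licq hq hC.le ?_ (hNR k) ?_ ?_ ?_
    · filter_upwards [(hN k).2.2, eventually_ne_nhds (hN k).2.1] with x h1 h2 h3 using h1 h3 h2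
    · rw [(hmem (k + N)).2]
      exact fun μ hμ h0 => eq_zero_of_lower_bound (mul_pos hc (ht0 (k + N))) (hN k).1 (hsub hμ) h0
    · rw [hIp, (hmem (k + N)).2]
      exact hwk k
    · rw [hIp, (hmem (k + N)).2]
      simpa using hak k
  · have h1 := tendsto_gradT hq hykN hlk
    rw [hlam.1.2] at h1
    exact hykN.prodMk_nhds h1
  · refine tendsto_nhds_of_eq ((ha.sub (tendsto_hessT hq hykN hlk hw)).prodMk_nhds hw) ?_
    rw [add_sub_cancel_right]

theorem regNormalConeP_subset_limNormalConeP {E F : Type*} [NormedAddCommGroup E]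
    [InnerProductSpace ℝ E] [NormedAddCommGroup F] [InnerProductSpace ℝ F] {Ω : Set (E × F)}
    {z : E × F} (hz : z ∈ Ω) : regNormalConeP Ω z ⊆ limNormalConeP Ω z := fun p hp =>
  ⟨fun _ => z, fun _ => p, fun _ => hz, fun _ => hp, tendsto_const_nhds, tendsto_const_nhds⟩

end LimitingNormals

/-- Theorem 8: full description of the limiting normal cone to `gph N̂_Γ`. -/
theorem statement_17 {m l : ℕ} (q : Em m → Em l) (hq : ContDiff ℝ 2 q)
    (yb ystar : Em m) (hy : yb ∈ Gam q) (hys : ystar ∈ regNormalCone (Gam q) yb)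
    (hsub : MetricallySubregularAt (Mq q) yb (0 : Em l))
    (hvic : MetricallyRegularInVicinity q yb)
    (h2reg : ∀ u ∈ Kbar q yb ystar, u ≠ 0 →
      ∀ J : Set (Fin l), MaximalJ q yb u J → TwoRegular q yb u J)
    (hN : Nspace q yb ≠ {0}) :
    limNormalConeP (GphNhat q) (yb, ystar) =
      regNormalConeP (GphNhat q) (yb, ystar) ∪
      {p | ∃ v vstar : Em m, v ≠ 0 ∧ (v, vstar) ∈ tanCone (GphNhat q) (yb, ystar) ∧
        p ∈ unionQ q yb ystar v vstar} := by
  refine Subset.antisymm (fun p hp => Or.inr ?_) (union_subset ?_ ?_)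
  · exact exists_mem_unionQ_of_mem_limNormalConeP hq hy hsub hvic h2reg hN hp
  · exact regNormalConeP_subset_limNormalConeP ⟨hy, hys⟩
  · rintro p ⟨v, vstar, hv0, hv, hp⟩
    exact mem_limNormalConeP_of_mem_unionQ hq hy hvic h2reg hv0 hv hp
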